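/- For any two infinite, finitely generated groups H and K, the set M_SFT(H × K) contains a nonzero Medvedev degree, i.e. H × K admits a nonempty SFT with m(X) > 0_M. Moreover, if H and K are recursively presented, then M_SFT(H × K) contains a degree greater than or equal to the maximal Π⁰₁ Medvedev degree. -/

import Mathlib

namespace MedvedevFormal

/-! ### Medvedev reducibility on Baire space -/

/-- The finite prefix of length `k` of a point of Baire space, as a list. -/
def pref (x : ℕ → ℕ) (k : ℕ) : List ℕ := (List.range k).map x

/-- Medvedev reducibility `m(P) ≤ m(Q)` between subsets of Baire space: some computable
monotone prefix-functional (i.e. a partial computable type-two functional), defined on all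
of `Q`, maps every element of `Q` to an element of `P`. -/
def BaireLE (P Q : Set (ℕ → ℕ)) : Prop :=
  ∃ φ : List ℕ → List ℕ, Computable φ ∧
    (∀ l₁ l₂ : List ℕ, l₁ <+: l₂ → φ l₁ <+: φ l₂) ∧
    ∀ x ∈ Q, ∃ y ∈ P, ∀ n : ℕ, ∃ k : ℕ, (φ (pref x k))[n]? = some (y n)

/-- Medvedev equivalence: `m(P) = m(Q)`. -/
def BaireEquiv (P Q : Set (ℕ → ℕ)) : Prop := BaireLE P Q ∧ BaireLE Q P

/-- A canonical representative of the join `m(P) ∨ m(Q)`. -/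
def joinSet (P Q : Set (ℕ → ℕ)) : Set (ℕ → ℕ) :=
  {x | (fun n => x (2 * n)) ∈ P ∧ (fun n => x (2 * n + 1)) ∈ Q}

/-- A canonical representative of the meet `m(P) ∧ m(Q)`. -/
def meetSet (P Q : Set (ℕ → ℕ)) : Set (ℕ → ℕ) :=
  {x | (x 0 = 0 ∧ (fun n => x (n + 1)) ∈ P) ∨ (x 0 = 1 ∧ (fun n => x (n + 1)) ∈ Q)}

/-- `P` has the zero Medvedev degree `0_M`: it contains a computable point. -/
def IsZeroDeg (P : Set (ℕ → ℕ)) : Prop := ∃ y ∈ P, Computable y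

/-- The cylinder of a finite word in Baire space. -/
def cylinder (l : List ℕ) : Set (ℕ → ℕ) :=
  {x | ∀ (i : ℕ) (h : i < l.length), x i = l[i]}

/-- Cantor space `{0,1}^ℕ` inside Baire space. -/
def cantorSpace : Set (ℕ → ℕ) := {x | ∀ n, x n ≤ 1}

/-- `P` is an effectively closed (`Π⁰₁`) subset of Cantor space: its complement within
Cantor space is the union of the cylinders of a computably enumerable sequence of words. -/
def IsPi01Cantor (P : Set (ℕ → ℕ)) : Prop :=
  ∃ f : ℕ → List ℕ, Computable f ∧ P = cantorSpace \ ⋃ n, cylinder (f n)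

/-- The Medvedev degree of `P` is a `Π⁰₁` Medvedev degree. -/
def IsPi01Deg (P : Set (ℕ → ℕ)) : Prop :=
  ∃ Q, IsPi01Cantor Q ∧ Q.Nonempty ∧ BaireEquiv P Q

/-- `P` realizes the maximal `Π⁰₁` Medvedev degree (the degree of the class of complete
consistent extensions of Peano arithmetic): it is a nonempty `Π⁰₁` subset of Cantor space
to which every nonempty `Π⁰₁` subset of Cantor space is Medvedev reducible. -/
def IsMaxPi01 (P : Set (ℕ → ℕ)) : Prop :=
  IsPi01Cantor P ∧ P.Nonempty ∧ ∀ Q, IsPi01Cantor Q → Q.Nonempty → BaireLE Q P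

/-! ### Encoding of configuration spaces -/

/-- The canonical encoding of a configuration `x : α → A` as a point of Baire space. -/
def confFun {α A : Type*} [Encodable α] [Encodable A] (x : α → A) : ℕ → ℕ :=
  fun n => Encodable.encode ((Encodable.decode (α := α) n).map x)

/-- The image of a set of configurations in Baire space, used to measure its
Medvedev degree. -/
def mSet {α A : Type*} [Encodable α] [Encodable A] (X : Set (α → A)) : Set (ℕ → ℕ) :=
  confFun '' X

/-- A configuration is computable if its Baire-space encoding is computable. -/
def ComputablePoint {α A : Type*} [Encodable α] [Encodable A] (x : α → A) : Prop :=
  Computable (confFun x)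

/-- `m(X) ≤ m(Y)` for sets of configurations. -/
def MedLE {α A β B : Type*} [Encodable α] [Encodable A] [Encodable β] [Encodable B]
    (X : Set (α → A)) (Y : Set (β → B)) : Prop :=
  BaireLE (mSet X) (mSet Y)

/-- `m(X) = m(Y)` for sets of configurations. -/
def MedEquiv {α A β B : Type*} [Encodable α] [Encodable A] [Encodable β] [Encodable B]
    (X : Set (α → A)) (Y : Set (β → B)) : Prop :=
  MedLE X Y ∧ MedLE Y X

/-! ### Subshifts -/

/-- The left shift action: `(g • x) h = x (g⁻¹ h)`. -/
def shift {G A : Type*} [Group G] (g : G) (x : G → A) : G → A := fun h => x (g⁻¹ * h)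

/-- The prodiscrete topology on `A^G`. -/
def prodiscrete (G A : Type*) : TopologicalSpace (G → A) :=
  @Pi.topologicalSpace G (fun _ => A) fun _ => ⊥

/-- A subshift: a shift-invariant subset of `A^G`, closed in the prodiscrete topology. -/
def IsSubshift {G A : Type*} [Group G] (X : Set (G → A)) : Prop :=
  (∀ x ∈ X, ∀ g : G, shift g x ∈ X) ∧ @IsClosed (G → A) (prodiscrete G A) X

/-- A pattern: a map `p : D → A` with `D ⊆ G` finite. -/
structure Pattern (G A : Type*) where
  dom : Finset G
  val : {g // g ∈ dom} → A

/-- The translate `g • x` agrees with the pattern `p` on its domain. -/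
def MatchesAt {G A : Type*} [Group G] (p : Pattern G A) (g : G) (x : G → A) : Prop :=
  ∀ h : {g' // g' ∈ p.dom}, shift g x h = p.val h

/-- A subshift of finite type: defined by a finite list of forbidden patterns. -/
def IsSFT {G A : Type*} [Group G] (X : Set (G → A)) : Prop :=
  ∃ F : List (Pattern G A), X = {x | ∀ p ∈ F, ∀ g : G, ¬MatchesAt p g x}

/-- A morphism between subshifts: a continuous shift-equivariant map from `X` to `Y`. -/
def IsMorphism {G A B : Type*} [Group G] (X : Set (G → A)) (Y : Set (G → B))
    (φ : (G → A) → (G → B)) : Prop :=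
  Set.MapsTo φ X Y ∧
    @ContinuousOn (G → A) (G → B) (prodiscrete G A) (prodiscrete G B) φ X ∧
    ∀ x ∈ X, ∀ g : G, φ (shift g x) = shift g (φ x)

/-- A sofic subshift: the image of an SFT (on some finite alphabet) under a topological
factor map. -/
def IsSofic {G A : Type*} [Group G] (X : Set (G → A)) : Prop :=
  ∃ (B : Type) (_ : Finite B) (Y : Set (G → B)) (φ : (G → B) → (G → A)),
    IsSFT Y ∧ IsMorphism Y X φ ∧ φ '' Y = X

/-! ### Finitely generated groups, covers and pullbacks -/

/-- `σ` enumerates a finite symmetric generating set of `G`. -/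
def IsSymmGen {G : Type*} [Group G] {k : ℕ} (σ : Fin k → G) : Prop :=
  Subgroup.closure (Set.range σ) = ⊤ ∧ ∀ i, (σ i)⁻¹ ∈ Set.range σ

/-- The canonical encoding of a free group via reduced words. -/
instance freeGroupEncodable {α : Type*} [DecidableEq α] [Encodable α] :
    Encodable (FreeGroup α) :=
  Encodable.ofLeftInjection FreeGroup.toWord (fun l => some (FreeGroup.mk l))
    fun _ => congrArg some FreeGroup.mk_toWord

/-- The canonical homomorphism from the free group determined by `σ`. -/
def cover {G : Type*} [Group G] {k : ℕ} (σ : Fin k → G) : FreeGroup (Fin k) →* G :=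
  FreeGroup.lift σ

/-- The pullback of a subshift along a group homomorphism. -/
def pullback {K G A : Type*} [Group K] [Group G] (ρ : K →* G) (X : Set (G → A)) :
    Set (K → A) :=
  (fun x => x ∘ ρ) '' X

/-- The group element represented by a word over the generators. -/
def wordVal {G : Type*} [Group G] {k : ℕ} (σ : Fin k → G) (w : List (Fin k × Bool)) : G :=
  cover σ (FreeGroup.mk w)

/-- `G` is recursively presented w.r.t. `σ`: its word problem is recursively enumerable. -/
def RecursivelyPresented {G : Type*} [Group G] {k : ℕ} (σ : Fin k → G) : Prop :=
  ∃ f : ℕ → Option (List (Fin k × Bool)), Computable f ∧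
    ∀ w : List (Fin k × Bool), (wordVal σ w = 1 ↔ ∃ n, f n = some w)

/-- The membership problem of the subgroup `H` in `G` is decidable w.r.t. `σ`. -/
def DecidableMembership {G : Type*} [Group G] {k : ℕ} (σ : Fin k → G)
    (H : Subgroup G) : Prop :=
  ∃ φ : List (Fin k × Bool) → Bool, Computable φ ∧
    ∀ w : List (Fin k × Bool), (φ w = true ↔ wordVal σ w ∈ H)

/-- `G` has decidable word problem w.r.t. `σ`. -/
def DecidableWordProblem {G : Type*} [Group G] {k : ℕ} (σ : Fin k → G) : Prop :=
  ∃ φ : List (Fin k × Bool) → Bool, Computable φ ∧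
    ∀ w : List (Fin k × Bool), (φ w = true ↔ wordVal σ w = 1)

/-- The set of configurations on the free group matching a coded pattern: a pattern is
coded as a list of pairs (code of a group element, code of a letter). -/
def codedCylinder {k : ℕ} {A : Type*} [Encodable A] (p : List (ℕ × ℕ)) :
    Set (FreeGroup (Fin k) → A) :=
  {x | ∀ q ∈ p, ∀ g : FreeGroup (Fin k),
    Encodable.encode g = q.1 → Encodable.encode (x g) = q.2}

/-- `X` is an effective subshift: the complement of its pullback to the free group is the
union of the cylinders of a computably enumerable sequence of finitely supported patterns. -/
def IsEffective {G : Type*} [Group G] {k : ℕ} (σ : Fin k → G) {A : Type*} [Encodable A]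
    (X : Set (G → A)) : Prop :=
  ∃ f : ℕ → List (ℕ × ℕ), Computable f ∧
    (pullback (cover σ) X)ᶜ = ⋃ n, codedCylinder (f n)

/-! ### Degree spectra -/

/-- The Medvedev degree of `P` belongs to `M_SFT(G)`: some nonempty `G`-SFT has the
Medvedev degree of `P`. -/
def IsSFTDeg {G : Type*} [Group G] {k : ℕ} (σ : Fin k → G) (P : Set (ℕ → ℕ)) : Prop :=
  ∃ (n : ℕ) (X : Set (G → Fin n)), IsSFT X ∧ X.Nonempty ∧
    BaireEquiv (mSet (pullback (cover σ) X)) P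

/-- The Medvedev degree of `P` belongs to `M_sof(G)`. -/
def IsSoficDeg {G : Type*} [Group G] {k : ℕ} (σ : Fin k → G) (P : Set (ℕ → ℕ)) : Prop :=
  ∃ (n : ℕ) (X : Set (G → Fin n)), IsSofic X ∧ X.Nonempty ∧
    BaireEquiv (mSet (pullback (cover σ) X)) P

/-- The Medvedev degree of `P` belongs to `M_eff(G)`. -/
def IsEffDeg {G : Type*} [Group G] {k : ℕ} (σ : Fin k → G) (P : Set (ℕ → ℕ)) : Prop :=
  ∃ (n : ℕ) (X : Set (G → Fin n)), IsSubshift X ∧ IsEffective σ X ∧ X.Nonempty ∧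
    BaireEquiv (mSet (pullback (cover σ) X)) P

/-! ### Word metrics and quasi-isometries -/

/-- The word length of `g` w.r.t. the (symmetric) generating map `σ`. -/
noncomputable def wordNorm {G : Type*} [Group G] {k : ℕ} (σ : Fin k → G) (g : G) : ℕ :=
  sInf {n | ∃ w : List (Fin k), w.length = n ∧ (w.map σ).prod = g}

/-- The word metric on `G` w.r.t. `σ`, as a real number. -/
noncomputable def wordDist {G : Type*} [Group G] {k : ℕ} (σ : Fin k → G) (g g' : G) : ℝ :=
  (wordNorm σ (g⁻¹ * g') : ℝ)

/-- `f : G → H` is a quasi-isometry w.r.t. the word metrics given by `σ` and `τ`. -/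
def IsQIGroups {G H : Type*} [Group G] [Group H] {k r : ℕ} (σ : Fin k → G)
    (τ : Fin r → H) (f : G → H) : Prop :=
  ∃ C : ℝ, 1 ≤ C ∧
    (∀ g g' : G, (1 / C) * wordDist σ g g' - C ≤ wordDist τ (f g) (f g') ∧
      wordDist τ (f g) (f g') ≤ C * wordDist σ g g' + C) ∧
    ∀ h : H, ∃ g : G, wordDist τ h (f g) ≤ C

/-- `f : G → Y` is a quasi-isometry from the group `G` (with word metric from `σ`) to the
metric space `Y`. -/
def IsQIToSpace {G : Type*} [Group G] {k : ℕ} (σ : Fin k → G) {Y : Type*}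
    [MetricSpace Y] (f : G → Y) : Prop :=
  ∃ C : ℝ, 1 ≤ C ∧
    (∀ g g' : G, (1 / C) * wordDist σ g g' - C ≤ dist (f g) (f g') ∧
      dist (f g) (f g') ≤ C * wordDist σ g g' + C) ∧
    ∀ y : Y, ∃ g : G, dist y (f g) ≤ C

/-- `f : G → H` is computable w.r.t. the generating maps `σ` and `τ`: some computable map
on words sends each word representing `g` to a word representing `f g`. -/
def ComputableMap {G H : Type*} [Group G] [Group H] {k r : ℕ} (σ : Fin k → G)
    (τ : Fin r → H) (f : G → H) : Prop :=
  ∃ φ : List (Fin k × Bool) → List (Fin r × Bool), Computable φ ∧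
    ∀ w : List (Fin k × Bool), wordVal τ (φ w) = f (wordVal σ w)

theorem pref_length (x : ℕ → ℕ) (k : ℕ) : (pref x k).length = k := by simp [pref]

theorem pref_getElem? (x : ℕ → ℕ) {k i : ℕ} (h : i < k) : (pref x k)[i]? = some (x i) := by
  simp [pref, h]

theorem pref_prefix (x : ℕ → ℕ) {k l : ℕ} (h : k ≤ l) : pref x k <+: pref x l := by
  rw [List.prefix_iff_eq_take]
  simp [pref, ← List.map_take, List.take_range, h]

theorem pref_succ (x : ℕ → ℕ) (k : ℕ) : pref x (k + 1) = pref x k ++ [x k] := by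
  simp [pref, List.range_succ]

/-- Greedy assembly of a finite output word from a partial output function. -/
def assemble (G : ℕ → Option ℕ) (k : ℕ) : List ℕ :=
  Nat.rec [] (fun _ acc => ((G acc.length).map fun v => acc ++ [v]).getD acc) k

theorem assemble_succ (G : ℕ → Option ℕ) (k : ℕ) : assemble G (k + 1) =
    ((G (assemble G k).length).map fun v => assemble G k ++ [v]).getD (assemble G k) := rfl

theorem assemble_valid (G : ℕ → Option ℕ) (k : ℕ) :
    ∀ i < (assemble G k).length, G i = (assemble G k)[i]? := by
  induction k with
  | zero => simp [assemble]
  | succ k ih =>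
    rw [assemble_succ]
    cases h : G (assemble G k).length with
    | none => simpa using ih
    | some v =>
      intro i hi
      simp only [Option.map_some, Option.getD_some, List.length_append, List.length_singleton]
        at hi ⊢
      rcases Nat.lt_succ_iff_lt_or_eq.1 hi with h1 | rfl
      · rw [ih i h1, List.getElem?_append_left h1]
      · simp [h]

theorem assemble_length_mono {G G' : ℕ → Option ℕ} (h : ∀ n v, G n = some v → G' n = some v)
    {k k' : ℕ} (hk : k ≤ k') : (assemble G k).length ≤ (assemble G' k').length := by
  induction k generalizing k' with
  | zero => simp [assemble]
  | succ k ih =>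
    obtain ⟨k', rfl⟩ : ∃ j, k' = j + 1 := ⟨k' - 1, by omega⟩
    have := ih (k' := k') (by omega)
    rw [assemble_succ, assemble_succ]
    cases h1 : G (assemble G k).length with
    | none =>
      cases h2 : G' (assemble G' k').length <;> simp <;> omega
    | some v =>
      rcases this.lt_or_eq with h3 | h3
      · cases h2 : G' (assemble G' k').length <;> simp <;> omega
      · rw [← h3, h _ _ h1]; simp [h3]

theorem assemble_length_of_total {G : ℕ → Option ℕ} {n : ℕ} (h : ∀ i < n, (G i).isSome)
    {k : ℕ} (hk : k ≤ n) : k ≤ (assemble G k).length := by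
  induction k with
  | zero => simp
  | succ k ih =>
    have := ih (by omega)
    rw [assemble_succ]
    by_cases h3 : (assemble G k).length < n
    · obtain ⟨v, hv⟩ := Option.isSome_iff_exists.1 (h _ h3)
      rw [hv]; simpa using this
    · cases h2 : G (assemble G k).length <;> simp <;> omega

/-- A monotone computable partial output function induces a Medvedev reduction. -/
theorem baireLE_of_partial {P Q : Set (ℕ → ℕ)} (G : List ℕ → ℕ → Option ℕ)
    (hG : Computable₂ G)
    (mono : ∀ l₁ l₂ n v, l₁ <+: l₂ → G l₁ n = some v → G l₂ n = some v)
    (h : ∀ x ∈ Q, ∃ y ∈ P, ∀ n, ∃ k, G (pref x k) n = some (y n)) : BaireLE P Q := by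
  refine ⟨fun l => assemble (G l) l.length, ?_, ?_, ?_⟩
  · have hacc : Computable fun p : List ℕ × ℕ × List ℕ => p.2.2 :=
      Computable.snd.comp Computable.snd
    have h1 : Computable fun p : List ℕ × ℕ × List ℕ => G p.1 p.2.2.length :=
      hG.comp Computable.fst (Computable.list_length.comp hacc)
    have h2 : Computable₂ fun (p : List ℕ × ℕ × List ℕ) (v : ℕ) => p.2.2 ++ [v] :=
      Computable.list_concat.comp (hacc.comp Computable.fst) Computable.snd
    exact Computable.nat_rec (f := fun l : List ℕ => l.length) (g := fun _ => ([] : List ℕ))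
      Computable.list_length (Computable.const _)
      (Computable.option_getD (Computable.option_map h1 h2) hacc).to₂
  · intro l₁ l₂ hl
    have hm := fun n v => mono l₁ l₂ n v hl
    have hle := assemble_length_mono hm hl.length_le
    change assemble (G l₁) l₁.length <+: assemble (G l₂) l₂.length
    rw [List.prefix_iff_eq_take]
    apply List.ext_getElem?
    intro i
    rw [List.getElem?_take]
    split_ifs with hi
    · have e1 := assemble_valid (G l₁) l₁.length i hi
      have e2 := assemble_valid (G l₂) l₂.length i (by omega)
      rw [← e1, ← e2]
      rw [List.getElem?_eq_getElem hi] at e1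
      rw [e1, hm _ _ e1]
    · exact List.getElem?_eq_none (not_lt.1 hi)
  · intro x hx
    obtain ⟨y, hy, hk⟩ := h x hx
    refine ⟨y, hy, fun n => ?_⟩
    choose k hk using hk
    set N := n + 1 + ∑ i ∈ Finset.range (n + 1), k i with hN
    have hall : ∀ i < n + 1, G (pref x N) i = some (y i) := by
      intro i hi
      refine mono _ _ _ _ (pref_prefix x ?_) (hk i)
      have := Finset.single_le_sum (f := k) (fun _ _ => Nat.zero_le _) (Finset.mem_range.2 hi)
      omega
    have hlen : n + 1 ≤ (assemble (G (pref x N)) (n + 1)).length :=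
      assemble_length_of_total (n := n + 1) (fun i hi => by simp [hall i hi]) le_rfl
    have hlen2 := assemble_length_mono (G := G (pref x N)) (G' := G (pref x N))
      (fun _ _ h => h) (show n + 1 ≤ N by omega)
    refine ⟨N, ?_⟩
    simp only [pref_length]
    rw [← assemble_valid _ _ _ (by omega), hall n (by omega)]

section
open Nat.Partrec (Code)
open Nat.Partrec.Code Encodable Denumerable

theorem exists_lt_primrec {β : Type*} [Primcodable β] {R : ℕ → β → Prop} (hf : PrimrecRel R) :
    PrimrecRel fun n y => ∃ x < n, R x y :=
  (hf.exists_mem_list.comp (Primrec.list_range.comp Primrec.fst) Primrec.snd).of_eq (by simp)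

/-- The finite word `l` agrees with the diagonal partial function at some place, as witnessed
by a computation bounded by the length of `l`. -/
def DiagBad (l : List ℕ) : Prop :=
  ∃ e < l.length, evaln l.length (ofNat Code e) e = l[e]?

/-- The class of binary sequences avoiding the diagonal partial computable function. -/
def diagClass : Set (ℕ → ℕ) := {x | (∀ n, x n ≤ 1) ∧ ∀ n, ¬ DiagBad (pref x n)}

theorem diagBad_primrec : PrimrecPred DiagBad := by
  have h : PrimrecRel fun (e : ℕ) (l : List ℕ) =>
      evaln l.length (ofNat Code e) e = l[e]? := by
    refine Primrec.eq.comp (primrec_evaln.comp (Primrec.pair (Primrec.pair ?_ ?_) ?_))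
      (Primrec.list_getElem?.comp Primrec.snd Primrec.fst)
    · exact Primrec.list_length.comp Primrec.snd
    · exact (Primrec.ofNat Code).comp Primrec.fst
    · exact Primrec.fst
  have h' := exists_lt_primrec h
  exact h'.comp Primrec.list_length Primrec.id

theorem mem_diagClass_iff {x : ℕ → ℕ} :
    x ∈ diagClass ↔ (∀ n, x n ≤ 1) ∧ ∀ e, x e ∉ eval (ofNat Code e) e := by
  refine and_congr Iff.rfl ⟨fun h e he => ?_, fun h n => ?_⟩
  · obtain ⟨k, hk⟩ := evaln_complete.1 he
    apply h (max k (e + 1))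
    refine ⟨e, by rw [pref_length]; omega, ?_⟩
    rw [pref_length, pref_getElem? x (by omega)]
    exact evaln_mono (le_max_left _ _) hk
  · rintro ⟨e, he, h1⟩
    rw [pref_length] at he h1
    rw [pref_getElem? x he] at h1
    exact h e (evaln_sound h1)

theorem diagClass_nonempty : diagClass.Nonempty := by
  classical
  refine ⟨fun e => if 0 ∈ eval (ofNat Code e) e then 1 else 0, mem_diagClass_iff.2 ⟨?_, ?_⟩⟩
  · intro n; split_ifs <;> simp
  · intro e h
    split_ifs at h with h1
    · exact absurd (Part.mem_unique h h1) (by simp)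
    · exact h1 h

theorem diagClass_not_computable {y : ℕ → ℕ} (hy : y ∈ diagClass) : ¬ Computable y := by
  intro hc
  obtain ⟨c, hc⟩ := exists_code.1 (Partrec.nat_iff.1 hc)
  apply (mem_diagClass_iff.1 hy).2 (encode c)
  rw [ofNat_encode, hc]
  simp

theorem diagClass_isPi01Cantor : IsPi01Cantor diagClass := by
  obtain ⟨dp, hd⟩ := diagBad_primrec
  refine ⟨fun n => ((decode (α := List ℕ) n).bind fun l =>
    if DiagBad l then some l else none).getD [2], ?_, ?_⟩
  · have h1 : Primrec fun l : List ℕ => if DiagBad l then some l else none :=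
      Primrec.ite diagBad_primrec Primrec.option_some (Primrec.const none)
    exact (Primrec.option_getD.comp (Primrec.option_bind Primrec.decode
      (h1.comp Primrec.snd).to₂) (Primrec.const [2])).to_comp
  · ext x
    refine and_congr_right fun hx => ?_
    have hx : ∀ n, x n ≤ 1 := hx
    rw [Set.mem_iUnion, not_exists]
    have key : ∀ l, x ∈ cylinder l → l = pref x l.length := fun l hl => by
      apply List.ext_getElem (by simp [pref])
      intro i h1 h2
      rw [← hl i h1]; simp [pref]
    constructor
    · intro h n hn
      cases h1 : decode (α := List ℕ) n with
      | none =>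
        simp only [h1, Option.bind_none, Option.getD_none] at hn
        have h3 : x 0 = 2 := hn 0 (by simp); have := hx 0; omega
      | some l =>
        simp only [h1, Option.bind_some] at hn
        split_ifs at hn with h2
        · rw [key l hn] at h2; exact h _ h2
        · have h3 : x 0 = 2 := hn 0 (by simp); have := hx 0; omega
    · intro h n hn
      apply h (encode (pref x n))
      simp only [encodek, Option.bind_some, hn, if_true, Option.getD_some]
      intro i hi
      simp [pref]

/-! ### Maximality of the diagonal class -/

/-- All binary words of length `n`. -/
def binWords (n : ℕ) : List (List ℕ) :=
  Nat.rec [[]] (fun _ acc => acc.map (List.cons 0) ++ acc.map (List.cons 1)) n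

theorem binWords_primrec : Primrec binWords := by
  have hm : ∀ a : ℕ, Primrec fun acc : List (List ℕ) => acc.map (List.cons a) := fun a =>
    Primrec.list_map Primrec.id (Primrec.list_cons.comp (Primrec.const a) Primrec.snd).to₂
  exact Primrec.nat_rec₁ _ (Primrec.list_append.comp ((hm 0).comp Primrec.snd)
    ((hm 1).comp Primrec.snd)).to₂

theorem mem_binWords {n : ℕ} {w : List ℕ} :
    w ∈ binWords n ↔ w.length = n ∧ ∀ a ∈ w, a ≤ 1 := by
  induction n generalizing w with
  | zero =>
    rw [show binWords 0 = [[]] from rfl, List.mem_singleton, List.length_eq_zero_iff]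
    constructor
    · rintro rfl; simp
    · exact fun h => h.1
  | succ n ih =>
    have : binWords (n + 1) = (binWords n).map (List.cons 0) ++ (binWords n).map (List.cons 1) :=
      rfl
    rw [this, List.mem_append, List.mem_map, List.mem_map]
    constructor
    · rintro (⟨v, hv, rfl⟩ | ⟨v, hv, rfl⟩) <;> · have := ih.1 hv; simp [this.1]; exact this.2
    · rintro ⟨h1, h2⟩
      cases w with
      | nil => simp at h1
      | cons a w =>
        have hw : w ∈ binWords n := ih.2 ⟨by simpa using h1, fun b hb => h2 b (by simp [hb])⟩
        have := h2 a (by simp)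
        interval_cases a
        · exact Or.inl ⟨w, hw, rfl⟩
        · exact Or.inr ⟨w, hw, rfl⟩

section Maximal
variable (cg : Code) (l : List ℕ) (n : ℕ)

/-- The `i`-th word enumerated by the code `cg`, computed within `n` steps. -/
def boundedWord (i : ℕ) : Option (List ℕ) := (evaln n cg i).bind decode

/-- All binary extensions of `l` by `n` bits have a prefix enumerated within `n` steps. -/
def Dead : Prop := ∀ w ∈ binWords n, ∃ i < n,
  boundedWord cg n i = some ((l ++ w).take ((boundedWord cg n i).getD []).length)

theorem boundedWord_primrec : Primrec fun p : ℕ × ℕ => boundedWord cg p.1 p.2 :=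
  Primrec.option_bind (primrec_evaln.comp
    (Primrec.pair (Primrec.pair Primrec.fst (Primrec.const cg)) Primrec.snd))
    (Primrec.decode.comp Primrec.snd).to₂

theorem dead_primrec : PrimrecPred fun p : List ℕ × ℕ => Dead cg p.1 p.2 := by
  have h1 : PrimrecRel fun (i : ℕ) (q : List ℕ × (List ℕ × ℕ)) =>
      boundedWord cg q.2.2 i =
        some ((q.2.1 ++ q.1).take ((boundedWord cg q.2.2 i).getD []).length) := by
    have hb : Primrec fun q : ℕ × (List ℕ × (List ℕ × ℕ)) => boundedWord cg q.2.2.2 q.1 :=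
      (boundedWord_primrec cg).comp (Primrec.pair
        (Primrec.snd.comp (Primrec.snd.comp Primrec.snd)) Primrec.fst)
    refine Primrec.eq.comp hb (Primrec.option_some.comp (Primrec.list_take.comp
      (Primrec.list_length.comp (Primrec.option_getD.comp hb (Primrec.const [])))
      (Primrec.list_append.comp ?_ ?_)))
    · exact Primrec.fst.comp (Primrec.snd.comp Primrec.snd)
    · exact Primrec.fst.comp Primrec.snd
  have h2 : PrimrecRel fun (w : List ℕ) (p : List ℕ × ℕ) => ∃ i < p.2,
      boundedWord cg p.2 i =
        some ((p.1 ++ w).take ((boundedWord cg p.2 i).getD []).length) := by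
    have h1' := exists_lt_primrec h1
    exact h1'.comp (Primrec.snd.comp Primrec.snd) Primrec.id
  have h2' := h2.forall_mem_list
  exact h2'.comp (binWords_primrec.comp Primrec.snd) Primrec.id

end Maximal

end

section
open Nat.Partrec (Code)
open Nat.Partrec.Code Encodable Denumerable

theorem mem_cylinder_iff {x : ℕ → ℕ} {l : List ℕ} : x ∈ cylinder l ↔ pref x l.length = l := by
  constructor
  · intro h
    apply List.ext_getElem (by simp [pref])
    intro i h1 h2
    rw [← h i h2]; simp [pref]
  · intro h i hi
    have := List.getElem_of_eq h (i := i) (by simpa [pref] using hi)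
    rw [← this]; simp [pref]

theorem cylinder_isClopen (l : List ℕ) : IsClopen (cylinder l) := by
  have : cylinder l = ⋂ i : Fin l.length, (fun x : ℕ → ℕ => x i) ⁻¹' {l[i]} := by
    ext x; simp [cylinder, Fin.forall_iff]
  rw [this]
  exact isClopen_iInter_of_finite fun i =>
    (isClopen_discrete _).preimage (continuous_apply _)

theorem cantorSpace_isCompact : IsCompact cantorSpace := by
  have : cantorSpace = Set.univ.pi fun _ : ℕ => Set.Iic 1 := by
    ext x; simp [cantorSpace, Pi.le_def]
  rw [this]
  exact isCompact_univ_pi fun _ => (Set.finite_Iic 1).isCompact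

section Maximal
variable {f : ℕ → List ℕ} {cg : Code}

theorem boundedWord_sound
    (hcg : ∀ i, eval cg i = Part.some (encode (f i)))
    {n i : ℕ} {w : List ℕ} (h : boundedWord cg n i = some w) : w = f i := by
  obtain ⟨a, ha, hw⟩ := Option.bind_eq_some_iff.1 h
  have := evaln_sound ha
  rw [hcg, Part.mem_some_iff] at this
  subst this
  rw [encodek] at hw
  exact (Option.some.inj hw).symm

theorem boundedWord_complete
    (hcg : ∀ i, eval cg i = Part.some (encode (f i)))
    (i : ℕ) : ∃ n, ∀ n' ≥ n, boundedWord cg n' i = some (f i) := by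
  have : encode (f i) ∈ eval cg i := by rw [hcg]; simp
  obtain ⟨k, hk⟩ := evaln_complete.1 this
  refine ⟨k, fun n hn => ?_⟩
  rw [boundedWord, evaln_mono hn hk]
  simp

theorem dead_not_extendible
    (hcg : ∀ i, eval cg i = Part.some (encode (f i)))
    {l : List ℕ} {n : ℕ} (h : Dead cg l n) {x : ℕ → ℕ}
    (hx : x ∈ cantorSpace \ ⋃ n, cylinder (f n)) : x ∉ cylinder l := by
  intro hl
  have hw : (List.range n).map (fun i => x (l.length + i)) ∈ binWords n :=
    mem_binWords.2 ⟨by simp, by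
      intro a ha
      obtain ⟨i, -, rfl⟩ := List.mem_map.1 ha
      exact hx.1 _⟩
  have hlw : l ++ (List.range n).map (fun i => x (l.length + i)) = pref x (l.length + n) := by
    conv_lhs => rw [← mem_cylinder_iff.1 hl]
    simp [pref, List.range_add]
  obtain ⟨i, hi, h1⟩ := h _ hw
  have h2 := boundedWord_sound hcg h1
  rw [h1, Option.getD_some, hlw] at h2
  apply hx.2
  refine Set.mem_iUnion.2 ⟨i, ?_⟩
  rw [← h2]
  generalize (List.take _ (pref x _)).length = j
  rw [mem_cylinder_iff, pref, pref, ← List.map_take, List.take_range]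
  simp

theorem exists_dead
    (hcg : ∀ i, eval cg i = Part.some (encode (f i)))
    {l : List ℕ} (hl : ∀ a ∈ l, a ≤ 1)
    (h : ∀ x ∈ cantorSpace \ ⋃ n, cylinder (f n), x ∉ cylinder l) : ∃ n, Dead cg l n := by
  by_contra! hd
  let C : ℕ → Set (ℕ → ℕ) := fun n => cantorSpace ∩ (cylinder l ∩ ⋂ i : Fin n,
    {x | ∀ w, boundedWord cg n i = some w → w.length ≤ n → x ∉ cylinder w})
  have hcl : ∀ n, IsClosed (C n) := fun n => by
    refine cantorSpace_isCompact.isClosed.inter ((cylinder_isClopen l).1.inter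
      (isClosed_iInter fun i => ?_))
    simp only [Set.ofPred_forall]
    exact isClosed_iInter fun w => isClosed_iInter fun _ => isClosed_iInter fun _ =>
      (cylinder_isClopen w).compl.1
  have hne : ∀ n, (C n).Nonempty := fun n => by
    have := hd n
    simp only [Dead, not_forall] at this
    obtain ⟨w, hw, hdw⟩ := this
    have hw := mem_binWords.1 hw
    refine ⟨fun i => (l ++ w).getD i 0, ?_, ?_, ?_⟩
    · intro i
      change (l ++ w).getD i 0 ≤ 1
      rw [List.getD_eq_getElem?_getD]
      rcases h1 : (l ++ w)[i]? with _ | a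
      · simp
      · have := List.mem_of_getElem? h1
        rcases List.mem_append.1 this with h2 | h2
        · exact hl _ h2
        · exact hw.2 _ h2
    · intro i hi
      simp [List.getElem?_append_left hi, List.getElem?_eq_getElem hi]
    · refine Set.mem_iInter.2 fun i v hv hvn hc => hdw ⟨i, i.2, ?_⟩
      rw [hv, Option.getD_some]
      congr 1
      apply List.ext_getElem (by simp; omega)
      intro j h1 h2
      rw [← hc j h1]
      have : j < (l ++ w).length := by simp; omega
      simp only [List.getElem_take]
      rw [List.getD_eq_getElem?_getD, List.getElem?_eq_getElem this, Option.getD_some]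
  have hmono : ∀ n, C (n + 1) ⊆ C n := fun n x hx => by
    refine ⟨hx.1, hx.2.1, Set.mem_iInter.2 fun i w hw hwn => ?_⟩
    refine Set.mem_iInter.1 hx.2.2 ⟨i, by omega⟩ w ?_ (by omega)
    obtain ⟨a, ha, hw⟩ := Option.bind_eq_some_iff.1 hw
    rw [boundedWord, evaln_mono (Nat.le_succ n) ha]
    exact hw
  obtain ⟨x, hx⟩ := IsCompact.nonempty_iInter_of_sequence_nonempty_isCompact_isClosed C hmono hne
    (cantorSpace_isCompact.inter_right ((hcl 0).inter isClosed_univ) |>.of_isClosed_subset (hcl 0)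
      (fun x hx => ⟨hx.1, hx, trivial⟩)) hcl
  rw [Set.mem_iInter] at hx
  refine h x ⟨(hx 0).1, fun hu => ?_⟩ (hx 0).2.1
  obtain ⟨i, hi⟩ := Set.mem_iUnion.1 hu
  obtain ⟨n, hn⟩ := boundedWord_complete hcg i
  have h1 := hn (n + i + 1 + (f i).length) (by omega)
  exact Set.mem_iInter.1 (hx (n + i + 1 + (f i).length)).2.2 ⟨i, by omega⟩ _ h1 (by omega) hi

end Maximal

/-- The partial function picking a bit whose appending makes `l` nonextendible. -/
noncomputable def badBit (cg : Code) (l : List ℕ) : Part ℕ := by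
  classical
  exact Nat.rfindOpt fun n => if Dead cg (l ++ [0]) n then some 0 else
    if Dead cg (l ++ [1]) n then some 1 else none

theorem badBit_partrec (cg : Code) : Partrec (badBit cg) := by
  classical
  have hd : ∀ a : ℕ, PrimrecPred fun p : List ℕ × ℕ => Dead cg (p.1 ++ [a]) p.2 := fun a =>
    (dead_primrec cg).comp (Primrec.pair (Primrec.list_concat.comp Primrec.fst
      (Primrec.const a)) Primrec.snd)
  have : Primrec₂ fun (l : List ℕ) (n : ℕ) => if Dead cg (l ++ [0]) n then some 0 else
      if Dead cg (l ++ [1]) n then some 1 else none :=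
    Primrec.ite (hd 0) (Primrec.const _) (Primrec.ite (hd 1) (Primrec.const _) (Primrec.const _))
  exact Partrec.rfindOpt this.to_comp

/-- An index at which the diagonal function takes the value `badBit cg l`. -/
theorem exists_badBit_index (cg : Code) : ∃ e : List ℕ → ℕ, Primrec e ∧
    ∀ l, eval (ofNat Code (e l)) (e l) = badBit cg l := by
  have hp : Partrec fun n : ℕ =>
      ((decode (α := List ℕ) n.unpair.1) : Part (List ℕ)).bind (badBit cg) :=
    Partrec.bind (Computable.ofOption (Computable.decode.comp
      (Computable.fst.comp Computable.unpair))) ((badBit_partrec cg).comp Computable.snd).to₂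
  obtain ⟨c, hc⟩ := exists_code.1 (Partrec.nat_iff.1 hp)
  refine ⟨fun l => encode (curry c (encode l)), ?_, fun l => ?_⟩
  · exact Primrec.encode.comp (primrec₂_curry.comp (Primrec.const c) Primrec.encode)
  · rw [ofNat_encode, eval_curry, hc]
    simp

/-- The first bits of the reduction from the diagonal class, as a function of a prefix. -/
def buildBits (e : List ℕ → ℕ) (l : List ℕ) (k : ℕ) : Option (List ℕ) :=
  Nat.rec (some []) (fun _ o => o.bind fun acc => (l[e acc]?).map fun v => acc ++ [v]) k

theorem diagClass_maximal {Q : Set (ℕ → ℕ)} (hQ : IsPi01Cantor Q) (hne : Q.Nonempty) :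
    BaireLE Q diagClass := by
  obtain ⟨f, hf, rfl⟩ := hQ
  obtain ⟨cg, hcg⟩ := exists_code.1 (Partrec.nat_iff.1
    (Computable.encode.comp hf : Computable fun n => encode (f n)))
  replace hcg : ∀ i, eval cg i = Part.some (encode (f i)) := fun i => by rw [hcg]; rfl
  obtain ⟨e, he, hev⟩ := exists_badBit_index cg
  refine baireLE_of_partial (fun l n => (buildBits e l (n + 1)).bind fun a => a[n]?) ?_ ?_ ?_
  · have h1 : Primrec₂ fun (l : List ℕ) (k : ℕ) => buildBits e l k := by
      refine Primrec.nat_rec (f := fun _ : List ℕ => some ([] : List ℕ))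
        (g := fun l (p : ℕ × Option (List ℕ)) =>
          p.2.bind fun acc => (l[e acc]?).map fun v => acc ++ [v]) (Primrec.const _) ?_
      refine Primrec.option_bind (Primrec.snd.comp Primrec.snd) ?_
      refine Primrec.option_map (Primrec.list_getElem?.comp (Primrec.fst.comp Primrec.fst)
        (he.comp Primrec.snd)) ?_
      exact Primrec.list_concat.comp (Primrec.snd.comp Primrec.fst) Primrec.snd
    have h2 : Primrec₂ fun (l : List ℕ) (n : ℕ) => (buildBits e l (n + 1)).bind fun a => a[n]? :=
      Primrec.option_bind (h1.comp Primrec.fst (Primrec.succ.comp Primrec.snd))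
        (Primrec.list_getElem?.comp Primrec.snd (Primrec.snd.comp Primrec.fst))
    exact h2.to_comp
  · intro l₁ l₂ n v hl h
    have key : ∀ k a, buildBits e l₁ k = some a → buildBits e l₂ k = some a := by
      intro k
      induction k with
      | zero => exact fun a h => h
      | succ k ih =>
        intro a h
        simp only [buildBits] at h ih ⊢
        obtain ⟨b, hb, h⟩ := Option.bind_eq_some_iff.1 h
        rw [ih b hb, Option.bind_some]
        obtain ⟨w, hw, rfl⟩ := Option.map_eq_some_iff.1 h
        obtain ⟨t, rfl⟩ := hl
        rw [List.getElem?_append_left (List.getElem?_eq_some_iff.1 hw).1, hw]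
        rfl
    obtain ⟨a, ha, hv⟩ := Option.bind_eq_some_iff.1 h
    rw [key _ a ha, Option.bind_some, hv]
  · intro x hx
    rw [mem_diagClass_iff] at hx
    let a : ℕ → List ℕ := fun k => Nat.rec [] (fun _ acc => acc ++ [x (e acc)]) k
    have ha : ∀ k, a (k + 1) = a k ++ [x (e (a k))] := fun k => rfl
    have hlen : ∀ k, (a k).length = k := fun k => by
      induction k with
      | zero => rfl
      | succ k ih => rw [ha]; simp [ih]
    have hpre : ∀ k, pref (fun n => x (e (a n))) k = a k := fun k => by
      induction k with
      | zero => rfl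
      | succ k ih => rw [pref_succ, ih, ha]
    have hbin : ∀ k, ∀ b ∈ a k, b ≤ 1 := fun k => by
      rw [← hpre]
      intro b hb
      obtain ⟨i, -, rfl⟩ := List.mem_map.1 hb
      exact hx.1 _
    have hext : ∀ k, ∃ z ∈ cantorSpace \ ⋃ n, cylinder (f n), z ∈ cylinder (a k) := by
      intro k
      induction k with
      | zero => obtain ⟨z, hz⟩ := hne; exact ⟨z, hz, fun i hi => absurd hi (by simp [a])⟩
      | succ k ih =>
        by_contra! hcon
        have hb := hx.2 (e (a k))
        rw [hev] at hb
        obtain ⟨n, hn⟩ := exists_dead hcg (hbin (k + 1)) hcon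
        rw [ha] at hn hcon
        obtain ⟨z, hz, hzk⟩ := ih
        have hz1 : z ∈ cylinder (a k ++ [z k]) := by
          rw [mem_cylinder_iff] at hzk ⊢
          rw [hlen] at hzk
          rw [List.length_append, List.length_singleton, hlen, pref_succ, hzk]
        have hdom : (badBit cg (a k)).Dom := by
          rw [badBit, Nat.rfindOpt_dom]
          have := hx.1 (e (a k))
          rcases Nat.le_one_iff_eq_zero_or_eq_one.1 this with h0 | h0 <;> rw [h0] at hn
          · exact ⟨n, 0, by simp [hn]⟩
          · by_cases h1 : Dead cg (a k ++ [0]) n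
            · exact ⟨n, 0, by simp [h1]⟩
            · exact ⟨n, 1, by simp [hn, h1]⟩
        obtain ⟨v, hv⟩ := Part.dom_iff_mem.1 hdom
        have hv' := hv
        rw [badBit] at hv
        obtain ⟨n', hn'⟩ := Nat.rfindOpt_spec hv
        have hdead : Dead cg (a k ++ [v]) n' ∧ v ≤ 1 := by
          split_ifs at hn' with h0 h1
          · obtain rfl : 0 = v := by simpa using hn'
            exact ⟨h0, by simp⟩
          · obtain rfl : 1 = v := by simpa using hn'
            exact ⟨h1, by simp⟩
          · simp at hn'
        have hzv : z k ≠ v := fun h => dead_not_extendible hcg hdead.1 hz (h ▸ hz1)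
        have hxv : x (e (a k)) ≠ v := fun h => hb (h ▸ hv')
        have h1 := hx.1 (e (a k))
        have h2 : z k ≤ 1 := hz.1 k
        have : z k = x (e (a k)) := by omega
        exact hcon z hz (this ▸ hz1)
    refine ⟨fun n => x (e (a n)), ⟨fun n => hx.1 _, fun hu => ?_⟩, fun n => ?_⟩
    · obtain ⟨i, hi⟩ := Set.mem_iUnion.1 hu
      rw [mem_cylinder_iff, hpre] at hi
      obtain ⟨z, hz, hzk⟩ := hext (f i).length
      rw [hi] at hzk
      exact hz.2 (Set.mem_iUnion.2 ⟨i, hzk⟩)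
    · have : ∀ k, ∃ K, ∀ K' ≥ K, buildBits e (pref x K') k = some (a k) := by
        intro k
        induction k with
        | zero => exact ⟨0, fun _ _ => rfl⟩
        | succ k ih =>
          obtain ⟨K, hK⟩ := ih
          refine ⟨K + e (a k) + 1, fun K' hK' => ?_⟩
          have := hK K' (by omega)
          simp only [buildBits] at this ⊢
          rw [this, Option.bind_some, pref_getElem? x (by omega)]
          rfl
      obtain ⟨K, hK⟩ := this (n + 1)
      refine ⟨K, ?_⟩
      rw [hK K le_rfl, Option.bind_some, ← hpre (n + 1), pref_getElem? _ (by omega)]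

theorem diagClass_isMaxPi01 : IsMaxPi01 diagClass :=
  ⟨diagClass_isPi01Cantor, diagClass_nonempty, fun _ => diagClass_maximal⟩

theorem not_computable_of_baireLE {S : Set (ℕ → ℕ)} (h : BaireLE diagClass S) {x : ℕ → ℕ}
    (hx : x ∈ S) : ¬ Computable x := by
  intro hc
  obtain ⟨φ, hφ, hm, h⟩ := h
  obtain ⟨y, hy, hk⟩ := h x hx
  apply diagClass_not_computable hy
  have hpref : Computable fun k => pref x k := by
    refine (Computable.nat_rec (f := fun k : ℕ => k) (g := fun _ : ℕ => ([] : List ℕ))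
      (h := fun _ (p : ℕ × List ℕ) => p.2 ++ [x p.1]) Computable.id (Computable.const _) ?_).of_eq ?_
    · exact Computable.list_concat.comp (Computable.snd.comp Computable.snd)
        (hc.comp (Computable.fst.comp Computable.snd))
    · intro k
      induction k with
      | zero => rfl
      | succ k ih => rw [pref_succ, ← ih]
  have hF : Computable₂ fun n k => (φ (pref x k))[n]? :=
    Computable.list_getElem?.comp (hφ.comp (hpref.comp Computable.snd)) Computable.fst
  refine (Partrec.rfindOpt hF).of_eq fun n => ?_
  obtain ⟨k, hkn⟩ := hk n
  have hd : (Nat.rfindOpt fun k => (φ (pref x k))[n]?).Dom := Nat.rfindOpt_dom.2 ⟨k, _, hkn⟩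
  obtain ⟨v, hv⟩ := Part.dom_iff_mem.1 hd
  obtain ⟨j, hj⟩ := Nat.rfindOpt_spec hv
  have hmono : ∀ {i j v}, i ≤ j → (φ (pref x i))[n]? = some v → (φ (pref x j))[n]? = some v := by
    intro i j v hij hi
    obtain ⟨t, ht⟩ := hm _ _ (pref_prefix x hij)
    rw [← ht, List.getElem?_append_left (List.getElem?_eq_some_iff.1 hi).1, hi]
  have : v = y n := by
    have h1 := hmono (le_max_left j k) hj
    have h2 := hmono (le_max_right j k) hkn
    exact Option.some.inj (h1.symm.trans h2)
  rw [Part.eq_some_iff.2 hv, this]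
  rfl

end

/-! ### Multi-stack machines reading bits on demand -/

/-- A nondeterministic multi-stack machine; the Boolean argument of the transition function is the
next input bit, which is consumed in the reading states. -/
structure StackMachine where
  Q : Type
  K : Type
  Γ : Type
  finQ : Finite Q
  finK : Finite K
  finΓ : Finite Γ
  q0 : Q
  rd : Q → Bool
  δ : Q → (K → Option Γ) → Bool → Option (Q × (K → Option (Option Γ)))

/-- The effect of a stack operation: nothing, pop, or push. -/
def applyOp {Γ : Type} : Option (Option Γ) → List Γ → List Γ
  | none, l => l
  | some none, l => l.tail
  | some (some a), l => a :: l

namespace StackMachine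
variable (M : StackMachine)

/-- Configurations: state and stack contents. -/
abbrev Conf := M.Q × (M.K → List M.Γ)

/-- One step of the machine on the input bit `b`. -/
def step (c : M.Conf) (b : Bool) : Option M.Conf :=
  (M.δ c.1 (fun k => (c.2 k).head?) b).map fun r => (r.1, fun k => applyOp (r.2 k) (c.2 k))

/-- The log of consumed bits after a step, newest first. -/
def newLog (q : M.Q) (b : Bool) (log : List Bool) : List Bool :=
  if M.rd q then b :: log else log

/-- Runs from the initial configuration. -/
inductive Run : ℕ → M.Conf → List Bool → Prop
  | zero : Run 0 (M.q0, fun _ => []) []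
  | succ {i c log b c'} : Run i c log → M.step c b = some c' →
      Run (i + 1) c' (M.newLog c.1 b log)

/-- Forced steps without reading. -/
def DStep (c c' : M.Conf) : Prop := M.rd c.1 = false ∧ ∀ b, M.step c b = some c'

/-- Forced paths of a given length. -/
inductive DPath : ℕ → M.Conf → M.Conf → Prop
  | zero (c) : DPath 0 c c
  | succ {n c c' d} : M.DStep c c' → DPath n c' d → DPath (n + 1) c d

variable {M}

theorem DPath.trans {m n : ℕ} {a b c : M.Conf} (h : M.DPath m a b) (h' : M.DPath n b c) :
    M.DPath (m + n) a c := by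
  induction h with
  | zero => simpa using h'
  | succ h _ ih => rw [Nat.succ_add_eq_add_succ]; exact DPath.succ h (ih h')

theorem DPath.exists_next {n j : ℕ} {a b c : M.Conf} (h : M.DPath n a b) (hj : M.DPath j a c)
    (hlt : j < n) : ∃ d, M.DStep c d ∧ M.DPath (j + 1) a d := by
  induction hj generalizing n with
  | zero a =>
    cases h with
    | zero => omega
    | succ h _ => exact ⟨_, h, DPath.succ h (DPath.zero _)⟩
  | succ h1 _ ih =>
    cases h with
    | zero => omega
    | succ h2 h3 =>
      have := (h1.2 true).symm.trans (h2.2 true)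
      obtain rfl := Option.some.inj this
      obtain ⟨d, hd, hd'⟩ := ih h3 (by omega)
      exact ⟨d, hd, DPath.succ h1 hd'⟩

theorem DPath.eq_of_eq {n : ℕ} {a b c : M.Conf} (h : M.DPath n a b) (h' : M.DPath n a c) :
    b = c := by
  induction h generalizing c with
  | zero => cases h'; rfl
  | succ h1 _ ih =>
    cases h' with
    | succ h2 h3 =>
      have := (h1.2 true).symm.trans (h2.2 true)
      obtain rfl := Option.some.inj this
      exact ih h3

end StackMachine

/-- The number coding a binary word, newest bit first. -/
def wordNum : List Bool → ℕ
  | [] => 1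
  | b :: u => 2 * wordNum u + b.toNat

/-- Abstract form of a machine reading bits and testing each word read so far: `base u` is the
configuration just after the word `u` has been read and `ready u` the configuration in which the
test of `u` has been completed. -/
structure WordTester (bad : List Bool → Prop) where
  M : StackMachine
  base : List Bool → M.Conf
  ready : List Bool → M.Conf
  T : List Bool → ℕ
  base_nil : base [] = (M.q0, fun _ => [])
  path : ∀ u, M.DPath (T u) (base u) (ready u)
  read : ∀ u, M.rd (ready u).1 = true
  die : ∀ u, bad u → ∀ b, M.step (ready u) b = none
  live : ∀ u, ¬ bad u → ∀ b, M.step (ready u) b = some (base (b :: u))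

namespace WordTester
variable {bad : List Bool → Prop} (W : WordTester bad)

/-- The time at which the word `u` has been read. -/
def time : List Bool → ℕ
  | [] => 0
  | _ :: u => time u + W.T u + 1

theorem run_inv {i : ℕ} {c : W.M.Conf} {log : List Bool} (h : W.M.Run i c log) :
    (∀ v u, log = v ++ u → v ≠ [] → ¬ bad u) ∧
      ∃ j ≤ W.T log, W.M.DPath j (W.base log) c ∧ i = W.time log + j := by
  induction h with
  | zero =>
    refine ⟨fun v u h => ?_, 0, Nat.zero_le _, ?_, rfl⟩
    · simp at h; simp [h.1]
    · rw [W.base_nil]; exact .zero _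
  | @succ i c log b c' _ hs ih =>
    obtain ⟨hb, j, hj, hp, rfl⟩ := ih
    rcases hj.lt_or_eq with hj | rfl
    · obtain ⟨d, hd, hd'⟩ := (W.path log).exists_next hp hj
      obtain rfl := Option.some.inj (hs.symm.trans (hd.2 b))
      rw [StackMachine.newLog, hd.1]
      exact ⟨hb, j + 1, hj, hd', rfl⟩
    · obtain rfl := hp.eq_of_eq (W.path log)
      by_cases hbad : bad log
      · rw [W.die _ hbad] at hs; cases hs
      · rw [W.live _ hbad] at hs
        obtain rfl := Option.some.inj hs
        rw [StackMachine.newLog, W.read, if_pos rfl]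
        refine ⟨fun v u h hv => ?_, 0, Nat.zero_le _, .zero _, by simp [time]⟩
        cases v with
        | nil => exact absurd rfl hv
        | cons a v =>
          simp only [List.cons_append, List.cons.injEq] at h
          by_cases hv' : v = []
          · subst hv'
            rw [List.nil_append] at h
            exact h.2 ▸ hbad
          · exact hb v u h.2 hv'

theorem exists_step {i : ℕ} {c : W.M.Conf} {log : List Bool} (h : W.M.Run i c log)
    (hbad : ∀ v u, log = v ++ u → ¬ bad u) (b : Bool) : ∃ c', W.M.step c b = some c' := by
  obtain ⟨-, j, hj, hp, -⟩ := W.run_inv h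
  rcases hj.lt_or_eq with hj | rfl
  · obtain ⟨d, hd, -⟩ := (W.path log).exists_next hp hj
    exact ⟨d, hd.2 b⟩
  · obtain rfl := hp.eq_of_eq (W.path log)
    exact ⟨_, W.live _ (hbad [] _ rfl) b⟩

theorem exists_time (m : ℕ) : ∃ N, ∀ c log, W.M.Run N c log →
    m < log.length ∧ ∀ v u, log = v ++ u → v ≠ [] → ¬ bad u := by
  obtain ⟨B, hB⟩ := ((List.finite_length_le Bool m).image fun u => W.time u + W.T u).bddAbove
  refine ⟨B + 1, fun c log h => ?_⟩
  obtain ⟨hb, j, hj, hp, hi⟩ := W.run_inv h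
  refine ⟨?_, hb⟩
  by_contra! hlen
  have := hB ⟨log, hlen, rfl⟩
  simp only at this
  omega

end WordTester

section
open Turing Turing.PartrecToTM2

instance : Finite K' :=
  Finite.of_injective (fun k : K' => (k.rec 0 1 2 3 : Fin 4)) fun a b h => by
    cases a <;> cases b <;> simp_all

section Tester
variable (c : ToPartrec.Code)

/-- The statements of the stack machine for `c`. -/
def CtlStmt : Type :=
  {s : Stmt' // some s ∈ TM2.stmts tr (codeSupp c Cont'.halt)}

/-- The states of the word-testing machine: two initialization states, the reading state, and the
states running the program `c`. -/
inductive TState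
  | start0
  | start1
  | ready
  | run (s : CtlStmt c) (v : Option Γ')

instance : Finite (CtlStmt c) := Finset.finite_toSet _ |>.subset (s := {s | s ∈ _})
  (fun _ h => h) |>.preimage (f := some) (Option.some_injective _).injOn |>.to_subtype

instance : Finite (TState c) := by
  refine Finite.of_surjective (fun x : Fin 3 ⊕ (CtlStmt c × Option Γ') => match x with
    | .inl 0 => .start0 | .inl 1 => .start1 | .inl 2 => .ready | .inr (s, v) => .run s v) ?_
  rintro (_ | _ | _ | ⟨s, v⟩)
  · exact ⟨.inl 0, rfl⟩
  · exact ⟨.inl 1, rfl⟩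
  · exact ⟨.inl 2, rfl⟩
  · exact ⟨.inr (s, v), rfl⟩

open Classical in
/-- The state running the statement `s`, if it is one of the statements for `c`. -/
noncomputable def toRun (s : Stmt') (v : Option Γ') : Option (TState c) :=
  if h : some s ∈ TM2.stmts tr (codeSupp c Cont'.halt) then some (.run ⟨s, h⟩ v) else none

/-- The operation acting on one stack only. -/
def opOn (k : K') (o : Option Γ') : K' → Option (Option Γ') :=
  fun k' => if k' = k then some o else none

/-- The small-step transition function of a statement of the stack machine. -/
noncomputable def runδ (s : Stmt') (v : Option Γ') (top : K' → Option Γ') :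
    Option (TState c × (K' → Option (Option Γ'))) :=
  match s with
  | .push k f q => (toRun c q v).map fun q => (q, opOn k (some (f v)))
  | .peek k f q => (toRun c q (f v (top k))).map fun q => (q, fun _ => none)
  | .pop k f q => (toRun c q (f v (top k))).map fun q => (q, opOn k none)
  | .load a q => (toRun c q (a v)).map fun q => (q, fun _ => none)
  | .branch f q₁ q₂ => (toRun c (cond (f v) q₁ q₂) v).map fun q => (q, fun _ => none)
  | .goto l => (toRun c (tr (l v)) v).map fun q => (q, fun _ => none)
  | .halt => some (.ready, fun _ => none)

/-- The transition function of the word-testing machine. -/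
noncomputable def testerδ (q : TState c) (top : K' → Option Γ') (b : Bool) :
    Option (TState c × (K' → Option (Option Γ'))) :=
  match q with
  | .start0 => some (.start1, opOn .main (some .cons))
  | .start1 => some (.ready, opOn .main (some .bit1))
  | .ready => if top .main = some .cons then none else
      (toRun c (tr (trNormal c Cont'.halt)) none).map fun q =>
        (q, opOn .main (some (bif b then .bit1 else .bit0)))
  | .run s v => runδ c s.1 v top

/-- The word-testing machine associated with the program `c`. -/
noncomputable def testerMachine : StackMachine where
  Q := TState c
  K := K'
  Γ := Γ'
  finQ := inferInstance
  finK := inferInstance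
  finΓ := inferInstance
  q0 := .start0
  rd q := match q with | .ready => true | _ => false
  δ := testerδ c

variable {c}

theorem applyOp_opOn (k : K') (o : Option Γ') (S : K' → List Γ') :
    (fun k' => applyOp (opOn k o k') (S k')) = Function.update S k (applyOp (some o) (S k)) := by
  funext k'
  by_cases h : k' = k
  · subst h; simp [opOn]
  · simp [opOn, h, applyOp]

theorem dstep_run {s : CtlStmt c} {v : Option Γ'} {S : K' → List Γ'} {q : TState c}
    {ops : K' → Option (Option Γ')} {S' : K' → List Γ'}
    (h : runδ c s.1 v (fun k => (S k).head?) = some (q, ops))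
    (hS : S' = fun k => applyOp (ops k) (S k)) :
    (testerMachine c).DStep (.run s v, S) (q, S') := by
  refine ⟨rfl, fun b => ?_⟩
  change Option.map _ (runδ c s.1 v fun k => (S k).head?) = _
  rw [h, hS]
  rfl

/-- The configuration of the tester corresponding to a configuration of the stack machine. -/
def Corresp (a : Cfg') (d : (testerMachine c).Conf) : Prop :=
  d.2 = a.stk ∧ match a.l with
    | none => d.1 = TState.ready
    | some l => toRun c (tr l) a.var = some d.1

theorem toRun_eq {s : Stmt'} {v : Option Γ'} {q : TState c} (h : toRun c s v = some q) :
    ∃ hs, q = .run ⟨s, hs⟩ v := by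
  unfold toRun at h
  split_ifs at h with h1
  exact ⟨h1, (Option.some.inj h).symm⟩

theorem toRun_of_mem {s : Stmt'} (hs : some s ∈ TM2.stmts tr (codeSupp c Cont'.halt))
    (v : Option Γ') : toRun c s v = some (.run ⟨s, hs⟩ v) := dif_pos hs

theorem supports_tester :
    @TM2.Supports K' (fun _ => Γ') Λ' (Option Γ') ⟨trNormal c Cont'.halt⟩ tr
      (codeSupp c Cont'.halt) := tr_supports c Cont'.halt

theorem tr_mem_stmts {l : Λ'} (hl : l ∈ codeSupp c Cont'.halt) :
    some (tr l) ∈ TM2.stmts tr (codeSupp c Cont'.halt) := by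
  classical
  refine Finset.mem_insertNone.2 fun a ha => ?_
  obtain rfl := Option.some.inj ha
  refine Finset.mem_biUnion.2 ?_
  exact ⟨l, hl, TM2.stmts₁_self⟩

theorem exists_dpath_stepAux (s : Stmt') :
    ∀ (hs : some s ∈ TM2.stmts tr (codeSupp c Cont'.halt)) (v : Option Γ') (S : K' → List Γ'),
      ∃ n d, Corresp (TM2.stepAux s v S) d ∧
        (testerMachine c).DPath n (.run ⟨s, hs⟩ v, S) d := by
  have sub : ∀ {s s' : Stmt'}, s' ∈ TM2.stmts₁ s →
      some s ∈ TM2.stmts tr (codeSupp c Cont'.halt) →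
      some s' ∈ TM2.stmts tr (codeSupp c Cont'.halt) := fun h => TM2.stmts_trans h
  induction s with
  | push k f q ih =>
    intro hs v S
    classical
    have hq := sub (s' := q) (Finset.mem_insert_of_mem TM2.stmts₁_self) hs
    obtain ⟨n, d, hd, hp⟩ := ih hq v (Function.update S k (f v :: S k))
    refine ⟨n + 1, d, hd, .succ (dstep_run (ops := opOn k (some (f v))) ?_ ?_) hp⟩
    · simp only [runδ, toRun_of_mem hq, Option.map_some]
    · rw [applyOp_opOn]; rfl
  | peek k f q ih =>
    intro hs v S
    classical
    have hq := sub (s' := q) (Finset.mem_insert_of_mem TM2.stmts₁_self) hs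
    obtain ⟨n, d, hd, hp⟩ := ih hq (f v (S k).head?) S
    refine ⟨n + 1, d, hd, .succ (dstep_run (ops := fun _ => none) ?_ ?_) hp⟩
    · simp only [runδ, toRun_of_mem hq, Option.map_some]
    · rfl
  | pop k f q ih =>
    intro hs v S
    classical
    have hq := sub (s' := q) (Finset.mem_insert_of_mem TM2.stmts₁_self) hs
    obtain ⟨n, d, hd, hp⟩ := ih hq (f v (S k).head?) (Function.update S k (S k).tail)
    refine ⟨n + 1, d, hd, .succ (dstep_run (ops := opOn k none) ?_ ?_) hp⟩
    · simp only [runδ, toRun_of_mem hq, Option.map_some]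
    · rw [applyOp_opOn]; rfl
  | load a q ih =>
    intro hs v S
    classical
    have hq := sub (s' := q) (Finset.mem_insert_of_mem TM2.stmts₁_self) hs
    obtain ⟨n, d, hd, hp⟩ := ih hq (a v) S
    refine ⟨n + 1, d, hd, .succ (dstep_run (ops := fun _ => none) ?_ ?_) hp⟩
    · simp only [runδ, toRun_of_mem hq, Option.map_some]
    · rfl
  | branch f q₁ q₂ ih₁ ih₂ =>
    intro hs v S
    classical
    have hq₁ := sub (s' := q₁)
      (Finset.mem_insert_of_mem (Finset.mem_union_left _ TM2.stmts₁_self)) hs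
    have hq₂ := sub (s' := q₂)
      (Finset.mem_insert_of_mem (Finset.mem_union_right _ TM2.stmts₁_self)) hs
    cases hf : f v
    · obtain ⟨n, d, hd, hp⟩ := ih₂ hq₂ v S
      refine ⟨n + 1, d, by simp only [TM2.stepAux, hf]; exact hd,
        .succ (dstep_run (ops := fun _ => none) ?_ ?_) hp⟩
      · change Option.map _ (toRun c (cond (f v) q₁ q₂) v) = _
        rw [hf]
        change Option.map _ (toRun c q₂ v) = _
        rw [toRun_of_mem hq₂]
        rfl
      · rfl
    · obtain ⟨n, d, hd, hp⟩ := ih₁ hq₁ v S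
      refine ⟨n + 1, d, by simp only [TM2.stepAux, hf]; exact hd,
        .succ (dstep_run (ops := fun _ => none) ?_ ?_) hp⟩
      · change Option.map _ (toRun c (cond (f v) q₁ q₂) v) = _
        rw [hf]
        change Option.map _ (toRun c q₁ v) = _
        rw [toRun_of_mem hq₁]
        rfl
      · rfl
  | goto l =>
    intro hs v S
    let _ : Inhabited Λ' := ⟨trNormal c Cont'.halt⟩
    have h1 := TM2.stmts_supportsStmt (supports_tester (c := c)) hs v
    have hq := tr_mem_stmts h1
    refine ⟨1, (.run ⟨tr (l v), hq⟩ v, S), ⟨rfl, toRun_of_mem hq v⟩, .succ (dstep_run (ops := fun _ => none) ?_ ?_) (.zero _)⟩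
    · simp only [runδ, toRun_of_mem hq, Option.map_some]
    · rfl
  | halt =>
    intro hs v S
    exact ⟨1, (.ready, S), ⟨rfl, rfl⟩, .succ (dstep_run rfl rfl) (.zero _)⟩

theorem exists_dpath_of_reaches {a b : Cfg'} (h : StateTransition.Reaches (TM2.step tr) a b)
    {d : (testerMachine c).Conf} (hd : Corresp a d) :
    ∃ n d', Corresp b d' ∧ (testerMachine c).DPath n d d' := by
  induction h with
  | refl => exact ⟨0, d, hd, .zero _⟩
  | @tail b b' _ hbb ih =>
    obtain ⟨n, d', hd', hp⟩ := ih
    obtain ⟨_ | l, v, S⟩ := b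
    · cases hbb
    · obtain ⟨q, S'⟩ := d'
      obtain ⟨h1, h2⟩ := hd'
      dsimp only at h1 h2
      subst h1
      obtain ⟨hs, rfl⟩ := toRun_eq h2
      obtain rfl := Option.some.inj hbb
      obtain ⟨n', d'', hd'', hp'⟩ := exists_dpath_stepAux (tr l) hs v S'
      exact ⟨n + n', d'', hd'', hp.trans hp'⟩

theorem trNat_bit {n : ℕ} (hn : n ≠ 0) (b : Bool) :
    trNat (2 * n + b.toNat) = (bif b then Γ'.bit1 else Γ'.bit0) :: trNat n := by
  have key : ∀ m : Num, m ≠ 0 → trNum (bif b then m.bit1 else m.bit0) =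
      (bif b then Γ'.bit1 else Γ'.bit0) :: trNum m := by
    intro m hm
    cases m with
    | zero => exact absurd rfl hm
    | pos p => cases b <;> rfl
  have h := key n (by exact_mod_cast hn)
  rw [trNat, trNat, ← h]
  congr 1
  rw [← Num.to_nat_inj]
  have h2 : ((2 : Num) : ℕ) = 2 := rfl
  cases b <;> simp [h2]
  

theorem wordNum_pos (u : List Bool) : wordNum u ≠ 0 := by
  induction u with
  | nil => simp [wordNum]
  | cons b u ih => simp only [wordNum]; omega

theorem trNat_head {n : ℕ} (hn : n ≠ 0) (l : List Γ') : (trNat n ++ l).head? ≠ some Γ'.cons := by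
  have key : ∀ p : PosNum, (trPosNum p ++ l).head? ≠ some Γ'.cons := by
    intro p
    cases p <;> simp [trPosNum]
  rw [trNat]
  cases h : (n : Num) with
  | zero => exact absurd h (by exact_mod_cast hn : (n : Num) ≠ 0)
  | pos p => exact key p

theorem init_mem_stmts :
    some (tr (trNormal c Cont'.halt)) ∈ TM2.stmts tr (codeSupp c Cont'.halt) :=
  tr_mem_stmts (supports_tester (c := c)).1

/-- A configuration whose only nonempty stack is the main one. -/
abbrev mainConf (q : TState c) (l : List Γ') : (testerMachine c).Conf :=
  (q, K'.elim l [] [] [])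

/-- The configuration in which the test of the word `u` starts. -/
noncomputable def testerBase : List Bool → (testerMachine c).Conf
  | [] => mainConf .start0 []
  | b :: u => mainConf (.run ⟨_, init_mem_stmts⟩ none) (trList [wordNum (b :: u)])

theorem dpath_start :
    (testerMachine c).DPath 2 (mainConf .start0 []) (mainConf .ready (trList [1])) := by
  refine .succ (c' := mainConf .start1 [.cons]) ⟨rfl, fun b => ?_⟩
    (.succ ⟨rfl, fun b => ?_⟩ (.zero _))
  · change some _ = some _
    refine congrArg some (Prod.ext rfl (funext fun (k : K') => ?_))
    cases k <;> rfl
  · change some _ = some _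
    refine congrArg some (Prod.ext rfl (funext fun (k : K') => ?_))
    cases k <;> rfl

theorem exists_tester_path {F : ℕ → ℕ} (hc : ∀ n, c.eval [n] = pure [F n]) (h1 : F 1 = 1)
    (u : List Bool) : ∃ n, (testerMachine c).DPath n (testerBase u)
      (mainConf .ready (trList [F (wordNum u)])) := by
  cases u with
  | nil =>
    rw [wordNum, h1]
    exact ⟨2, dpath_start⟩
  | cons b u =>
    have h := tr_eval c [wordNum (b :: u)]
    rw [hc] at h
    have h2 : PartrecToTM2.halt [F (wordNum (b :: u))] ∈
        StateTransition.eval (TM2.step tr) (init c [wordNum (b :: u)]) := by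
      rw [h]; exact ⟨trivial, rfl⟩
    obtain ⟨n, ⟨q, S⟩, ⟨hS, hq⟩, hp⟩ := exists_dpath_of_reaches (StateTransition.mem_eval.1 h2).1
      (d := testerBase (b :: u)) ⟨rfl, toRun_of_mem init_mem_stmts none⟩
    refine ⟨n, ?_⟩
    convert hp using 1
    exact Prod.ext hq.symm hS.symm

theorem tester_step_ready (l : List Γ') (b : Bool) :
    (testerMachine c).step (mainConf .ready l) b = if l.head? = some .cons then none else
      some (mainConf (.run ⟨_, init_mem_stmts⟩ none) ((bif b then .bit1 else .bit0) :: l)) := by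
  change Option.map _ (if l.head? = some .cons then none else
      (toRun c (tr (trNormal c Cont'.halt)) none).map fun q =>
        (q, opOn .main (some (bif b then .bit1 else .bit0)))) = _
  split_ifs with h
  · rfl
  · rw [toRun_of_mem init_mem_stmts]
    change some _ = some _
    refine congrArg some (Prod.ext rfl (funext fun (k : K') => ?_))
    cases k <;> rfl

theorem nonempty_wordTester_of_code {F : ℕ → ℕ} (hc : ∀ n, c.eval [n] = pure [F n])
    (h1 : F 1 = 1) (hF : ∀ n, F n = 0 ∨ F n = n) :
    Nonempty (WordTester fun u => F (wordNum u) = 0) := by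
  choose T hT using exists_tester_path hc h1
  refine ⟨⟨testerMachine c, testerBase, fun u => mainConf .ready (trList [F (wordNum u)]), T, ?_,
    hT, fun u => rfl, fun u hu b => ?_, fun u hu b => ?_⟩⟩
  · refine Prod.ext rfl (funext fun (k : K') => ?_)
    cases k <;> rfl
  · rw [tester_step_ready, hu]
    exact if_pos rfl
  · rw [tester_step_ready, (hF _).resolve_left hu]
    refine (if_neg (trNat_head (wordNum_pos u) _)).trans (congrArg some ?_)
    simp only [testerBase, trList, wordNum, trNat_bit (wordNum_pos u), List.cons_append]

end Tester

theorem nonempty_wordTester {F : ℕ → ℕ} (hcomp : Computable F)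
    (h1 : F 1 = 1) (hF : ∀ n, F n = 0 ∨ F n = n) :
    Nonempty (WordTester fun u => F (wordNum u) = 0) := by
  obtain ⟨c, hc⟩ := ToPartrec.Code.exists_code (Nat.Partrec'.part_iff₁.2 hcomp.partrec)
  refine nonempty_wordTester_of_code (c := c) (fun n => ?_) h1 hF
  exact (hc (n ::ᵥ List.Vector.nil)).trans (Part.map_some _ _)

end

/-! ### The test applied to Sturmian words -/

/-- The list of indicators of the digit `3` among the `k` base-8 digits of `I`. -/
def digitList (k I : ℕ) : List ℕ :=
  (List.range k).map fun j => if I / 8 ^ (k - 1 - j) % 8 = 3 then 1 else 0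

/-- The test failed by a word of length `L` with `c` ones. -/
def BadCount (L c : ℕ) : Prop :=
  ∃ k < L, L = 16 * 8 ^ k ∧ (¬ (2 ≤ c % 16 ∧ c % 16 ≤ 13) ∨ DiagBad (digitList k (c / 16)))

/-- One step of the computation of length and number of ones from the code of a word. -/
def countStep (p : ℕ × ℕ × ℕ) : ℕ × ℕ × ℕ :=
  if p.1 ≤ 1 then p else (p.1 / 2, p.2.1 + 1, p.2.2 + p.1 % 2)

theorem primrec_nat_pow : Primrec₂ ((· ^ ·) : ℕ → ℕ → ℕ) :=
  (Primrec.nat_rec' (f := fun p : ℕ × ℕ => p.2) (g := fun _ => 1)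
    (h := fun p q => q.2 * p.1) Primrec.snd (Primrec.const 1)
    (Primrec.nat_mul.comp (Primrec.snd.comp Primrec.snd)
      (Primrec.fst.comp Primrec.fst))).of_eq fun p => by
    induction p.2 with
    | zero => rfl
    | succ n ih =>
      change _ * p.1 = p.1 ^ (n + 1)
      rw [pow_succ]
      exact congrArg (· * p.1) ih

theorem countStep_primrec : Primrec countStep :=
  Primrec.ite (Primrec.nat_le.comp Primrec.fst (Primrec.const 1)) Primrec.id
    ((Primrec.nat_div.comp Primrec.fst (Primrec.const 2)).pair
      ((Primrec.succ.comp (Primrec.fst.comp Primrec.snd)).pair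
        (Primrec.nat_add.comp (Primrec.snd.comp Primrec.snd)
          (Primrec.nat_mod.comp Primrec.fst (Primrec.const 2)))))

theorem digitList_primrec : Primrec₂ digitList := by
  refine Primrec.list_map (Primrec.list_range.comp Primrec.fst) ?_
  refine Primrec.ite ?_ (Primrec.const 1) (Primrec.const 0)
  refine Primrec.eq.comp (Primrec.nat_mod.comp (Primrec.nat_div.comp
    (Primrec.snd.comp Primrec.fst) (primrec_nat_pow.comp (Primrec.const 8) ?_))
      (Primrec.const 8)) (Primrec.const 3)
  exact Primrec.nat_sub.comp (Primrec.nat_sub.comp (Primrec.fst.comp Primrec.fst)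
    (Primrec.const 1)) Primrec.snd

theorem badCount_primrec : PrimrecRel BadCount := by
  have h : PrimrecRel fun (k : ℕ) (p : ℕ × ℕ) => p.1 = 16 * 8 ^ k ∧
      (¬ (2 ≤ p.2 % 16 ∧ p.2 % 16 ≤ 13) ∨ DiagBad (digitList k (p.2 / 16))) := by
    have hc : Primrec fun q : ℕ × ℕ × ℕ => q.2.2 := Primrec.snd.comp Primrec.snd
    have hm : Primrec fun q : ℕ × ℕ × ℕ => q.2.2 % 16 := Primrec.nat_mod.comp hc (Primrec.const 16)
    have h1 : PrimrecPred fun q : ℕ × ℕ × ℕ => q.2.1 = 16 * 8 ^ q.1 :=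
      Primrec.eq.comp (Primrec.fst.comp Primrec.snd) (Primrec.nat_mul.comp (Primrec.const 16)
        (primrec_nat_pow.comp (Primrec.const 8) Primrec.fst))
    have h2 : PrimrecPred fun q : ℕ × ℕ × ℕ => 2 ≤ q.2.2 % 16 :=
      Primrec.nat_le.comp (Primrec.const 2) hm
    have h3 : PrimrecPred fun q : ℕ × ℕ × ℕ => q.2.2 % 16 ≤ 13 :=
      Primrec.nat_le.comp hm (Primrec.const 13)
    have h4 : PrimrecPred fun q : ℕ × ℕ × ℕ => DiagBad (digitList q.1 (q.2.2 / 16)) := by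
      have := digitList_primrec.comp Primrec.fst (Primrec.nat_div.comp hc (Primrec.const 16))
      exact diagBad_primrec.comp this
    exact h1.and ((h2.and h3).not.or h4)
  have h' := exists_lt_primrec h
  exact h'.comp Primrec.fst Primrec.id

theorem countStep_iterate (u : List Bool) (L c : ℕ) : ∀ i ≥ u.length,
    countStep^[i] (wordNum u, L, c) = (1, L + u.length, c + u.count true) := by
  induction u generalizing L c with
  | nil =>
    intro i _
    induction i with
    | zero => rfl
    | succ i ih => rw [Function.iterate_succ_apply]; exact ih (Nat.zero_le _)
  | cons b u ih =>
    intro i hi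
    obtain ⟨i, rfl⟩ : ∃ j, i = j + 1 := ⟨i - 1, by simp at hi; omega⟩
    have h0 := wordNum_pos u
    have h1 : countStep (wordNum (b :: u), L, c) = (wordNum u, L + 1, c + b.toNat) := by
      have hb := b.toNat_lt
      refine (if_neg ?_).trans ?_
      · simp only [wordNum]; omega
      simp only [wordNum]
      refine Prod.ext ?_ (Prod.ext rfl ?_) <;> simp only <;> omega
    rw [Function.iterate_succ_apply, h1, ih _ _ i (by simpa using hi)]
    cases b <;> simp <;> omega

theorem length_le_wordNum (u : List Bool) : u.length ≤ wordNum u := by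
  induction u with
  | nil => simp
  | cons b u ih => have := wordNum_pos u; simp only [wordNum, List.length_cons]; omega

theorem exists_wordTester :
    Nonempty (WordTester fun u => BadCount u.length (u.count true)) := by
  classical
  let g : ℕ → ℕ × ℕ × ℕ := fun n => countStep^[n] (n, 0, 0)
  have hg : Primrec g := Primrec.nat_iterate Primrec.id (Primrec.id.pair (Primrec.const (0, 0)))
    (countStep_primrec.comp Primrec.snd)
  have hgu : ∀ u, g (wordNum u) = (1, u.length, u.count true) := fun u => by
    simpa using countStep_iterate u 0 0 _ (length_le_wordNum u)
  let F : ℕ → ℕ := fun n => if BadCount (g n).2.1 (g n).2.2 then 0 else n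
  have hF : Primrec F := by
    have hb := badCount_primrec
    have : PrimrecPred fun n => BadCount (g n).2.1 (g n).2.2 :=
      hb.comp (Primrec.fst.comp (Primrec.snd.comp hg)) (Primrec.snd.comp (Primrec.snd.comp hg))
    exact Primrec.ite this (Primrec.const 0) Primrec.id
  have h1 : F 1 = 1 := by
    refine if_neg ?_
    have := hgu []
    simp only [wordNum] at this
    rw [this]
    rintro ⟨k, hk, -⟩
    simp at hk
  have h2 := nonempty_wordTester hF.to_comp h1 fun n => by
    by_cases h : BadCount (g n).2.1 (g n).2.2
    · exact .inl (if_pos h)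
    · exact .inr (if_neg h)
  have h3 : (fun u => F (wordNum u) = 0) = fun u => BadCount u.length (u.count true) := by
    funext u
    simp only [F, hgu]
    have := wordNum_pos u
    by_cases h : BadCount u.length (u.count true) <;> simp [h, this]
  rwa [h3] at h2

section
/-! ### The nested machine -/

/-- Phases of the nested machine: moving up, resuming an upward move, moving down, calling during a
downward move, resuming a downward move. -/
inductive Phase
  | up | upR | down | downC | downR

/-- Stack symbols of the nested machine. -/
inductive NSym (Q Γ : Type)
  | cell | mark
  | bar (f : Bool) (q : Q)
  | dat (a : Γ)
  | lg (b : Bool)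

/-- Stack indices of the nested machine. -/
inductive Ix (K : Type)
  | bh | ah | log
  | dat (k : K)

instance : Finite Phase :=
  Finite.of_injective (fun p : Phase => (p.rec 0 1 2 3 4 : Fin 5)) fun a b h => by
    cases a <;> cases b <;> simp_all

instance {Q Γ : Type} [Finite Q] [Finite Γ] : Finite (NSym Q Γ) := by
  refine Finite.of_surjective (fun x : Fin 2 ⊕ (Bool × Q) ⊕ Γ ⊕ Bool => match x with
    | .inl 0 => NSym.cell | .inl 1 => .mark | .inr (.inl (f, q)) => .bar f q
    | .inr (.inr (.inl a)) => .dat a | .inr (.inr (.inr b)) => .lg b) ?_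
  rintro (_ | _ | ⟨f, q⟩ | a | b)
  exacts [⟨.inl 0, rfl⟩, ⟨.inl 1, rfl⟩, ⟨.inr (.inl (f, q)), rfl⟩, ⟨.inr (.inr (.inl a)), rfl⟩,
    ⟨.inr (.inr (.inr b)), rfl⟩]

instance {K : Type} [Finite K] : Finite (Ix K) := by
  refine Finite.of_surjective (fun x : Fin 3 ⊕ K => match x with
    | .inl 0 => Ix.bh | .inl 1 => .ah | .inl 2 => .log | .inr k => .dat k) ?_
  rintro (_ | _ | _ | k)
  exacts [⟨.inl 0, rfl⟩, ⟨.inl 1, rfl⟩, ⟨.inl 2, rfl⟩, ⟨.inr k, rfl⟩]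

/-- A stack operation of the nested machine: copy a stack, possibly without its top, and possibly
push a symbol. -/
structure NOp (Q K Γ : Type) where
  src : Ix K
  drop : Bool
  psh : Option (NSym Q Γ)

/-- The result of a transition of the nested machine: new phase and state, stack operations and the
coefficients of the change of the phase register. -/
structure NRes (Q K Γ : Type) where
  ph : Phase
  q : Q
  ops : Ix K → NOp Q K Γ
  dy : ℤ
  b : ℤ

/-- The top of a data stack, as seen by the simulated machine. -/
def NSym.toDat {Q Γ : Type} : NSym Q Γ → Option Γ
  | .dat a => some a
  | _ => none

namespace StackMachine
variable (M : StackMachine)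

abbrev Sym := NSym M.Q M.Γ
abbrev Idx := Ix M.K
abbrev Op := NOp M.Q M.K M.Γ
abbrev Res := NRes M.Q M.K M.Γ

instance : Finite M.Q := M.finQ
instance : Finite M.K := M.finK
instance : Finite M.Γ := M.finΓ

variable {M}

/-- The operation keeping a stack. -/
def keep (i : M.Idx) : M.Op := ⟨i, false, none⟩

/-- Saving the current run and starting a new one. -/
def callOps (f : Bool) (q : M.Q) : M.Idx → M.Op
  | .bh => ⟨.ah, false, some (.bar f q)⟩
  | .ah => ⟨.bh, false, none⟩
  | i => ⟨i, false, some .mark⟩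

/-- Returning to the saved run. -/
def retOps : M.Idx → M.Op
  | .bh => ⟨.ah, false, none⟩
  | .ah => ⟨.bh, true, none⟩
  | i => ⟨i, true, none⟩

/-- The action of a stack operation of the simulated machine. -/
def datOp (k : M.K) (a : M.Sym) : Option (Option M.Γ) → M.Op
  | none => keep (.dat k)
  | some none => ⟨.dat k, a.toDat.isSome, none⟩
  | some (some c) => ⟨.dat k, false, some (.dat c)⟩

/-- Moving up by one cell while performing one step of the simulated machine. -/
def upOps (a : M.Idx → M.Sym) (r : Bool) (u : Bool) (o : M.K → Option (Option M.Γ)) :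
    M.Idx → M.Op
  | .bh => ⟨.bh, false, some .cell⟩
  | .ah => ⟨.ah, true, none⟩
  | .log => ⟨.log, false, if r then some (.lg u) else none⟩
  | .dat k => datOp k (a (.dat k)) (o k)

/-- The bit on top of the log, if there is one. -/
def logBit : M.Sym → Option Bool
  | .lg b => some b
  | _ => none

/-- Moving down by one cell while popping from the data stacks. -/
def downOps (a : M.Idx → M.Sym) : M.Idx → M.Op
  | .bh => ⟨.bh, true, none⟩
  | .ah => ⟨.ah, false, some .cell⟩
  | .log => ⟨.log, (logBit (a .log)).isSome, none⟩
  | .dat k => ⟨.dat k, (a (.dat k)).toDat.isSome, none⟩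

/-- The phase in which a saved run is resumed. -/
def resume (f : Bool) : Phase := if f then .downR else .upR

variable (M) in
/-- The transition function of the nested machine. -/
def act (p : Phase) (q : M.Q) (a : M.Idx → M.Sym) (u : Bool) : Option M.Res :=
  match p with
  | .up => match a .ah with
    | .cell => some ⟨.up, M.q0, callOps false q, 0, 0⟩
    | .bar _ _ => some ⟨.down, q, keep, 0, 0⟩
    | _ => none
  | .upR => match a .ah with
    | .cell => (M.δ q (fun k => (a (.dat k)).toDat) u).map fun r =>
        ⟨.up, r.1, upOps a (M.rd q) u r.2, if M.rd q then 1 else 0,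
          if M.rd q then u.toNat else 0⟩
    | _ => none
  | .down => match a .bh with
    | .cell => some ⟨.downC, q, downOps a, if (logBit (a .log)).isSome then -1 else 0,
        - ((logBit (a .log)).elim 0 fun b => (b.toNat : ℤ))⟩
    | .bar f q' => some ⟨resume f, q', retOps, 0, 0⟩
    | _ => none
  | .downC => some ⟨.up, M.q0, callOps true q, 0, 0⟩
  | .downR => match a .ah with
    | .cell => some ⟨.down, q, keep, 0, 0⟩
    | _ => none

/-! ### Coding stacks by real numbers -/

open unitInterval

/-- A numbering of the stack symbols. -/
noncomputable def symCode (a : M.Sym) : ℕ := (Finite.equivFin M.Sym a : ℕ)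

variable (M) in
/-- The base of the coding of stacks. -/
noncomputable def symBase : ℕ := 2 * Nat.card M.Sym

theorem symCode_lt (a : M.Sym) : 2 * symCode a + 2 ≤ M.symBase := by
  have := (Finite.equivFin M.Sym a).2
  unfold symCode symBase
  omega

theorem symBase_pos : (0 : ℝ) < M.symBase := by
  have := symCode_lt (.cell : M.Sym)
  exact_mod_cast (by omega : 0 < M.symBase)

/-- Push a symbol on the stack coded by a real number. -/
noncomputable def push (a : M.Sym) (v : I) : I :=
  ⟨(v + 2 * symCode a) / M.symBase, by
    have h := symCode_lt a
    have h' : (2 * symCode a + 2 : ℝ) ≤ M.symBase := by exact_mod_cast h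
    have h0 := M.symBase_pos
    have := v.2.1
    have := v.2.2
    constructor
    · positivity
    · rw [div_le_one h0]; linarith⟩

theorem symBase_mul_push (a : M.Sym) (v : I) :
    (M.symBase : ℝ) * push a v = v + 2 * symCode a := by
  have h0 := M.symBase_pos
  simp only [push]
  field_simp

theorem push_inj {a b : M.Sym} {v w : I} : push a v = push b w ↔ a = b ∧ v = w := by
  refine ⟨fun h => ?_, fun h => by rw [h.1, h.2]⟩
  have h1 := symBase_mul_push a v
  rw [h, symBase_mul_push] at h1
  have hv := v.2
  have hw := w.2
  have hab : symCode a = symCode b := by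
    rcases lt_trichotomy (symCode a) (symCode b) with h | h | h
    · have : (symCode a + 1 : ℝ) ≤ symCode b := by exact_mod_cast h
      linarith [hv.1, hv.2, hw.1, hw.2]
    · exact h
    · have : (symCode b + 1 : ℝ) ≤ symCode a := by exact_mod_cast h
      linarith [hv.1, hv.2, hw.1, hw.2]
  refine ⟨(Finite.equivFin M.Sym).injective (Fin.ext hab), Subtype.ext ?_⟩
  rw [hab] at h1
  linarith

theorem exists_push_fixed (a : M.Sym) : ∃ v : I, push a v = v := by
  have h := symCode_lt a
  have h' : (2 * symCode a + 2 : ℝ) ≤ M.symBase := by exact_mod_cast h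
  have hp : (0 : ℝ) < M.symBase - 1 := by
    have : (0 : ℝ) ≤ symCode a := Nat.cast_nonneg _
    linarith
  refine ⟨⟨2 * symCode a / (M.symBase - 1), by positivity, ?_⟩, Subtype.ext ?_⟩
  · rw [div_le_one hp]; linarith
  · have h0 := M.symBase_pos
    simp only [push]
    field_simp
    ring

/-- Whether a number codes a nonempty stack. -/
def IsPush (M : StackMachine) (v : I) : Prop := ∃ (a : M.Sym) (w : I), v = push a w

open Classical in
variable (M) in
/-- The top of a stack. -/
noncomputable def tp (v : I) : M.Sym := if h : IsPush M v then h.choose else .cell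

open Classical in
variable (M) in
/-- The tail of a stack. -/
noncomputable def tl (v : I) : I := if h : IsPush M v then h.choose_spec.choose else v

theorem push_tp_tl {v : I} (h : IsPush M v) : push (tp M v) (tl M v) = v := by
  unfold tp tl
  rw [dif_pos h, dif_pos h]
  exact h.choose_spec.choose_spec.symm

theorem isPush_push (a : M.Sym) (v : I) : IsPush M (push a v) := ⟨a, v, rfl⟩

@[simp] theorem tp_push (a : M.Sym) (v : I) : tp M (push a v) = a :=
  (push_inj.1 (push_tp_tl (isPush_push a v))).1

@[simp] theorem tl_push (a : M.Sym) (v : I) : tl M (push a v) = v :=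
  (push_inj.1 (push_tp_tl (isPush_push a v))).2

/-! ### Steps of the nested machine -/

/-- The effect of a stack operation. -/
noncomputable def opVal (S : M.Idx → I) (o : M.Op) : I :=
  let w := if o.drop then tl M (S o.src) else S o.src
  o.psh.elim w fun c => push c w

variable (M) in
/-- Configurations of the nested machine. -/
@[ext] structure NState where
  ph : Phase
  q : M.Q
  S : M.Idx → I
  y : I

variable (M) in
/-- The step relation of the nested machine with slope `s`. -/
def NStep (s : ℝ) (x x' : M.NState) : Prop :=
  (∀ i, IsPush M (x.S i)) ∧ ∃ u r, M.act x.ph x.q (fun i => tp M (x.S i)) u = some r ∧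
    x'.ph = r.ph ∧ x'.q = r.q ∧ (x'.S = fun i => opVal x.S (r.ops i)) ∧
    (x'.y : ℝ) = x.y + r.dy * s - r.b

/-- Stack contents given by their components. -/
def mkS (bh ah log : I) (dat : M.K → I) : M.Idx → I
  | .bh => bh
  | .ah => ah
  | .log => log
  | .dat k => dat k

theorem mkS_eta (S : M.Idx → I) : mkS (S .bh) (S .ah) (S .log) (fun k => S (.dat k)) = S := by
  funext i; cases i <;> rfl

variable (M) in
/-- A state just after a call. -/
noncomputable def fresh (f : Bool) (q : M.Q) (X A LV : I) (V : M.K → I) (y : I) : M.NState :=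
  ⟨.up, M.q0, mkS (push (.bar f q : M.Sym) X) A (push (.mark : M.Sym) LV)
    fun k => push (.mark : M.Sym) (V k), y⟩

variable {s : ℝ} {q : M.Q} {y : I} {bh ah log : I} {dat : M.K → I} {x' : M.NState}

theorem nstep_up (h : M.NStep s ⟨.up, q, mkS bh ah log dat, y⟩ x') :
    (∃ A, ah = push (.cell : M.Sym) A ∧ x' = M.fresh false q ah bh log dat y) ∨
    (∃ f p A, ah = push (.bar f p : M.Sym) A ∧ x' = ⟨.down, q, mkS bh ah log dat, y⟩) := by
  obtain ⟨hp, u, r, hr, h1, h2, h3, h4⟩ := h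
  have ha := push_tp_tl (hp .ah)
  simp only [mkS] at ha
  simp only [act, mkS] at hr
  cases hc : tp M ah <;> simp only [hc, reduceCtorEq, Option.some.injEq] at hr
  · subst hr
    rw [hc] at ha
    refine .inl ⟨_, ha.symm, NState.ext h1 h2 (h3.trans ?_) (Subtype.ext ?_)⟩
    · funext i; cases i <;> rfl
    · simpa [fresh] using h4
  · subst hr
    rw [hc] at ha
    refine .inr ⟨_, _, _, ha.symm, NState.ext h1 h2 (h3.trans ?_) (Subtype.ext ?_)⟩
    · funext i; cases i <;> rfl
    · simpa using h4

theorem nstep_downC (h : M.NStep s ⟨.downC, q, mkS bh ah log dat, y⟩ x') :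
    x' = M.fresh true q ah bh log dat y := by
  obtain ⟨hp, u, r, hr, h1, h2, h3, h4⟩ := h
  simp only [act, Option.some.injEq] at hr
  subst hr
  refine NState.ext h1 h2 (h3.trans ?_) (Subtype.ext ?_)
  · funext i; cases i <;> rfl
  · simpa [fresh] using h4

theorem nstep_downR (h : M.NStep s ⟨.downR, q, mkS bh ah log dat, y⟩ x') :
    ∃ A, ah = push (.cell : M.Sym) A ∧ x' = ⟨.down, q, mkS bh ah log dat, y⟩ := by
  obtain ⟨hp, u, r, hr, h1, h2, h3, h4⟩ := h
  have ha := push_tp_tl (hp .ah)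
  simp only [mkS] at ha
  simp only [act, mkS] at hr
  cases hc : tp M ah <;> simp only [hc, reduceCtorEq, Option.some.injEq] at hr
  subst hr
  rw [hc] at ha
  refine ⟨_, ha.symm, NState.ext h1 h2 (h3.trans ?_) (Subtype.ext ?_)⟩
  · funext i; cases i <;> rfl
  · simpa using h4

theorem nstep_down (h : M.NStep s ⟨.down, q, mkS bh ah log dat, y⟩ x') :
    (∃ A, bh = push (.cell : M.Sym) A ∧ x'.ph = .downC ∧ x'.q = q ∧
      x'.S = mkS A (push (.cell : M.Sym) ah) (if (logBit (tp M log)).isSome then tl M log else log)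
        (fun k => if (tp M (dat k)).toDat.isSome then tl M (dat k) else dat k) ∧
      (x'.y : ℝ) = y + (logBit (tp M log)).elim 0 (fun b => b.toNat - s)) ∨
    (∃ f p A, bh = push (.bar f p : M.Sym) A ∧
      x' = ⟨resume f, p, mkS ah A (tl M log) fun k => tl M (dat k), y⟩) := by
  obtain ⟨hp, u, r, hr, h1, h2, h3, h4⟩ := h
  have ha := push_tp_tl (hp .bh)
  simp only [mkS] at ha
  simp only [act, mkS] at hr
  cases hc : tp M bh <;> simp only [hc, reduceCtorEq, Option.some.injEq] at hr
  · subst hr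
    rw [hc] at ha
    refine .inl ⟨_, ha.symm, h1, h2, h3.trans ?_, h4.trans ?_⟩
    · funext i; cases i <;> rfl
    · change (y : ℝ) + ((if (logBit (tp M log)).isSome then -1 else 0 : ℤ) : ℝ) * s -
        ((-(logBit (tp M log)).elim 0 fun b => (b.toNat : ℤ) : ℤ) : ℝ) = _
      cases logBit (tp M log) <;> simp
      ring
  · subst hr
    rw [hc] at ha
    refine .inr ⟨_, _, _, ha.symm, NState.ext h1 h2 (h3.trans ?_) (Subtype.ext ?_)⟩
    · funext i; cases i <;> rfl
    · simpa using h4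

/-- The effect of a stack operation of the simulated machine on a coded data stack. -/
noncomputable def datVal (v : I) : Option (Option M.Γ) → I
  | none => v
  | some none => if (tp M v).toDat.isSome then tl M v else v
  | some (some c) => push (.dat c : M.Sym) v

theorem nstep_upR (h : M.NStep s ⟨.upR, q, mkS bh ah log dat, y⟩ x') :
    ∃ A, ah = push (.cell : M.Sym) A ∧ ∃ u r, M.δ q (fun k => (tp M (dat k)).toDat) u = some r ∧
      x'.ph = .up ∧ x'.q = r.1 ∧
      x'.S = mkS (push (.cell : M.Sym) bh) A (if M.rd q then push (.lg u : M.Sym) log else log)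
        (fun k => datVal (dat k) (r.2 k)) ∧
      (x'.y : ℝ) = y + if M.rd q then s - u.toNat else 0 := by
  obtain ⟨hp, u, r, hr, h1, h2, h3, h4⟩ := h
  have ha := push_tp_tl (hp .ah)
  simp only [mkS] at ha
  simp only [act, mkS] at hr
  cases hc : tp M ah <;> simp only [hc, reduceCtorEq] at hr
  obtain ⟨r', hr', rfl⟩ := Option.map_eq_some_iff.1 hr
  rw [hc] at ha
  refine ⟨_, ha.symm, u, r', hr', h1, h2, h3.trans ?_, h4.trans ?_⟩
  · funext i
    cases i with
    | dat k =>
      simp only [upOps, mkS]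
      cases r'.2 k with
      | none => rfl
      | some o => cases o <;> rfl
    | log => simp only [upOps, mkS, opVal]; cases M.rd q <;> rfl
    | _ => rfl
  · cases M.rd q <;> simp
    ring

end StackMachine

end

section
namespace StackMachine
open unitInterval
variable {M : StackMachine} {s : ℝ}

/-! ### Inevitability -/

/-- All orbits from a state reach `Post`; under the hypothesis `G` there is no dead end before. -/
inductive Ev (s : ℝ) (G : Prop) (Post : M.NState → Prop) : M.NState → Prop
  | here {x} : Post x → Ev s G Post x
  | next {x} : (G → ∃ x', M.NStep s x x') → (∀ x', M.NStep s x x' → Ev s G Post x') →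
      Ev s G Post x

theorem Ev.bind {G : Prop} {P Q : M.NState → Prop} {x : M.NState} (h : Ev s G P x)
    (hQ : ∀ z, P z → Ev s G Q z) : Ev s G Q x := by
  induction h with
  | here h => exact hQ _ h
  | next h1 _ ih => exact .next h1 ih

theorem Ev.weaken {G G' : Prop} {P : M.NState → Prop} {x : M.NState} (h : Ev s G P x)
    (hG : G' → G) : Ev s G' P x := by
  induction h with
  | here h => exact .here h
  | next h1 _ ih => exact .next (fun h => h1 (hG h)) ih

theorem Ev.exists_orbit {G : Prop} {P : M.NState → Prop} {x : M.NState} (h : Ev s G P x)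
    (o : ℕ → M.NState) (ho : ∀ t, M.NStep s (o t) (o (t + 1))) (t : ℕ) (hx : o t = x) :
    ∃ t', P (o t') := by
  induction h generalizing t with
  | here h => exact ⟨t, hx ▸ h⟩
  | next _ _ ih => exact ih (o (t + 1)) (hx ▸ ho t) (t + 1) rfl

theorem Ev.exists_path {G : Prop} {P : M.NState → Prop} {x : M.NState} (h : Ev s G P x)
    (hG : G) : ∃ z, P z ∧ Relation.ReflTransGen (M.NStep s) x z := by
  induction h with
  | here h => exact ⟨_, h, .refl⟩
  | next h1 _ ih =>
    obtain ⟨x', hx'⟩ := h1 hG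
    obtain ⟨z, hz, hp⟩ := ih x' hx'
    exact ⟨z, hz, .head hx' hp⟩

/-! ### Stacks -/

/-- A data stack on top of a mark. -/
noncomputable def stk (l : List M.Γ) (v : I) : I :=
  l.foldr (fun a w => push (.dat a : M.Sym) w) (push (.mark : M.Sym) v)

variable (M) in
/-- A log on top of a mark. -/
noncomputable def lgs (l : List Bool) (v : I) : I :=
  l.foldr (fun a w => push (.lg a : M.Sym) w) (push (.mark : M.Sym) v)

variable (M) in
/-- A pile of cells. -/
noncomputable def cells (n : ℕ) (v : I) : I := (push (.cell : M.Sym))^[n] v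

theorem cells_succ (n : ℕ) (v : I) : M.cells (n + 1) v = push (.cell : M.Sym) (M.cells n v) :=
  Function.iterate_succ_apply' _ _ _

theorem cells_push (n : ℕ) (v : I) :
    M.cells n (push (.cell : M.Sym) v) = push (.cell : M.Sym) (M.cells n v) :=
  (Function.iterate_succ_apply _ _ _).symm.trans (cells_succ n v)

theorem isPush_stk (l : List M.Γ) (v : I) : IsPush M (stk l v) := by
  cases l <;> exact isPush_push _ _

theorem isPush_lgs (l : List Bool) (v : I) : IsPush M (M.lgs l v) := by
  cases l <;> exact isPush_push _ _

@[simp] theorem tp_stk (l : List M.Γ) (v : I) : (tp M (stk l v)).toDat = l.head? := by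
  cases l <;> simp [stk, NSym.toDat]

@[simp] theorem tp_lgs (l : List Bool) (v : I) : logBit (tp M (M.lgs l v)) = l.head? := by
  cases l <;> simp [lgs, logBit]

theorem tl_stk (l : List M.Γ) (v : I) :
    (if (tp M (stk l v)).toDat.isSome then tl M (stk l v) else stk l v) = stk l.tail v := by
  rw [tp_stk]
  cases l <;> simp [stk]

theorem tl_lgs (l : List Bool) (v : I) :
    (if (logBit (tp M (M.lgs l v))).isSome then tl M (M.lgs l v) else M.lgs l v) =
      M.lgs l.tail v := by
  rw [tp_lgs]
  cases l <;> simp [lgs]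

theorem datVal_stk (l : List M.Γ) (v : I) (o : Option (Option M.Γ)) :
    datVal (stk l v) o = stk (applyOp o l) v := by
  rcases o with _ | _ | c
  · rfl
  · exact tl_stk l v
  · rfl

/-! ### Runs with a balanced input -/

/-- The deviation of a word from its expected number of ones. -/
def phase (s : ℝ) (u : List Bool) : ℝ := u.length * s - u.count true

/-- Whether a word, read from the right, keeps the phase in the unit interval. -/
def Balanced (s : ℝ) (y : I) (log : List Bool) : Prop :=
  ∀ v u, log = v ++ u → y + phase s u ∈ Set.Icc (0 : ℝ) 1

variable (M) in
/-- Runs of the simulated machine whose input keeps the phase in the unit interval. -/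
def MReach (s : ℝ) (y : I) (i : ℕ) (c : M.Conf) (log : List Bool) : Prop :=
  M.Run i c log ∧ Balanced s y log

variable (M) in
/-- Every run of the simulated machine on a balanced input can be continued. -/
def Good (s : ℝ) : Prop := ∀ (y : I) (i : ℕ) (c : M.Conf) (log : List Bool), M.MReach s y i c log →
  ∃ u c', M.step c u = some c' ∧ Balanced s y (M.newLog c.1 u log)

theorem Balanced.tail {y : I} {log : List Bool} (h : Balanced s y log) :
    Balanced s y log.tail := by
  cases log with
  | nil => exact h
  | cons a l => intro v u hl; exact h (a :: v) u (by rw [List.tail_cons] at hl; rw [hl]; rfl)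

theorem Balanced.cons {y : I} {log : List Bool} (h : Balanced s y log) {b : Bool}
    (hb : y + phase s (b :: log) ∈ Set.Icc (0 : ℝ) 1) : Balanced s y (b :: log) := by
  intro v u hu
  cases v with
  | nil => rw [List.nil_append] at hu; rwa [← hu]
  | cons a v =>
    rw [List.cons_append, List.cons.injEq] at hu
    exact h v u hu.2

theorem phase_cons (b : Bool) (u : List Bool) :
    phase s (b :: u) = phase s u + (s - b.toNat) := by
  cases b <;> simp [phase] <;> ring

theorem Run.length_le {i : ℕ} {c : M.Conf} {log : List Bool} (h : M.Run i c log) :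
    log.length ≤ i ∧ ∀ k, (c.2 k).length ≤ i := by
  induction h with
  | zero => simp
  | @succ i c log b c' _ hs ih =>
    constructor
    · unfold newLog
      split_ifs
      · simpa using ih.1
      · exact ih.1.trans (Nat.le_succ i)
    · intro k
      obtain ⟨r, -, rfl⟩ := Option.map_eq_some_iff.1 hs
      have := ih.2 k
      change (applyOp (r.2 k) (c.2 k)).length ≤ _
      rcases r.2 k with _ | _ | a
      · simp only [applyOp]; omega
      · simp only [applyOp, List.length_tail]; omega
      · simp only [applyOp, List.length_cons]; omega

/-! ### Existence of steps -/

theorem exists_nstep {x : M.NState} (hp : ∀ i, IsPush M (x.S i)) {u : Bool} {r : M.Res}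
    (hr : M.act x.ph x.q (fun i => tp M (x.S i)) u = some r)
    (hy : (x.y : ℝ) + (r.dy : ℝ) * s - (r.b : ℝ) ∈ Set.Icc (0 : ℝ) 1) : ∃ x', M.NStep s x x' :=
  ⟨⟨r.ph, r.q, fun i => opVal x.S (r.ops i), ⟨_, hy⟩⟩, hp, u, r, hr, rfl, rfl, rfl, rfl⟩

theorem isPush_mkS {bh ah log : I} {dat : M.K → I} (h1 : IsPush M bh) (h2 : IsPush M ah)
    (h3 : IsPush M log) (h4 : ∀ k, IsPush M (dat k)) (i : M.Idx) :
    IsPush M (mkS bh ah log dat i) := by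
  cases i
  exacts [h1, h2, h3, h4 _]

/-- Whether a stack has a bar on top. -/
def IsBar (M : StackMachine) (v : I) : Prop := ∃ f p w, v = push (.bar f p : M.Sym) w

/-- Whether a stack has a cell on top. -/
def IsCell (M : StackMachine) (v : I) : Prop := ∃ w, v = push (.cell : M.Sym) w

theorem IsBar.not_isCell {v : I} (h : IsBar M v) : ¬ IsCell M v := by
  rintro ⟨w, rfl⟩
  obtain ⟨f, p, w', h⟩ := h
  cases (push_inj.1 h).1

theorem isBar_push (f : Bool) (p : M.Q) (v : I) : IsBar M (push (.bar f p : M.Sym) v) :=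
  ⟨f, p, v, rfl⟩

theorem IsBar.isPush {v : I} (h : IsBar M v) : IsPush M v := by
  obtain ⟨f, p, w, rfl⟩ := h
  exact isPush_push _ _

theorem isPush_cells {v : I} (h : IsPush M v) (n : ℕ) : IsPush M (M.cells n v) := by
  cases n with
  | zero => exact h
  | succ n => rw [cells_succ]; exact isPush_push _ _

theorem add_zero_mem (y : I) : (y : ℝ) + ((0 : ℤ) : ℝ) * s - ((0 : ℤ) : ℝ) ∈ Set.Icc (0 : ℝ) 1 := by
  simp

theorem exists_nstep_of_zero {p : Phase} {q : M.Q} {S : M.Idx → I} {y : I}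
    (hp : ∀ i, IsPush M (S i)) {u : Bool} {r : M.Res}
    (hr : M.act p q (fun i => tp M (S i)) u = some r) (h1 : r.dy = 0) (h2 : r.b = 0) :
    ∃ x', M.NStep s ⟨p, q, S, y⟩ x' :=
  exists_nstep (x := ⟨p, q, S, y⟩) hp hr (by rw [h1, h2]; exact add_zero_mem y)

end StackMachine

end

section
namespace StackMachine
open unitInterval
variable {M : StackMachine} {s : ℝ}

/-- A state of the nested machine simulating a configuration. -/
noncomputable abbrev sim (p : Phase) (q : M.Q) (l : M.K → List M.Γ) (log : List Bool)
    (LV : I) (V : M.K → I) (bh ah : I) (y : I) : M.NState :=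
  ⟨p, q, mkS bh ah (M.lgs log LV) fun k => stk (l k) (V k), y⟩

theorem isPush_sim {l : M.K → List M.Γ} {log : List Bool} {LV : I} {V : M.K → I} {bh ah : I}
    (h1 : IsPush M bh) (h2 : IsPush M ah) (i : M.Idx) :
    IsPush M (mkS bh ah (M.lgs log LV) (fun k => stk (l k) (V k)) i) :=
  isPush_mkS h1 h2 (isPush_lgs _ _) (fun _ => isPush_stk _ _) i

variable (M) in
/-- A call on a pile of `B` cells returns and restores the state. -/
def Returns (s : ℝ) (B : ℕ) : Prop := ∀ f (q : M.Q) X Y LV V y, ¬ IsCell M Y →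
  Ev s (M.Good s ∧ IsBar M Y)
    (fun z => IsBar M Y ∧ z = ⟨resume f, q, mkS (M.cells B Y) X LV V, y⟩)
    (M.fresh f q X (M.cells B Y) LV V y)

/-- The call made while moving up returns. -/
theorem Returns.up {i : ℕ} (hi : M.Returns s i) {G : Prop} (hG : G → M.Good s)
    {P : M.NState → Prop} {q : M.Q} {W A LV : I} {V : M.K → I} {y : I} (hW : IsBar M W)
    (hp : G → IsPush M LV ∧ ∀ k, IsPush M (V k))
    (h : Ev s G P ⟨.upR, q, mkS (M.cells i W) (push (.cell : M.Sym) A) LV V, y⟩) :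
    Ev s G P ⟨.up, q, mkS (M.cells i W) (push (.cell : M.Sym) A) LV V, y⟩ := by
  refine .next (fun g => ?_) fun x' hx' => ?_
  · refine exists_nstep_of_zero (u := true) (r := ⟨.up, M.q0, callOps false q, 0, 0⟩)
      (isPush_mkS (isPush_cells hW.isPush i) (isPush_push _ _) (hp g).1 (hp g).2) ?_ rfl rfl
    simp [act, mkS]
  · rcases nstep_up hx' with ⟨A', -, rfl⟩ | ⟨f, p, A', h', -⟩
    · refine ((hi _ _ _ W _ _ _ hW.not_isCell).weaken fun g => ⟨hG g, hW⟩).bind ?_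
      rintro _ ⟨-, rfl⟩
      exact h
    · cases (push_inj.1 h').1

/-- The call made while moving down returns. -/
theorem Returns.downC {i : ℕ} (hi : M.Returns s i) {G : Prop} (hG : G → M.Good s)
    {P : M.NState → Prop} {q : M.Q} {W A LV : I} {V : M.K → I} {y : I} (hW : IsBar M W)
    (hp : G → IsPush M LV ∧ ∀ k, IsPush M (V k))
    (h : Ev s G P ⟨.down, q, mkS (M.cells i W) (push (.cell : M.Sym) A) LV V, y⟩) :
    Ev s G P ⟨.downC, q, mkS (M.cells i W) (push (.cell : M.Sym) A) LV V, y⟩ := by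
  refine .next (fun g => ?_) fun x' hx' => ?_
  · exact exists_nstep_of_zero (u := true) (r := ⟨.up, M.q0, callOps true q, 0, 0⟩)
      (isPush_mkS (isPush_cells hW.isPush i) (isPush_push _ _) (hp g).1 (hp g).2) rfl rfl rfl
  · obtain rfl := nstep_downC hx'
    refine ((hi _ _ _ W _ _ _ hW.not_isCell).weaken fun g => ⟨hG g, hW⟩).bind ?_
    rintro _ ⟨-, rfl⟩
    refine .next (fun g => ?_) fun x' hx' => ?_
    · refine exists_nstep_of_zero (u := true) (r := ⟨.down, q, keep, 0, 0⟩)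
        (isPush_mkS (isPush_cells hW.isPush i) (isPush_push _ _) (hp g).1 (hp g).2) ?_ rfl rfl
      simp [act, mkS, resume]
    · obtain ⟨A', -, rfl⟩ := nstep_downR hx'
      exact h

/-- One step of the simulation while moving up. -/
theorem Returns.step {i : ℕ} (hi : M.Returns s i) {G : Prop} (hG : G → M.Good s)
    {P : M.NState → Prop} {c : M.Conf} {log : List Bool} {W A LV : I} {V : M.K → I} {y y0 : I}
    (hW : IsBar M W) (hc : M.MReach s y0 i c log) (hy : (y : ℝ) = y0 + phase s log)
    (h : ∀ (c' : M.Conf) (log' : List Bool) (y' : I), M.MReach s y0 (i + 1) c' log' →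
      (y' : ℝ) = y0 + phase s log' →
      Ev s G P (sim .up c'.1 c'.2 log' LV V (M.cells (i + 1) W) A y')) :
    Ev s G P (sim .up c.1 c.2 log LV V (M.cells i W) (push (.cell : M.Sym) A) y) := by
  have hlog : ∀ u, (y0 : ℝ) + phase s (M.newLog c.1 u log) =
      y + if M.rd c.1 then s - (u.toNat : ℝ) else 0 := by
    intro u
    unfold newLog
    split_ifs
    · rw [phase_cons, hy]; ring
    · rw [hy]; ring
  refine hi.up hG hW (fun _ => ⟨isPush_lgs _ _, fun _ => isPush_stk _ _⟩) ?_
  refine .next (fun g => ?_) fun x' hx' => ?_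
  · obtain ⟨u, c', hs, hb⟩ := hG g y0 i c log hc
    obtain ⟨r, hr, -⟩ := Option.map_eq_some_iff.1 hs
    refine exists_nstep (u := u) (r := ⟨.up, r.1, upOps (fun j => tp M (mkS (M.cells i W)
      (push (.cell : M.Sym) A) (M.lgs log LV) (fun k => stk (c.2 k) (V k)) j)) (M.rd c.1) u r.2,
      if M.rd c.1 then 1 else 0, if M.rd c.1 then u.toNat else 0⟩)
      (isPush_sim (isPush_cells hW.isPush i) (isPush_push _ _)) ?_ ?_
    · simp only [act, mkS, tp_push, tp_stk]
      rw [hr]; rfl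
    · have : (y0 : ℝ) + phase s (M.newLog c.1 u log) ∈ Set.Icc (0 : ℝ) 1 := hb [] _ rfl
      rw [hlog] at this
      convert this using 1
      cases M.rd c.1 <;> simp
      ring
  · obtain ⟨A', hA', u, r, hr, h1, h2, h3, h4⟩ := nstep_upR hx'
    obtain rfl := (push_inj.1 hA').2
    have hs : M.step c u = some (r.1, fun k => applyOp (r.2 k) (c.2 k)) := by
      simp only [tp_stk] at hr
      unfold StackMachine.step
      rw [hr]; rfl
    have hx : x' = sim .up r.1 (fun k => applyOp (r.2 k) (c.2 k)) (M.newLog c.1 u log) LV V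
        (M.cells (i + 1) W) A x'.y := by
      refine NState.ext h1 h2 (h3.trans ?_) rfl
      rw [← cells_succ]
      congr 1
      · unfold newLog; split_ifs <;> rfl
      · funext k; exact datVal_stk _ _ _
    rw [hx]
    have hy' : (x'.y : ℝ) = y0 + phase s (M.newLog c.1 u log) := by rw [hlog, h4]
    refine h (r.1, fun k => applyOp (r.2 k) (c.2 k)) _ _ ⟨hc.1.succ hs, ?_⟩ hy'
    unfold newLog at hy' ⊢
    split_ifs at hy' ⊢
    · exact hc.2.cons (hy' ▸ x'.y.2)
    · exact hc.2

/-- The descent of a run. -/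
theorem descend {B : ℕ} (hB : ∀ j < B, M.Returns s j) {f : Bool} {q q' : M.Q} {X Y LV : I}
    {V : M.K → I} {y0 : I} (hY : IsBar M Y) : ∀ j m, j + m = B → ∀ (l : M.K → List M.Γ) log (y : I),
    Balanced s y0 log → log.length ≤ j → (∀ k, (l k).length ≤ j) →
    (y : ℝ) = y0 + phase s log →
    Ev s (M.Good s ∧ IsBar M Y)
      (fun z => IsBar M Y ∧ z = ⟨resume f, q, mkS (M.cells B Y) X LV V, y0⟩)
      (sim .down q' l log LV V (M.cells j (push (.bar f q : M.Sym) X)) (M.cells m Y) y) := by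
  intro j
  induction j with
  | zero =>
    intro m hm l log y hb h1 h2 hy
    obtain rfl : m = B := by omega
    obtain rfl := List.length_eq_zero_iff.1 (Nat.le_zero.1 h1)
    obtain rfl : l = fun _ => [] := funext fun k => List.length_eq_zero_iff.1 (Nat.le_zero.1 (h2 k))
    obtain rfl : y = y0 := Subtype.ext (by simpa [phase] using hy)
    refine .next (fun g => ?_) fun x' hx' => ?_
    · refine exists_nstep_of_zero (u := true) (r := ⟨resume f, q, retOps, 0, 0⟩)
        (isPush_sim (isPush_push _ _) (isPush_cells hY.isPush _)) ?_ rfl rfl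
      simp [act, mkS, cells]
    · refine .here ⟨hY, ?_⟩
      rcases nstep_down hx' with ⟨A, h, -⟩ | ⟨f', p, A, h, rfl⟩
      · cases (push_inj.1 h).1
      · obtain ⟨h1, h2⟩ := push_inj.1 h
        cases h1
        rw [← h2]
        simp [lgs, stk]
  | succ j ih =>
    intro m hm l log y hb h1 h2 hy
    rw [cells_succ]
    have hlog : (y : ℝ) + (log.head?.elim 0 fun b => (b.toNat : ℝ) - s) =
        y0 + phase s log.tail := by
      rw [hy]
      cases log with
      | nil => simp
      | cons b log => simp only [phase_cons, List.head?_cons, Option.elim_some, List.tail_cons]; ring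
    refine .next (fun g => ?_) fun x' hx' => ?_
    · refine exists_nstep (u := true) (r := ⟨.downC, q', downOps (fun i => tp M (mkS
        (push (.cell : M.Sym) (M.cells j (push (.bar f q : M.Sym) X))) (M.cells m Y) (M.lgs log LV)
        (fun k => stk (l k) (V k)) i)), if log.head?.isSome then -1 else 0,
        - (log.head?.elim 0 fun b => (b.toNat : ℤ))⟩)
        (isPush_sim (isPush_push _ _) (isPush_cells hY.isPush _)) ?_ ?_
      · simp only [act, mkS, tp_push, tp_lgs]
      · have : (y0 : ℝ) + phase s log.tail ∈ Set.Icc (0 : ℝ) 1 := hb.tail [] _ rfl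
        rw [← hlog] at this
        convert this using 1
        cases log.head? <;> simp
        ring
    · rcases nstep_down hx' with ⟨A, h, h1', h2', h3, h4⟩ | ⟨f', p, A, h, -⟩
      · obtain ⟨-, rfl⟩ := push_inj.1 h
        rw [tp_lgs, hlog] at h4
        have hx : x' = sim .downC q' (fun k => (l k).tail) log.tail LV V
            (M.cells j (push (.bar f q : M.Sym) X)) (push (.cell : M.Sym) (M.cells m Y)) x'.y := by
          refine NState.ext h1' h2' (h3.trans ?_) rfl
          rw [tl_lgs]
          congr 1
          funext k
          exact tl_stk _ _
        rw [hx]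
        refine (hB j (by omega)).downC (fun g => g.1) (isBar_push _ _ _)
          (fun _ => ⟨isPush_lgs _ _, fun _ => isPush_stk _ _⟩) ?_
        rw [← cells_succ]
        refine ih (m + 1) (by omega) _ _ _ hb.tail ?_ (fun k => ?_) h4
        · simp only [List.length_tail]; omega
        · have := h2 k
          simp only [List.length_tail]; omega
      · cases (push_inj.1 h).1

theorem returns (B : ℕ) : M.Returns s B := by
  induction B using Nat.strong_induction_on with
  | _ B hB =>
  intro f q X Y LV V y0 hY
  have key : ∀ m i, i + m = B → ∀ (c : M.Conf) log (y : I), M.MReach s y0 i c log →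
      (y : ℝ) = y0 + phase s log → Ev s (M.Good s ∧ IsBar M Y)
      (fun z => IsBar M Y ∧ z = ⟨resume f, q, mkS (M.cells B Y) X LV V, y0⟩)
      (sim .up c.1 c.2 log LV V (M.cells i (push (.bar f q : M.Sym) X)) (M.cells m Y) y) := by
    intro m
    induction m with
    | zero =>
      intro i hi c log y hc hy
      obtain rfl : i = B := by omega
      refine .next (fun g => ?_) fun x' hx' => ?_
      · obtain ⟨f', p, Y', rfl⟩ := g.2
        refine exists_nstep_of_zero (u := true) (r := ⟨.down, c.1, keep, 0, 0⟩)
          (isPush_sim (isPush_cells (isPush_push _ _) _) (isPush_push _ _)) ?_ rfl rfl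
        simp [act, mkS, cells]
      · rcases nstep_up hx' with ⟨A, h, -⟩ | ⟨f', p, A, h, rfl⟩
        · exact absurd ⟨A, h⟩ hY
        · have hl := hc.1.length_le
          exact descend hB ⟨f', p, A, h⟩ i 0 (by omega) _ _ _ hc.2 hl.1 hl.2 hy
    | succ m ih =>
      intro i hi c log y hc hy
      rw [cells_succ]
      refine (hB i (by omega)).step (fun g => g.1) (isBar_push _ _ _) hc hy
        fun c' log' y' hc' hy' => ih (i + 1) (by omega) c' log' y' hc' hy'
  refine key B 0 (by omega) (M.q0, fun _ => []) [] y0 ⟨.zero, ?_⟩ (by simp [phase])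
  intro v u h
  obtain ⟨rfl, rfl⟩ := List.append_eq_nil_iff.1 h.symm
  simp [phase]

theorem MReach.zero (y : I) : M.MReach s y 0 (M.q0, fun _ => []) [] := by
  refine ⟨.zero, ?_⟩
  intro v u h
  obtain ⟨rfl, rfl⟩ := List.append_eq_nil_iff.1 h.symm
  simp [phase]

/-- A fresh state with `n` cells ahead performs `n` steps of the simulation. -/
theorem ev_reach (n : ℕ) (f : Bool) (q : M.Q) (X A LV : I) (V : M.K → I) (y0 : I) :
    Ev s (M.Good s) (fun z => ∃ (c : M.Conf) (log : List Bool) (y : I), M.MReach s y0 n c log ∧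
      (y : ℝ) = y0 + phase s log ∧
      z = sim .up c.1 c.2 log LV V (M.cells n (push (.bar f q : M.Sym) X)) A y)
    (M.fresh f q X (M.cells n A) LV V y0) := by
  suffices key : ∀ m i, i + m = n → ∀ (c : M.Conf) log (y : I), M.MReach s y0 i c log →
      (y : ℝ) = y0 + phase s log → Ev s (M.Good s) (fun z => ∃ (c : M.Conf) (log : List Bool)
        (y : I), M.MReach s y0 n c log ∧ (y : ℝ) = y0 + phase s log ∧
        z = sim .up c.1 c.2 log LV V (M.cells n (push (.bar f q : M.Sym) X)) A y)
      (sim .up c.1 c.2 log LV V (M.cells i (push (.bar f q : M.Sym) X)) (M.cells m A) y) from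
    key n 0 (by omega) (M.q0, fun _ => []) [] y0 (.zero _) (by simp [phase])
  intro m
  induction m with
  | zero =>
    intro i hi c log y hc hy
    obtain rfl : i = n := by omega
    exact .here ⟨c, log, y, hc, hy, rfl⟩
  | succ m ih =>
    intro i hi c log y hc hy
    rw [cells_succ]
    exact (returns i).step id (isBar_push _ _ _) hc hy
      fun c' log' y' hc' hy' => ih (i + 1) (by omega) c' log' y' hc' hy'

end StackMachine

end

section
namespace StackMachine
open unitInterval
variable {M : StackMachine} {s : ℝ}

/-! ### Every orbit makes calls on large piles -/

variable (M) in
/-- Calls on a pile of at least `n` cells. -/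
def FreshN (n : ℕ) (z : M.NState) : Prop :=
  ∃ f q X Y LV V y, z = M.fresh f q X (M.cells n Y) LV V y

variable (M) in
/-- Every orbit from such a state makes a call on a pile of at least `n` cells. -/
def Calls (s : ℝ) (n : ℕ) (p : Phase) (bh ah : I) : Prop :=
  ∀ q log dat y, Ev s False (M.FreshN n) ⟨p, q, mkS bh ah log dat, y⟩

variable (M) in
/-- Every orbit from the corresponding call makes a call on a pile of at least `n` cells. -/
def CallsFresh (s : ℝ) (n : ℕ) (f : Bool) (X A : I) : Prop :=
  ∀ q LV V y, Ev s False (M.FreshN n) (M.fresh f q X A LV V y)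

variable {n : ℕ} {bh ah : I}

theorem callsFresh_cells (f : Bool) (X Y : I) : M.CallsFresh s n f X (M.cells n Y) :=
  fun _ _ _ _ => .here ⟨_, _, _, _, _, _, _, rfl⟩

theorem Calls.up (hc : IsCell M ah → M.CallsFresh s n false ah bh)
    (hb : IsBar M ah → M.Calls s n .down bh ah) : M.Calls s n .up bh ah := by
  intro q log dat y
  refine .next False.elim fun x' hx' => ?_
  rcases nstep_up hx' with ⟨A, h, rfl⟩ | ⟨f, p, A, h, rfl⟩
  · exact hc ⟨A, h⟩ _ _ _ _
  · exact hb ⟨f, p, A, h⟩ _ _ _ _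

theorem Calls.upR (h : ∀ A, ah = push (.cell : M.Sym) A →
    M.Calls s n .up (push (.cell : M.Sym) bh) A) : M.Calls s n .upR bh ah := by
  intro q log dat y
  refine .next False.elim fun x' hx' => ?_
  obtain ⟨A, hA, u, r, -, h1, h2, h3, -⟩ := nstep_upR hx'
  obtain ⟨p, q, S, y⟩ := x'
  obtain rfl : p = _ := h1
  obtain rfl : S = _ := h3
  exact h A hA _ _ _ _

theorem Calls.down (hc : ∀ A, bh = push (.cell : M.Sym) A →
    M.Calls s n .downC A (push (.cell : M.Sym) ah))
    (hb : ∀ f p A, bh = push (.bar f p : M.Sym) A → M.Calls s n (resume f) ah A) :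
    M.Calls s n .down bh ah := by
  intro q log dat y
  refine .next False.elim fun x' hx' => ?_
  rcases nstep_down hx' with ⟨A, hA, h1, -, h3, -⟩ | ⟨f, p, A, h, rfl⟩
  · obtain ⟨p, q, S, y⟩ := x'
    obtain rfl : p = _ := h1
    obtain rfl : S = _ := h3
    exact hc A hA _ _ _ _
  · exact hb f p A h _ _ _ _

theorem Calls.downC (h : M.CallsFresh s n true ah bh) : M.Calls s n .downC bh ah := by
  intro q log dat y
  refine .next False.elim fun x' hx' => ?_
  obtain rfl := nstep_downC hx'
  exact h _ _ _ _

theorem Calls.downR (h : ∀ A, ah = push (.cell : M.Sym) A → M.Calls s n .down bh ah) :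
    M.Calls s n .downR bh ah := by
  intro q log dat y
  refine .next False.elim fun x' hx' => ?_
  obtain ⟨A, hA, rfl⟩ := nstep_downR hx'
  exact h A hA _ _ _ _

theorem CallsFresh.ret {f : Bool} {B : ℕ} {X Y : I} (hY : ¬ IsCell M Y)
    (h : IsBar M Y → M.Calls s n (resume f) (M.cells B Y) X) :
    M.CallsFresh s n f X (M.cells B Y) := by
  intro q LV V y
  refine ((returns B f q X Y LV V y hY).weaken False.elim).bind ?_
  rintro _ ⟨hb, rfl⟩
  exact h hb _ _ _ _

theorem Calls.resume (f : Bool) (h1 : M.Calls s n .upR bh ah) (h2 : M.Calls s n .downR bh ah) :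
    M.Calls s n (resume f) bh ah := by
  cases f
  exacts [h1, h2]

theorem calls_zero (p : Phase) (bh ah : I) : M.Calls s 0 p bh ah := by
  have hf : ∀ f X A, M.CallsFresh s 0 f X A := fun f X A => callsFresh_cells f X A
  have hdC : ∀ bh ah, M.Calls s 0 .downC bh ah := fun bh ah => .downC (hf _ _ _)
  have hd : ∀ W ah, M.Calls s 0 .down (push (.cell : M.Sym) W) ah := fun W ah =>
    .down (fun _ _ => hdC _ _) fun f p A h => by cases (push_inj.1 h).1
  have hu : ∀ W ah, M.Calls s 0 .up (push (.cell : M.Sym) W) ah := fun W ah =>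
    .up (fun _ => hf _ _ _) fun _ => hd _ _
  have huR : ∀ bh ah, M.Calls s 0 .upR bh ah := fun bh ah => .upR fun _ _ => hu _ _
  have hd' : ∀ bh A, M.Calls s 0 .down bh (push (.cell : M.Sym) A) := fun bh A =>
    .down (fun _ _ => hdC _ _) fun f p W _ => .resume f (huR _ _) (.downR fun _ _ => hd _ _)
  have hdR : ∀ bh ah, M.Calls s 0 .downR bh ah := fun bh ah =>
    .downR fun A h => by rw [h]; exact hd' _ _
  have hda : ∀ bh ah, M.Calls s 0 .down bh ah := fun bh ah =>
    .down (fun _ _ => hdC _ _) fun f p W _ => .resume f (huR _ _) (hdR _ _)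
  cases p
  exacts [.up (fun _ => hf _ _ _) fun _ => hda _ _, huR _ _, hda _ _, hdC _ _, hdR _ _]

theorem calls_descend {W : I} (hW : ¬ IsCell M W) (m : ℕ) (A : I)
    (h : IsBar M W → M.Calls s n .down W (M.cells m A)) :
    M.Calls s n .down (M.cells m W) A := by
  induction m generalizing A with
  | zero =>
    by_cases hb : IsBar M W
    · exact h hb
    · exact .down (fun B hB => absurd ⟨B, hB⟩ hW) fun f p B hB => absurd ⟨f, p, B, hB⟩ hb
  | succ m ih =>
    rw [cells_succ]
    refine .down (fun B hB => ?_) fun f p B hB => by cases (push_inj.1 hB).1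
    obtain rfl := (push_inj.1 hB).2
    refine .downC (.ret hW fun hb => .downR fun _ _ => ih _ fun hb => ?_)
    rw [cells_push, ← cells_succ]
    exact h hb

theorem calls_succ (h : ∀ p bh ah, M.Calls s n p bh ah) (p : Phase) (bh ah : I) :
    M.Calls s (n + 1) p bh ah := by
  have l1 : ∀ W ah, M.Calls s (n + 1) .down (M.cells (n + 2) W) ah := fun W ah => by
    rw [cells_succ]
    refine .down (fun B hB => ?_) fun f p B hB => by cases (push_inj.1 hB).1
    obtain rfl := (push_inj.1 hB).2
    exact .downC (callsFresh_cells _ _ _)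
  have l2 : ∀ W ah, M.Calls s (n + 1) .up (M.cells (n + 2) W) ah := fun W ah =>
    .up (fun _ => by rw [cells_succ, ← cells_push]; exact callsFresh_cells _ _ _) fun _ => l1 _ _
  have l3 : ∀ W ah, M.Calls s (n + 1) .upR (M.cells (n + 1) W) ah := fun W ah =>
    .upR fun _ _ => by rw [← cells_succ]; exact l2 _ _
  have l5 : ∀ W, IsBar M W → ∀ A, M.Calls s (n + 1) .down W (M.cells (n + 2) A) := by
    rintro _ ⟨f', p', W, rfl⟩ A
    refine .down (fun B hB => by cases (push_inj.1 hB).1) fun f p B _ =>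
      .resume f ?_ (.downR fun _ _ => l1 _ _)
    rw [cells_succ, ← cells_push]
    exact l3 _ _
  have l7 : ∀ W, IsBar M W → ∀ A, M.Calls s (n + 1) .down W (M.cells (n + 1) A) := by
    rintro _ ⟨f', p', W, rfl⟩ A
    refine .down (fun B hB => by cases (push_inj.1 hB).1) fun f p B _ =>
      .resume f (l3 _ _) (.downR fun B' hB' => ?_)
    rw [hB']
    by_cases hA : IsCell M A
    · obtain ⟨A, rfl⟩ := hA
      rw [cells_push, ← cells_succ]
      exact l1 _ _
    · refine calls_descend hA _ _ fun hb => ?_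
      rw [cells_push, ← cells_succ]
      exact l5 _ hb _
  have l8 : ∀ W, IsBar M W → ∀ A,
      M.Calls s (n + 1) .down (M.cells n W) (push (.cell : M.Sym) A) := fun W hW A => by
    refine calls_descend hW.not_isCell _ _ fun hb => ?_
    rw [cells_push, ← cells_succ]
    exact l7 _ hb _
  have l9 : ∀ W, IsBar M W → ∀ A, M.Calls s (n + 1) .down (M.cells (n + 1) W) A := fun W hW A => by
    rw [cells_succ]
    refine .down (fun B hB => ?_) fun f p B hB => by cases (push_inj.1 hB).1
    obtain rfl := (push_inj.1 hB).2
    exact .downC (.ret hW.not_isCell fun _ => .downR fun _ _ => l8 _ hW _)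
  have l10 : ∀ W, IsBar M W → ∀ A, M.Calls s (n + 1) .upR (M.cells n W) A := fun W hW A =>
    .upR fun A' _ => by
      rw [← cells_succ]
      exact .up (fun _ => callsFresh_cells _ _ _) fun _ => l9 _ hW _
  have l11 : ∀ W, IsBar M W → ∀ A, M.Calls s (n + 1) .downR (M.cells n W) A := fun W hW A =>
    .downR fun A' hA => by rw [hA]; exact l8 _ hW _
  intro q log dat y
  refine (h p bh ah q log dat y).bind ?_
  rintro _ ⟨f, q, X, Y, LV, V, y, rfl⟩
  by_cases hY : IsCell M Y
  · obtain ⟨Y, rfl⟩ := hY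
    rw [cells_push, ← cells_succ]
    exact callsFresh_cells _ _ _ _ _ _ _
  · exact CallsFresh.ret hY (fun hb => .resume f (l10 _ hb _) (l11 _ hb _)) _ _ _ _

theorem calls (n : ℕ) (x : M.NState) : Ev s False (M.FreshN n) x := by
  have : ∀ n p bh ah, M.Calls s n p bh ah := fun n => by
    induction n with
    | zero => exact calls_zero
    | succ n ih => exact calls_succ ih
  have := this n x.ph (x.S .bh) (x.S .ah) x.q (x.S .log) (fun k => x.S (.dat k)) x.y
  rwa [mkS_eta] at this

/-- Infinite orbits simulate arbitrarily long runs. -/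
theorem exists_mreach_of_orbit (o : ℕ → M.NState) (ho : ∀ t, M.NStep s (o t) (o (t + 1)))
    (n : ℕ) : ∃ y c log, M.MReach s y n c log := by
  obtain ⟨t, f, q, X, Y, LV, V, y, h⟩ := (calls (s := s) n (o 0)).exists_orbit o ho 0 rfl
  obtain ⟨t', c, log, y', hc, -⟩ :=
    ((ev_reach n f q X Y LV V y).weaken False.elim).exists_orbit o ho t h
  exact ⟨y, c, log, hc⟩

/-- If every run on a balanced input can be continued, then there is an infinite orbit. -/
theorem Good.exists_orbit (h : M.Good s) :
    ∃ o : ℕ → M.NState, ∀ t, M.NStep s (o t) (o (t + 1)) := by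
  obtain ⟨v, hv⟩ := exists_push_fixed (.cell : M.Sym)
  have key : ∀ i (c : M.Conf) (log : List Bool) (y : I), M.MReach s 0 i c log →
      (y : ℝ) = (0 : I) + phase s log → ∃ (c' : M.Conf) (log' : List Bool) (y' : I),
      M.MReach s 0 (i + 1) c' log' ∧ (y' : ℝ) = (0 : I) + phase s log' ∧
      Relation.TransGen (M.NStep s)
        (sim .up c.1 c.2 log 0 0 (M.cells i (push (.bar false M.q0 : M.Sym) 0)) v y)
        (sim .up c'.1 c'.2 log' 0 0 (M.cells (i + 1) (push (.bar false M.q0 : M.Sym) 0)) v y') := by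
    intro i c log y hc hy
    have := (returns i).step (G := M.Good s) (P := fun z => ∃ (c' : M.Conf) (log' : List Bool)
      (y' : I), M.MReach s 0 (i + 1) c' log' ∧ (y' : ℝ) = (0 : I) + phase s log' ∧
      z = (sim .up c'.1 c'.2 log' 0 0 (M.cells (i + 1) (push (.bar false M.q0 : M.Sym) 0)) v y'))
      (A := v) (LV := 0) (V := 0) id (isBar_push false M.q0 0) hc hy
      fun c' log' y' hc' hy' => .here ⟨c', log', y', hc', hy', rfl⟩
    rw [hv] at this
    obtain ⟨z, ⟨c', log', y', hc', hy', rfl⟩, hz⟩ := this.exists_path h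
    refine ⟨c', log', y', hc', hy', ?_⟩
    rcases Relation.reflTransGen_iff_eq_or_transGen.1 hz with hz' | hz'
    · exfalso
      have h1 := congrFun (congrArg NState.S hz') .bh
      simp only [mkS] at h1
      clear hz hz' hc hc' hy hy' this
      induction i with
      | zero => cases (push_inj.1 h1).1
      | succ i ih =>
        rw [cells_succ (i + 1), cells_succ i] at h1
        exact ih ((cells_succ _ _).trans (push_inj.1 h1).2)
    · exact hz'
  let inv : M.NState → Prop := fun x => ∃ z, (∃ i, ∃ (c : M.Conf) (log : List Bool) (y : I),
    M.MReach s 0 i c log ∧ (y : ℝ) = (0 : I) + phase s log ∧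
    z = (sim .up c.1 c.2 log 0 0 (M.cells i (push (.bar false M.q0 : M.Sym) 0)) v y)) ∧
    Relation.ReflTransGen (M.NStep s) x z
  have hstep : ∀ x : {x // inv x}, ∃ x' : {x // inv x}, M.NStep s x x' := by
    rintro ⟨x, z, ⟨i, c, log, y, hc, hy, rfl⟩, hx⟩
    obtain ⟨c', log', y', hc', hy', hz⟩ := key i c log y hc hy
    obtain ⟨x', h1, h2⟩ := Relation.TransGen.head'_iff.1 (Relation.TransGen.trans_right hx hz)
    exact ⟨⟨x', _, ⟨i + 1, c', log', y', hc', hy', rfl⟩, h2⟩, h1⟩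
  choose f hf using hstep
  let x0 : {x // inv x} := ⟨_, _, ⟨0, (M.q0, fun _ => []), [], 0, .zero _, by simp [phase], rfl⟩,
    .refl⟩
  refine ⟨fun t => (f^[t] x0).1, fun t => ?_⟩
  have := hf (f^[t] x0)
  rwa [← Function.iterate_succ_apply' f] at this

end StackMachine

end

section
open unitInterval

/-! ### Slopes coding points of Cantor space -/

/-- The real number with base eight digits `2 + x k`. -/
noncomputable def slope (x : ℕ → ℕ) : ℝ := ∑' k, (2 + x k : ℝ) * (1 / 8) ^ (k + 1)

theorem summable_slope {x : ℕ → ℕ} (hx : ∀ n, x n ≤ 1) :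
    Summable fun k => (2 + x k : ℝ) * (1 / 8) ^ (k + 1) := by
  refine Summable.of_nonneg_of_le (fun k => by positivity) (fun k => ?_)
    (((summable_geometric_of_lt_one (r := (1 / 8 : ℝ)) (by norm_num) (by norm_num)).mul_right
      (1 / 8)).mul_left 3)
  have : (x k : ℝ) ≤ 1 := by exact_mod_cast hx k
  rw [pow_succ]
  gcongr
  linarith

theorem slope_mem {x : ℕ → ℕ} (hx : ∀ n, x n ≤ 1) : 2 / 7 ≤ slope x ∧ slope x ≤ 3 / 7 := by
  have hg : HasSum (fun k => (1 / 8 : ℝ) ^ (k + 1)) (1 / 7) := by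
    have := (hasSum_geometric_of_lt_one (r := (1 / 8 : ℝ)) (by norm_num) (by norm_num)).mul_right
      (1 / 8)
    simp_rw [← pow_succ] at this
    rwa [show (1 - 1 / 8 : ℝ)⁻¹ * (1 / 8) = 1 / 7 by norm_num] at this
  have h2 := (hg.mul_left 2).tsum_eq
  have h3 := (hg.mul_left 3).tsum_eq
  constructor
  · rw [show (2 / 7 : ℝ) = 2 * (1 / 7) by norm_num, ← h2]
    refine (hg.mul_left 2).summable.tsum_le_tsum (fun k => ?_) (summable_slope hx)
    gcongr
    have : (0 : ℝ) ≤ x k := Nat.cast_nonneg _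
    linarith
  · rw [show (3 / 7 : ℝ) = 3 * (1 / 7) by norm_num, ← h3]
    refine (summable_slope hx).tsum_le_tsum (fun k => ?_) (hg.mul_left 3).summable
    have : (x k : ℝ) ≤ 1 := by exact_mod_cast hx k
    gcongr
    linarith

theorem slope_eq {x : ℕ → ℕ} (hx : ∀ n, x n ≤ 1) :
    8 * slope x = 2 + x 0 + slope fun n => x (n + 1) := by
  unfold slope
  rw [(summable_slope hx).tsum_eq_zero_add, mul_add, ← tsum_mul_left]
  congr 1
  · rw [zero_add, pow_one]; ring
  · congr 1
    funext k
    rw [pow_succ _ (k + 1)]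
    ring

theorem pow_mul_slope {x : ℕ → ℕ} (hx : ∀ n, x n ≤ 1) (k : ℕ) :
    ∃ J : ℕ, 8 ^ k * slope x = J + slope fun n => x (n + k) := by
  induction k generalizing x with
  | zero => exact ⟨0, by simp⟩
  | succ k ih =>
    obtain ⟨J, hI⟩ := ih (x := fun n => x (n + 1)) fun n => hx _
    refine ⟨8 ^ k * (2 + x 0) + J, ?_⟩
    rw [pow_succ, mul_assoc, slope_eq hx, mul_add, hI]
    push_cast
    simp only [add_assoc]

/-- The base eight digits of a real number, read as bits. -/
noncomputable def digit (s : ℝ) (j : ℕ) : ℕ := if ⌊8 ^ (j + 1) * s⌋₊ % 8 = 3 then 1 else 0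

theorem floor_div_pow (s : ℝ) {j k : ℕ} (h : j ≤ k) :
    ⌊8 ^ k * s⌋₊ / 8 ^ (k - j) = ⌊8 ^ j * s⌋₊ := by
  have := Nat.floor_div_natCast (8 ^ k * s : ℝ) (8 ^ (k - j))
  rw [← this]
  congr 1
  rw [div_eq_iff (by positivity)]
  push_cast
  rw [mul_right_comm, ← pow_add, Nat.add_sub_cancel' h]

theorem digitList_floor (s : ℝ) (k : ℕ) : digitList k ⌊8 ^ k * s⌋₊ = pref (digit s) k := by
  unfold digitList pref
  refine List.map_congr_left fun j hj => ?_
  rw [List.mem_range] at hj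
  rw [show k - 1 - j = k - (j + 1) by omega, floor_div_pow s (by omega)]
  rfl

theorem floor_slope {x : ℕ → ℕ} (hx : ∀ n, x n ≤ 1) {k J : ℕ}
    (hI : 8 ^ k * slope x = J + slope fun n => x (n + k)) : ⌊8 ^ k * slope x⌋₊ = J := by
  have h := slope_mem (x := fun n => x (n + k)) fun n => hx _
  rw [Nat.floor_eq_iff (by rw [hI]; have : (0 : ℝ) ≤ J := Nat.cast_nonneg _; linarith), hI]
  constructor <;> linarith

theorem digit_slope {x : ℕ → ℕ} (hx : ∀ n, x n ≤ 1) : digit (slope x) = x := by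
  funext j
  obtain ⟨J, hI⟩ := pow_mul_slope hx j
  have h1 : 8 ^ (j + 1) * slope x = (8 * J + (2 + x j) : ℕ) + slope fun n => x (n + (j + 1)) := by
    rw [pow_succ', mul_assoc, hI, mul_add, slope_eq fun n => hx _]
    push_cast
    simp only [zero_add, add_assoc, add_comm 1 j]
  unfold digit
  rw [floor_slope hx h1]
  have := hx j
  split_ifs <;> omega

namespace StackMachine
variable {M : StackMachine} {s : ℝ}

theorem Balanced.dev_le {y : I} {u log : List Bool} {v : List Bool} (h : Balanced s y log)
    (hu : log = v ++ u) : |(u.count true : ℝ) - u.length * s| ≤ 1 := by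
  have h1 := h v u hu
  have h2 := y.2
  unfold phase at h1
  rw [abs_le]
  constructor <;> linarith [h1.1, h1.2, h2.1, h2.2]

end StackMachine

open StackMachine

theorem not_badCount {x : ℕ → ℕ} (hx : x ∈ diagClass) {L c : ℕ} (h : |(c : ℝ) - L * slope x| ≤ 1) :
    ¬ BadCount L c := by
  rintro ⟨k, -, rfl, hk⟩
  obtain ⟨J, hI⟩ := pow_mul_slope hx.1 k
  have hs := slope_mem (x := fun n => x (n + k)) fun n => hx.1 _
  have e : (((16 * 8 ^ k : ℕ) : ℝ)) * slope x = 16 * J + 16 * slope fun n => x (n + k) := by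
    push_cast
    rw [mul_assoc, hI]; ring
  rw [e, abs_le] at h
  have h1 : 16 * J + 3 < c := by
    have : (16 * J + 3 : ℝ) < c := by linarith [h.1]
    exact_mod_cast this
  have h2 : c < 16 * J + 8 := by
    have : (c : ℝ) < 16 * J + 8 := by linarith [h.2]
    exact_mod_cast this
  rcases hk with hk | hk
  · omega
  · rw [show c / 16 = J by omega, ← floor_slope hx.1 hI, digitList_floor, digit_slope hx.1] at hk
    exact hx.2 k hk

theorem WordTester.good (W : WordTester fun u => BadCount u.length (u.count true))
    {x : ℕ → ℕ} (hx : x ∈ diagClass) : W.M.Good (slope x) := by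
  intro y i c log h
  have hstep := W.exists_step h.1 fun v u hu => not_badCount hx (h.2.dev_le hu)
  have hs := slope_mem hx.1
  have h0 := h.2 [] log rfl
  by_cases hp : y + phase (slope x) log + slope x ≤ 1
  · obtain ⟨c', hc'⟩ := hstep false
    refine ⟨false, c', hc', ?_⟩
    unfold newLog
    split_ifs
    · refine h.2.cons ?_
      rw [phase_cons]
      constructor <;> simp <;> linarith [h0.1]
    · exact h.2
  · obtain ⟨c', hc'⟩ := hstep true
    refine ⟨true, c', hc', ?_⟩
    unfold newLog
    split_ifs
    · refine h.2.cons ?_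
      rw [phase_cons]
      constructor <;> simp <;> linarith [h0.2]
    · exact h.2

theorem floor_of_count {s : ℝ} {n c c' : ℕ} (h1 : |(c : ℝ) - 16 * 8 ^ n * s| ≤ 1)
    (h2 : 2 ≤ c % 16 ∧ c % 16 ≤ 13) (h3 : |(c' : ℝ) - 16 * 8 ^ n * s| ≤ 1) :
    c' / 16 = ⌊8 ^ n * s⌋₊ := by
  rw [abs_le] at h1 h3
  have e : (c : ℝ) = 16 * (c / 16 : ℕ) + (c % 16 : ℕ) := by exact_mod_cast (Nat.div_add_mod c 16).symm
  have e1 : (2 : ℝ) ≤ (c % 16 : ℕ) := by exact_mod_cast h2.1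
  have e2 : ((c % 16 : ℕ) : ℝ) ≤ 13 := by exact_mod_cast h2.2
  have e3 : (0 : ℝ) ≤ (c / 16 : ℕ) := Nat.cast_nonneg _
  have hfl : ⌊8 ^ n * s⌋₊ = c / 16 := by
    rw [Nat.floor_eq_iff (by linarith)]
    constructor <;> linarith
  have k1 : c' ≤ c + 2 := by
    have : (c' : ℝ) ≤ c + 2 := by linarith
    exact_mod_cast this
  have k2 : c ≤ c' + 2 := by
    have : (c : ℝ) ≤ c' + 2 := by linarith
    exact_mod_cast this
  omega

theorem WordTester.exists_count (W : WordTester fun u => BadCount u.length (u.count true))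
    {s : ℝ} (o : ℕ → W.M.NState) (ho : ∀ t, W.M.NStep s (o t) (o (t + 1))) (n : ℕ) :
    ∃ c : ℕ, |(c : ℝ) - 16 * 8 ^ n * s| ≤ 1 ∧ (2 ≤ c % 16 ∧ c % 16 ≤ 13) ∧
      ¬ DiagBad (digitList n (c / 16)) := by
  obtain ⟨N, hN⟩ := W.exists_time (16 * 8 ^ n)
  obtain ⟨y, c, log, h⟩ := exists_mreach_of_orbit o ho N
  obtain ⟨hl, hb⟩ := hN c log h.1
  set d := log.length - 16 * 8 ^ n with hd
  have hdrop := (List.take_append_drop d log).symm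
  have hlen : (log.drop d).length = 16 * 8 ^ n := by rw [List.length_drop]; omega
  have h1 := hb _ _ hdrop (by
    rw [← List.length_pos_iff, List.length_take]; omega)
  have h2 := h.2.dev_le hdrop
  rw [hlen] at h1 h2
  push_cast at h2
  refine ⟨_, h2, ?_⟩
  by_contra hc
  refine h1 ⟨n, ?_, rfl, ?_⟩
  · have := Nat.lt_pow_self (n := n) (a := 8) (by norm_num)
    omega
  · tauto

/-- A nested machine whose infinite orbits exist only for slopes coding points of the class of
diagonally noncomputable functions. -/
theorem exists_nested : ∃ M : StackMachine,
    (∃ s : I, ∃ o : ℕ → M.NState, ∀ t, M.NStep s (o t) (o (t + 1))) ∧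
    ∀ s : ℝ, ∀ o : ℕ → M.NState, (∀ t, M.NStep s (o t) (o (t + 1))) → digit s ∈ diagClass ∧
      ∀ n c : ℕ, |(c : ℝ) - 16 * 8 ^ n * s| ≤ 1 → c / 16 = ⌊8 ^ n * s⌋₊ := by
  obtain ⟨W⟩ := exists_wordTester
  refine ⟨W.M, ?_, fun s o ho => ⟨⟨fun n => ?_, fun n => ?_⟩, fun n c hc => ?_⟩⟩
  · obtain ⟨x, hx⟩ := diagClass_nonempty
    have hs := slope_mem hx.1
    exact ⟨⟨slope x, by linarith, by linarith⟩, (W.good hx).exists_orbit⟩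
  · unfold digit
    split_ifs <;> omega
  · obtain ⟨c, h1, h2, h3⟩ := W.exists_count o ho n
    rwa [floor_of_count h1 h2 h1, digitList_floor] at h3
  · obtain ⟨c', h1, h2, -⟩ := W.exists_count o ho n
    exact floor_of_count h1 h2 hc

end

section
open unitInterval

/-! ### Integer affine systems and tilings of the quadrant -/

/-- The value of a linear form with integer coefficients. -/
noncomputable def evalForm {ι : Type} [Fintype ι] (a : ι → ℤ) (x : ι → ℝ) : ℝ := ∑ j, (a j : ℝ) * x j

section
variable {ι : Type} [Fintype ι] (a b : ι → ℤ) (x : ι → ℝ)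

@[simp] theorem evalForm_sub : evalForm (a - b) x = evalForm a x - evalForm b x := by
  simp [evalForm, sub_mul, Finset.sum_sub_distrib]

@[simp] theorem evalForm_single [DecidableEq ι] (j : ι) (m : ℤ) :
    evalForm (Pi.single j m) x = m * x j := by
  simp [evalForm, Pi.single_apply]

end

/-- Dynamics of finitely many registers in the unit interval, given by a finite automaton and
affine equations with integer coefficients between successive register values. -/
structure AffineSystem where
  E : Type
  ι : Type
  κ : Type
  finE : Finite E
  finι : Fintype ι
  finκ : Finite κ
  nxt : E → E → Prop
  coef : κ → E → ι ⊕ ι → ℤ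
  const : κ → E → ℤ

namespace AffineSystem
variable (Z : AffineSystem)

instance : Finite Z.E := Z.finE
instance : Fintype Z.ι := Z.finι
instance : Finite Z.κ := Z.finκ

/-- Orbits of an affine system. -/
def Orbit (e : ℕ → Z.E) (x : ℕ → Z.ι → I) : Prop :=
  ∀ t, Z.nxt (e t) (e (t + 1)) ∧ ∀ k,
    evalForm (Z.coef k (e t)) (Sum.elim (fun i => (x t i : ℝ)) fun i => (x (t + 1) i : ℝ)) +
      Z.const k (e t) = 0

/-- A bound for the carries. -/
noncomputable def bound : ℕ :=
  letI := Fintype.ofFinite Z.E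
  letI := Fintype.ofFinite Z.κ
  ∑ p : Z.κ × Z.E, ∑ j, (Z.coef p.1 p.2 j).natAbs

theorem sum_natAbs_le (k : Z.κ) (e : Z.E) : ∑ j, (Z.coef k e j).natAbs ≤ Z.bound := by
  unfold bound
  let _ := Fintype.ofFinite Z.E
  let _ := Fintype.ofFinite Z.κ
  exact Finset.single_le_sum (f := fun p : Z.κ × Z.E => ∑ j, (Z.coef p.1 p.2 j).natAbs)
    (fun _ _ => Nat.zero_le _) (Finset.mem_univ (k, e))

/-- Tiles: bits of the registers, a label, and carries. -/
structure Tile where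
  bits : Z.ι → Bool
  e : Z.E
  carry : Z.κ → Set.Icc (-(Z.bound : ℤ)) Z.bound

instance : Finite Z.Tile :=
  Finite.of_injective (fun a : Z.Tile => (a.bits, a.e, a.carry)) fun a b h => by
    cases a; cases b; simp_all

/-- The increment of a carry. -/
def incr (k : Z.κ) (a up : Z.Tile) : ℤ :=
  ∑ j, Z.coef k a.e j * (Sum.elim a.bits up.bits j).toNat + Z.const k a.e

/-- The local rule: a tile, its right neighbour and its upper neighbour. -/
def Loc (a right up : Z.Tile) : Prop :=
  right.e = a.e ∧ Z.nxt a.e up.e ∧ ∀ k, (right.carry k : ℤ) = a.carry k + Z.incr k a up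

/-- Tilings of the quadrant. -/
def Tiling (T : ℕ → ℕ → Z.Tile) : Prop := ∀ n t, Z.Loc (T n t) (T (n + 1) t) (T n (t + 1))

variable {Z}

theorem floor_step {x : ℝ} (hx : x ∈ Set.Icc (0 : ℝ) 1) (n : ℕ) :
    ((decide (⌊n * x⌋ < ⌊(n + 1 : ℕ) * x⌋)).toNat : ℤ) = ⌊(n + 1 : ℕ) * x⌋ - ⌊n * x⌋ := by
  have h1 : ⌊n * x⌋ ≤ ⌊(n + 1 : ℕ) * x⌋ := Int.floor_le_floor (by push_cast; linarith [hx.1])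
  have h2 : ⌊(n + 1 : ℕ) * x⌋ ≤ ⌊n * x⌋ + 1 := by
    rw [← Int.floor_add_one]
    exact Int.floor_le_floor (by push_cast; linarith [hx.2])
  by_cases h : ⌊n * x⌋ < ⌊(n + 1 : ℕ) * x⌋
  · simp only [h, decide_true, Bool.toNat_true]; omega
  · simp only [h, decide_false, Bool.toNat_false]; omega

/-- Orbits give rise to tilings. -/
theorem Orbit.exists_tiling {e : ℕ → Z.E} {x : ℕ → Z.ι → I} (h : Z.Orbit e x) :
    ∃ T, Z.Tiling T := by
  let X : ℕ → Z.ι ⊕ Z.ι → ℝ := fun t =>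
    Sum.elim (fun i => (x t i : ℝ)) fun i => (x (t + 1) i : ℝ)
  let c : ℕ → ℕ → Z.κ → ℤ := fun n t k =>
    ∑ j, Z.coef k (e t) j * ⌊n * X t j⌋ + n * Z.const k (e t)
  have hX : ∀ t j, X t j ∈ Set.Icc (0 : ℝ) 1 := fun t j => by cases j <;> exact Subtype.property _
  have hc : ∀ n t k, c n t k ∈ Set.Icc (-(Z.bound : ℤ)) Z.bound := by
    intro n t k
    rw [Set.mem_Icc, ← abs_le]
    have h1 : (c n t k : ℝ) = - ∑ j, (Z.coef k (e t) j : ℝ) * Int.fract (n * X t j) := by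
      have := (h t).2 k
      unfold evalForm at this
      have h2 : (Z.const k (e t) : ℝ) = - ∑ j, (Z.coef k (e t) j : ℝ) * X t j := by
        linarith
      simp only [c, Int.fract]
      push_cast
      rw [h2]
      simp only [mul_sub, Finset.sum_sub_distrib]
      rw [mul_neg, Finset.mul_sum]
      simp only [mul_left_comm (n : ℝ)]
      ring
    have h2 : |(c n t k : ℝ)| ≤ Z.bound := by
      rw [h1, abs_neg]
      refine (Finset.abs_sum_le_sum_abs _ _).trans ?_
      have : (∑ j, (((Z.coef k (e t) j).natAbs : ℕ) : ℝ)) ≤ Z.bound := by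
        exact_mod_cast Z.sum_natAbs_le k (e t)
      refine (Finset.sum_le_sum fun j _ => ?_).trans this
      rw [abs_mul, Nat.cast_natAbs, Int.cast_abs, abs_of_nonneg (Int.fract_nonneg (n * X t j))]
      exact mul_le_of_le_one_right (abs_nonneg _) (Int.fract_lt_one _).le
    exact_mod_cast h2
  let T : ℕ → ℕ → Z.Tile := fun n t =>
    ⟨fun i => decide (⌊n * (x t i : ℝ)⌋ < ⌊(n + 1 : ℕ) * (x t i : ℝ)⌋), e t,
      fun k => ⟨c n t k, hc n t k⟩⟩
  refine ⟨T, fun n t => ⟨rfl, (h t).1, fun k => ?_⟩⟩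
  have hb : ∀ j, ((Sum.elim (T n t).bits (T n (t + 1)).bits j).toNat : ℤ) =
      ⌊(n + 1 : ℕ) * X t j⌋ - ⌊n * X t j⌋ := by
    intro j
    cases j <;> exact floor_step (Subtype.property _) n
  change c (n + 1) t k = c n t k + Z.incr k (T n t) (T n (t + 1))
  unfold incr
  simp only [hb]
  simp only [c, mul_sub, Finset.sum_sub_distrib]
  push_cast
  ring

open Filter in
/-- Tilings give rise to orbits. -/
theorem Tiling.exists_orbit {T : ℕ → ℕ → Z.Tile} (h : Z.Tiling T) :
    ∃ x, Z.Orbit (fun t => (T 0 t).e) x := by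
  let S : ℕ → Z.ι → ℕ → ℝ := fun t i N =>
    (∑ n ∈ Finset.range N, (((T n t).bits i).toNat : ℝ)) / N
  have hS : ∀ t i N, S t i N ∈ Set.Icc (0 : ℝ) 1 := by
    intro t i N
    refine ⟨by positivity, div_le_one_of_le₀ ?_ (Nat.cast_nonneg _)⟩
    refine (Finset.sum_le_card_nsmul _ _ 1 fun n _ => ?_).trans (by simp)
    exact_mod_cast Bool.toNat_le _
  have hlim : ∀ t i, ∃ y : I, Tendsto (S t i) (hyperfilter ℕ) (nhds (y : ℝ)) := by
    intro t i
    obtain ⟨y, hy, hle⟩ := isCompact_Icc.ultrafilter_le_nhds ((hyperfilter ℕ).map (S t i))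
      (by
        rw [le_principal_iff]
        exact Filter.mem_map.2 (Filter.univ_mem' (hS t i)))
    exact ⟨⟨y, hy⟩, hle⟩
  choose x hx using hlim
  have he : ∀ n t, (T n t).e = (T 0 t).e := by
    intro n t
    induction n with
    | zero => rfl
    | succ n ih => rw [(h n t).1, ih]
  refine ⟨x, fun t => ⟨(h 0 t).2.1, fun k => ?_⟩⟩
  set e := (T 0 t).e with hedef
  have hsum : ∀ N : ℕ, ((T N t).carry k : ℤ) - (T 0 t).carry k =
      (∑ j, Z.coef k e j * ∑ n ∈ Finset.range N,
        ((Sum.elim (T n t).bits (T n (t + 1)).bits j).toNat : ℤ)) + N * Z.const k e := by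
    intro N
    induction N with
    | zero => simp
    | succ N ih =>
      rw [(h N t).2.2 k]
      have : Z.incr k (T N t) (T N (t + 1)) = ∑ j, Z.coef k e j *
          ((Sum.elim (T N t).bits (T N (t + 1)).bits j).toNat : ℤ) + Z.const k e := by
        unfold incr; rw [he]
      rw [this]
      simp only [Finset.sum_range_succ, mul_add, Finset.sum_add_distrib]
      push_cast
      linarith
  have h1 : Tendsto (fun N : ℕ => (((T N t).carry k : ℤ) - ((T 0 t).carry k : ℤ) : ℝ) / N)
      (hyperfilter ℕ) (nhds 0) := by
    refine Tendsto.mono_left ?_ Nat.hyperfilter_le_atTop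
    refine squeeze_zero_norm (a := fun N : ℕ => (2 * Z.bound : ℝ) / N) (fun N => ?_)
      (tendsto_const_div_atTop_nhds_zero_nat _)
    rw [norm_div, Real.norm_natCast]
    gcongr
    rw [Real.norm_eq_abs, abs_le]
    have a1 := ((T N t).carry k).2
    have a2 := ((T 0 t).carry k).2
    have b1 : (-(Z.bound : ℝ)) ≤ (((T N t).carry k : ℤ) : ℝ) := by exact_mod_cast a1.1
    have b2 : (((T N t).carry k : ℤ) : ℝ) ≤ Z.bound := by exact_mod_cast a1.2
    have b3 : (-(Z.bound : ℝ)) ≤ (((T 0 t).carry k : ℤ) : ℝ) := by exact_mod_cast a2.1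
    have b4 : (((T 0 t).carry k : ℤ) : ℝ) ≤ Z.bound := by exact_mod_cast a2.2
    constructor <;> linarith
  have h2 : Tendsto (fun N : ℕ => evalForm (Z.coef k e)
      (Sum.elim (fun i => S t i N) fun i => S (t + 1) i N) + Z.const k e)
      (hyperfilter ℕ) (nhds (evalForm (Z.coef k e)
        (Sum.elim (fun i => (x t i : ℝ)) fun i => (x (t + 1) i : ℝ)) + Z.const k e)) := by
    refine Tendsto.add_const _ ?_
    unfold evalForm
    refine tendsto_finsetSum _ fun j _ => Tendsto.const_mul _ ?_
    cases j <;> exact hx _ _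
  refine tendsto_nhds_unique (h2.congr' ?_) h1
  have hne : ∀ᶠ N in (hyperfilter ℕ : Filter ℕ), 0 < N :=
    Nat.hyperfilter_le_atTop (eventually_gt_atTop 0)
  filter_upwards [hne] with N hN
  have hN' : (N : ℝ) ≠ 0 := by exact_mod_cast hN.ne'
  rw [eq_div_iff hN']
  have := congrArg (Int.cast : ℤ → ℝ) (hsum N)
  push_cast at this
  rw [this, add_mul, mul_comm (N : ℝ)]
  congr 1
  unfold evalForm
  rw [Finset.sum_mul]
  refine Finset.sum_congr rfl fun j _ => ?_
  rw [mul_assoc]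
  congr 1
  cases j <;> exact div_mul_cancel₀ _ hN'

end AffineSystem

end

section
open unitInterval

/-! ### The nested machine as an affine system -/

namespace StackMachine
variable (M : StackMachine)

/-- The finite part of a configuration of the nested machine, together with the tops of the stacks
and two guessed bits. -/
structure Label where
  ph : Phase
  q : M.Q
  top : M.Idx → M.Sym
  u : Bool
  w : Bool

instance : Finite M.Label :=
  Finite.of_injective (fun a : M.Label => (a.ph, a.q, a.top, a.u, a.w)) fun a b h => by
    cases a; cases b; simp_all

variable {M} in
/-- The transition determined by a label, if there is one. -/
def Label.res? (e : M.Label) : Option M.Res := M.act e.ph e.q e.top e.u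

variable {M} in
/-- The transition determined by a label. -/
def Label.res (e : M.Label) : M.Res := e.res?.getD ⟨.up, M.q0, keep, 0, 0⟩

/-- Registers: stacks, tails of stacks, and the slope, phase and clock registers. -/
abbrev Reg := M.Idx ⊕ M.Idx ⊕ Fin 3

noncomputable instance : Fintype M.Reg := Fintype.ofFinite _

open Classical in
/-- The coefficients of the equations of the nested machine. -/
noncomputable def regCoef : M.Reg → M.Label → M.Reg ⊕ M.Reg → ℤ
  | .inl i, _ => Pi.single (.inl (.inl i)) (M.symBase : ℤ) - Pi.single (.inl (.inr (.inl i))) 1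
  | .inr (.inl i), e =>
    let o := e.res.ops i
    Pi.single (.inr (.inl i)) (o.psh.elim 1 fun _ => (M.symBase : ℤ)) -
      Pi.single (.inl (if o.drop then .inr (.inl o.src) else .inl o.src)) 1
  | .inr (.inr 0), _ => Pi.single (.inr (.inr (.inr 0))) 1 - Pi.single (.inl (.inr (.inr 0))) 1
  | .inr (.inr 1), e => Pi.single (.inr (.inr (.inr 1))) 1 - Pi.single (.inl (.inr (.inr 1))) 1 -
      Pi.single (.inl (.inr (.inr 0))) e.res.dy
  | .inr (.inr 2), _ => Pi.single (.inr (.inr (.inr 2))) 1 - Pi.single (.inl (.inr (.inr 2))) 1 -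
      Pi.single (.inl (.inr (.inr 0))) 1

/-- The constant terms of the equations of the nested machine. -/
noncomputable def regConst : M.Reg → M.Label → ℤ
  | .inl i, e => -(2 * symCode (e.top i) : ℕ)
  | .inr (.inl i), e => (e.res.ops i).psh.elim 0 fun c => -(2 * symCode c : ℕ)
  | .inr (.inr 0), _ => 0
  | .inr (.inr 1), e => e.res.b
  | .inr (.inr 2), e => e.w.toNat

/-- The nested machine as an affine system. -/
noncomputable def toAffine : AffineSystem where
  E := M.Label
  ι := M.Reg
  κ := M.Reg
  finE := inferInstance
  finι := inferInstance
  finκ := inferInstance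
  nxt e e' := ∃ r, e.res? = some r ∧ e'.ph = r.ph ∧ e'.q = r.q
  coef := M.regCoef
  const := M.regConst

variable {M}

/-- The equations relating successive register values. -/
structure RegStep (e : M.Label) (x x' : M.Reg → I) : Prop where
  top : ∀ i, x (.inl i) = push (e.top i) (x (.inr (.inl i)))
  op : ∀ i, x' (.inl i) = (e.res.ops i).psh.elim
    (x (if (e.res.ops i).drop then .inr (.inl (e.res.ops i).src) else .inl (e.res.ops i).src))
    fun c => push c
      (x (if (e.res.ops i).drop then .inr (.inl (e.res.ops i).src) else .inl (e.res.ops i).src))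
  slope : x' (.inr (.inr 0)) = x (.inr (.inr 0))
  phase : (x' (.inr (.inr 1)) : ℝ) =
    x (.inr (.inr 1)) + e.res.dy * (x (.inr (.inr 0)) : ℝ) - e.res.b
  clock : (x' (.inr (.inr 2)) : ℝ) = x (.inr (.inr 2)) + (x (.inr (.inr 0)) : ℝ) - e.w.toNat

theorem eq_push_iff {a : M.Sym} {v w : I} : v = push a w ↔ (M.symBase : ℝ) * v = w + 2 * symCode a := by
  refine ⟨fun h => h ▸ symBase_mul_push a w, fun h => Subtype.ext ?_⟩
  rw [← symBase_mul_push] at h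
  exact mul_left_cancel₀ M.symBase_pos.ne' h

theorem regStep_iff {e : M.Label} {x x' : M.Reg → I} : RegStep e x x' ↔
    ∀ k, evalForm (M.regCoef k e)
      (Sum.elim (fun i => (x i : ℝ)) fun i => (x' i : ℝ)) + M.regConst k e = 0 := by
  constructor
  · rintro ⟨h1, h2, h3, h4, h5⟩ (i | i | i)
    · have := eq_push_iff.1 (h1 i)
      simp only [regCoef, regConst, evalForm_sub, evalForm_single, Sum.elim_inl]
      push_cast
      linarith
    · have := h2 i
      simp only [regCoef, regConst, evalForm_sub, evalForm_single, Sum.elim_inl, Sum.elim_inr]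
      cases hp : (e.res.ops i).psh with
      | none =>
        rw [hp] at this
        have := congrArg (fun v : I => (v : ℝ)) this
        simp only [Option.elim] at this ⊢
        push_cast
        linarith
      | some c =>
        rw [hp] at this
        have := eq_push_iff.1 this
        simp only [Option.elim]
        push_cast
        linarith
    · fin_cases i <;> simp [regCoef, regConst]
      · rw [h3]; ring
      · linarith
      · linarith
  · intro h
    refine ⟨fun i => eq_push_iff.2 ?_, fun i => ?_, Subtype.ext ?_, ?_, ?_⟩
    · have := h (.inl i)
      simp only [regCoef, regConst, evalForm_sub, evalForm_single, Sum.elim_inl] at this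
      push_cast at this
      linarith
    · have := h (.inr (.inl i))
      simp only [regCoef, regConst, evalForm_sub, evalForm_single, Sum.elim_inl,
        Sum.elim_inr] at this
      cases hp : (e.res.ops i).psh with
      | none =>
        simp only [hp, Option.elim] at this ⊢
        push_cast at this
        refine Subtype.ext ?_
        linarith
      | some c =>
        simp only [hp, Option.elim] at this ⊢
        push_cast at this
        refine eq_push_iff.2 ?_
        linarith
    · have := h (.inr (.inr 0))
      simp [regCoef, regConst] at this
      linarith
    · have := h (.inr (.inr 1))
      simp [regCoef, regConst] at this
      linarith
    · have := h (.inr (.inr 2))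
      simp [regCoef, regConst] at this
      linarith

/-- The registers of a configuration. -/
noncomputable def regs (s : I) (o : M.NState) (z : I) : M.Reg → I
  | .inl i => o.S i
  | .inr (.inl i) => tl M (o.S i)
  | .inr (.inr 0) => s
  | .inr (.inr 1) => o.y
  | .inr (.inr 2) => z

theorem orbit_of_nstep {s : I} {o : ℕ → M.NState} (h : ∀ t, M.NStep s (o t) (o (t + 1))) :
    ∃ e x, M.toAffine.Orbit e x := by
  choose hp u r hr h1 h2 h3 h4 using h
  let z : ℕ → I := fun t => ⟨Int.fract (t * (s : ℝ)), Int.fract_nonneg _, (Int.fract_lt_one _).le⟩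
  let e : ℕ → M.Label := fun t => ⟨(o t).ph, (o t).q, fun i => tp M ((o t).S i), u t,
    decide (⌊t * (s : ℝ)⌋ < ⌊(t + 1 : ℕ) * (s : ℝ)⌋)⟩
  have hres : ∀ t, (e t).res? = some (r t) := hr
  have hres' : ∀ t, (e t).res = r t := fun t => by unfold Label.res; rw [hres]; rfl
  refine ⟨e, fun t => regs s (o t) (z t), fun t => ⟨⟨r t, hres t, h1 t, h2 t⟩, ?_⟩⟩
  refine regStep_iff.1 ⟨fun i => (push_tp_tl (hp t i)).symm, fun i => ?_, rfl, ?_, ?_⟩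
  · rw [hres']
    refine (congrFun (h3 t) i).trans ?_
    unfold opVal
    cases ((r t).ops i).drop <;> rfl
  · rw [hres']
    exact h4 t
  · have := AffineSystem.floor_step s.2 t
    have : (((e t).w.toNat : ℤ) : ℝ) = ⌊(t + 1 : ℕ) * (s : ℝ)⌋ - ⌊t * (s : ℝ)⌋ := by
      rw [this]; push_cast; rfl
    change Int.fract ((t + 1 : ℕ) * (s : ℝ)) = Int.fract (t * (s : ℝ)) + s - _
    rw [Int.cast_natCast] at this
    rw [this]
    unfold Int.fract
    push_cast
    ring

theorem nstep_of_orbit {e : ℕ → M.Label} {x : ℕ → M.Reg → I} (h : M.toAffine.Orbit e x) :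
    ∃ (s : ℝ) (o : ℕ → M.NState), (∀ t, M.NStep s (o t) (o (t + 1))) ∧
      ∀ n, |(((List.range n).map fun t => (e t).w).count true : ℝ) - n * s| ≤ 1 := by
  choose r hr h1 h2 using fun t => (h t).1
  have hs : ∀ t, RegStep (e t) (x t) (x (t + 1)) := fun t => regStep_iff.2 (h t).2
  have hres' : ∀ t, (e t).res = r t := fun t => by unfold Label.res; rw [hr]; rfl
  have hc : ∀ t, x t (.inr (.inr 0)) = x 0 (.inr (.inr 0)) := fun t => by
    induction t with
    | zero => rfl
    | succ t ih => rw [(hs t).slope, ih]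
  refine ⟨x 0 (.inr (.inr 0)), fun t => ⟨(e t).ph, (e t).q, fun i => x t (.inl i),
    x t (.inr (.inr 1))⟩, fun t => ⟨fun i => ⟨_, _, (hs t).top i⟩,
      (e t).u, r t, ?_, h1 t, h2 t, funext fun i => ?_, ?_⟩, fun n => ?_⟩
  · refine Eq.trans ?_ (hr t)
    unfold Label.res?
    congr 1
    funext i
    simp [(hs t).top i]
  · have := (hs t).op i
    rw [hres'] at this
    refine this.trans ?_
    simp only [opVal]
    cases ((r t).ops i).drop
    · rfl
    · simp [(hs t).top]
  · have := (hs t).phase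
    rw [hres', hc] at this
    exact this
  · have : (((List.range n).map fun t => (e t).w).count true : ℝ) =
        n * (x 0 (.inr (.inr 0)) : ℝ) + x 0 (.inr (.inr 2)) - x n (.inr (.inr 2)) := by
      induction n with
      | zero => simp
      | succ n ih =>
        have hn := (hs n).clock
        rw [hc] at hn
        rw [List.range_succ, List.map_append, List.count_append]
        have : ([n].map fun t => (e t).w).count true = (e n).w.toNat := by
          cases hw : (e n).w <;> simp [hw]
        rw [this]
        push_cast
        rw [ih]
        linarith
    rw [this, abs_le]
    have h0 := (x 0 (.inr (.inr 2))).2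
    have hn := (x n (.inr (.inr 2))).2
    constructor <;> linarith [h0.1, h0.2, hn.1, hn.2]

end StackMachine

/-- The bit coded by the number of marked letters in a block. -/
def readBit (c : ℕ) : ℕ := if c / 16 % 8 = 3 then 1 else 0

/-- A finite set of tiles all of whose quadrant tilings compute, along a boundary line, a point of
`diagClass`. -/
theorem exists_tiles : ∃ (A : Type) (_ : Finite A) (Loc : A → A → A → Prop) (lab : A → Bool),
    (∃ T : ℕ → ℕ → A, ∀ n t, Loc (T n t) (T (n + 1) t) (T n (t + 1))) ∧
    ∀ T : ℕ → ℕ → A, (∀ n t, Loc (T n t) (T (n + 1) t) (T n (t + 1))) →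
      (fun j => readBit (((List.range (16 * 8 ^ (j + 1))).map fun t => lab (T 0 t)).count true)) ∈
        diagClass := by
  obtain ⟨M, ⟨s, o, ho⟩, hM⟩ := exists_nested
  refine ⟨M.toAffine.Tile, inferInstance, M.toAffine.Loc, fun a => a.e.w, ?_, fun T hT => ?_⟩
  · obtain ⟨e, x, hx⟩ := StackMachine.orbit_of_nstep ho
    exact hx.exists_tiling
  · obtain ⟨x, hx⟩ := AffineSystem.Tiling.exists_orbit hT
    obtain ⟨s, o, ho, hc⟩ := StackMachine.nstep_of_orbit hx
    obtain ⟨hd, hdig⟩ := hM s o ho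
    convert hd using 1
    funext j
    unfold readBit digit
    rw [hdig (j + 1) _ (by simpa using hc (16 * 8 ^ (j + 1)))]

end

/-! ### Subshifts of finite type from local rules -/

section
variable {G A : Type*} [Group G]

theorem isSFT_of_local {N : ℕ} (D : Finset G) (P : (G → Fin N) → Prop)
    (hP : ∀ x y, (∀ g ∈ D, x g = y g) → P x → P y) :
    IsSFT {x : G → Fin N | ∀ g, P fun h => x (g * h)} := by
  classical
  let bad : Finset ({g // g ∈ D} → Fin N) :=
    Finset.univ.filter fun p => ∃ y, (∀ g : {g // g ∈ D}, y g = p g) ∧ ¬ P y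
  refine ⟨bad.toList.map fun p => ⟨D, p⟩, Set.ext fun x => ?_⟩
  constructor
  · intro h p hp g hm
    obtain ⟨p, hp', rfl⟩ := List.mem_map.1 hp
    obtain ⟨y, hy, hPy⟩ := (Finset.mem_filter.1 (Finset.mem_toList.1 hp')).2
    refine hPy (hP _ y (fun g' hg' => ?_) (h g⁻¹))
    rw [hy ⟨g', hg'⟩]
    exact hm ⟨g', hg'⟩
  · intro h g
    by_contra hg
    refine h ⟨D, fun d => x (g * d)⟩ (List.mem_map.2 ⟨_, Finset.mem_toList.2
      (Finset.mem_filter.2 ⟨Finset.mem_univ _, _, fun d => rfl, hg⟩), rfl⟩) g⁻¹ fun d => ?_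
    simp [shift]

theorem nonempty_of_local {N : ℕ} (D : Finset G) (P : (G → Fin N) → Prop)
    (hP : ∀ x y, (∀ g ∈ D, x g = y g) → P x → P y)
    (h : ∀ F : Finset G, ∃ x : G → Fin N, ∀ g ∈ F, P fun h => x (g * h)) :
    {x : G → Fin N | ∀ g, P fun h => x (g * h)}.Nonempty := by
  have key := (isCompact_univ (X := G → Fin N)).inter_iInter_nonempty
    (fun g : G => {x | P fun h => x (g * h)}) (fun g => ?_) fun F => ?_
  · obtain ⟨x, -, hx⟩ := key
    exact ⟨x, Set.mem_iInter.1 hx⟩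
  · let f : (G → Fin N) → ({d // d ∈ D} → Fin N) := fun x d => x (g * d)
    have hf : Continuous f := continuous_pi fun d => continuous_apply _
    have hc := (isClosed_discrete {p | ∃ x : G → Fin N, f x = p ∧ P fun h => x (g * h)}).preimage hf
    convert hc using 1
    ext x
    refine ⟨fun hx => ⟨x, rfl, hx⟩, ?_⟩
    rintro ⟨y, hy, hPy⟩
    exact hP _ _ (fun d hd => congrFun hy ⟨d, hd⟩) hPy
  · obtain ⟨x, hx⟩ := h F
    exact ⟨x, trivial, Set.mem_iInter₂.2 hx⟩

end

/-! ### Long geodesics -/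

section
variable {G : Type*} [Group G] {k : ℕ} {σ : Fin k → G}

theorem IsSymmGen.exists_word (hσ : IsSymmGen σ) (g : G) :
    ∃ w : List (Fin k), (w.map σ).prod = g := by
  have hg : g ∈ (Subgroup.closure (Set.range σ)).toSubmonoid := by rw [hσ.1]; trivial
  rw [Subgroup.closure_toSubmonoid] at hg
  obtain ⟨l, hl, rfl⟩ := Submonoid.exists_list_of_mem_closure hg
  have : ∀ x ∈ l, ∃ i, σ i = x := fun x hx => by
    rcases hl x hx with h | h
    · exact h
    · obtain ⟨i, hi⟩ := h
      obtain ⟨j, hj⟩ := hσ.2 i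
      exact ⟨j, by rw [hj, hi, inv_inv]⟩
  obtain ⟨w, rfl⟩ : l ∈ Set.range (List.map σ) := by rw [Set.range_list_map]; exact this
  exact ⟨w, rfl⟩

theorem wordNorm_le (w : List (Fin k)) : wordNorm σ (w.map σ).prod ≤ w.length :=
  Nat.sInf_le ⟨w, rfl, rfl⟩

theorem IsSymmGen.exists_length_eq (hσ : IsSymmGen σ) (g : G) :
    ∃ w : List (Fin k), w.length = wordNorm σ g ∧ (w.map σ).prod = g := by
  obtain ⟨w, hw⟩ := hσ.exists_word g
  exact Nat.sInf_mem (s := {n | ∃ w : List (Fin k), w.length = n ∧ (w.map σ).prod = g})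
    ⟨_, w, rfl, hw⟩

theorem IsSymmGen.exists_wordNorm_eq (hσ : IsSymmGen σ) {g : G} (hg : g ≠ 1) :
    ∃ i, wordNorm σ g = wordNorm σ ((σ i)⁻¹ * g) + 1 := by
  obtain ⟨w, hw, hwg⟩ := hσ.exists_length_eq g
  cases w with
  | nil => exact absurd hwg.symm (by simpa using hg)
  | cons i w =>
    have hg' : (σ i)⁻¹ * g = (w.map σ).prod := by rw [← hwg]; simp
    refine ⟨i, le_antisymm ?_ ?_⟩
    · obtain ⟨v, hv, hvg⟩ := hσ.exists_length_eq ((σ i)⁻¹ * g)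
      have := wordNorm_le (σ := σ) (i :: v)
      rw [List.map_cons, List.prod_cons, hvg, mul_inv_cancel_left] at this
      simpa [hv] using this
    · have := wordNorm_le (σ := σ) w
      rw [← hg'] at this
      simp only [List.length_cons] at hw
      omega

/-- Every finite part of an infinite group is foliated by geodesics. -/
theorem IsSymmGen.exists_direction [Infinite G] (hσ : IsSymmGen σ) (F : Finset G) :
    ∃ (d : G → Fin k) (p : G → ℕ), ∀ g ∈ F, p (g * σ (d g)) = p g + 1 := by
  obtain ⟨a, ha⟩ := F.exists_notMem
  have hi : Nonempty (Fin k) := by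
    obtain ⟨g, hg⟩ := exists_ne (1 : G)
    exact ⟨(hσ.exists_wordNorm_eq hg).choose⟩
  have : ∀ g ∈ F, ∃ i, wordNorm σ (g⁻¹ * a) = wordNorm σ ((g * σ i)⁻¹ * a) + 1 := fun g hg => by
    have : g⁻¹ * a ≠ 1 := fun h => ha (by rwa [← inv_mul_eq_one.1 h])
    simpa only [mul_inv_rev, mul_assoc] using hσ.exists_wordNorm_eq this
  choose! d hd using this
  refine ⟨d, fun g => F.sup (fun g => wordNorm σ (g⁻¹ * a)) - wordNorm σ (g⁻¹ * a),
    fun g hg => ?_⟩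
  have h1 := hd g hg
  have h2 := Finset.le_sup (f := fun g => wordNorm σ (g⁻¹ * a)) hg
  simp only at h2 ⊢
  omega

end

section
/-! ### Tilings of the quadrant inside products of infinite groups -/

section
variable {H K A : Type*} [Group H] [Group K] {k r : ℕ} (σ : Fin k → H) (τ : Fin r → K)

/-- The local rule: directions in `H` and in `K` are locally constant along the other factor, and
tiles match along the directions. -/
def ProductRule (Loc : A → A → A → Prop) (b : H × K → Fin k × Fin r × A) : Prop :=
  (∀ j, (b (1, τ j)).1 = (b 1).1) ∧ (∀ i, (b (σ i, 1)).2.1 = (b 1).2.1) ∧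
    Loc (b 1).2.2 (b (σ (b 1).1, 1)).2.2 (b (1, τ (b 1).2.1)).2.2

open Classical in
/-- The window of the local rule. -/
noncomputable def productWindow : Finset (H × K) :=
  insert 1 (Finset.univ.image (fun i => (σ i, (1 : K))) ∪
    Finset.univ.image fun j => ((1 : H), τ j))

variable {σ τ}

theorem ProductRule.congr {Loc : A → A → A → Prop} {b c : H × K → Fin k × Fin r × A}
    (hbc : ∀ g ∈ productWindow σ τ, b g = c g) (h : ProductRule σ τ Loc b) :
    ProductRule σ τ Loc c := by
  have h1 : b 1 = c 1 := hbc _ (by simp [productWindow])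
  have hH : ∀ i, b (σ i, 1) = c (σ i, 1) := fun i => hbc _ (by simp [productWindow])
  have hK : ∀ j, b (1, τ j) = c (1, τ j) := fun j => hbc _ (by simp [productWindow])
  unfold ProductRule at h ⊢
  simpa only [h1, hH, hK] using h

theorem exists_productRule [Infinite H] [Infinite K] (hσ : IsSymmGen σ) (hτ : IsSymmGen τ)
    {Loc : A → A → A → Prop} {T : ℕ → ℕ → A}
    (hT : ∀ n t, Loc (T n t) (T (n + 1) t) (T n (t + 1))) (F : Finset (H × K)) :
    ∃ b : H × K → Fin k × Fin r × A, ∀ g ∈ F, ProductRule σ τ Loc fun h => b (g * h) := by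
  classical
  obtain ⟨d, p, hp⟩ := hσ.exists_direction (F.image Prod.fst)
  obtain ⟨e, q, hq⟩ := hτ.exists_direction (F.image Prod.snd)
  refine ⟨fun g => (d g.1, e g.2, T (p g.1) (q g.2)), fun g hg => ⟨fun j => ?_, fun i => ?_, ?_⟩⟩
  · simp
  · simp
  · have h1 := hp _ (Finset.mem_image_of_mem _ hg)
    have h2 := hq _ (Finset.mem_image_of_mem _ hg)
    simpa [h1, h2] using hT (p g.1) (q g.2)

variable (σ τ)

/-- The path following the directions in the first factor. -/
def pathH (b : H × K → Fin k × Fin r × A) : ℕ → H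
  | 0 => 1
  | n + 1 => pathH b n * σ (b (pathH b n, 1)).1

/-- The path following the directions in the second factor. -/
def pathK (b : H × K → Fin k × Fin r × A) : ℕ → K
  | 0 => 1
  | t + 1 => pathK b t * τ (b (1, pathK b t)).2.1

variable {σ τ}

theorem ProductRule.tiling {Loc : A → A → A → Prop} {b : H × K → Fin k × Fin r × A}
    (h : ∀ g, ProductRule σ τ Loc fun h => b (g * h)) (n t : ℕ) :
    Loc (b (pathH σ b n, pathK τ b t)).2.2 (b (pathH σ b (n + 1), pathK τ b t)).2.2
      (b (pathH σ b n, pathK τ b (t + 1))).2.2 := by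
  have h1 : ∀ x t, (b (x, pathK τ b t)).1 = (b (x, 1)).1 := fun x t => by
    induction t with
    | zero => rfl
    | succ t ih =>
      rw [← ih]
      simpa [pathK] using (h (x, pathK τ b t)).1 (b (1, pathK τ b t)).2.1
  have h2 : ∀ n y, (b (pathH σ b n, y)).2.1 = (b (1, y)).2.1 := fun n y => by
    induction n with
    | zero => rfl
    | succ n ih =>
      rw [← ih]
      simpa [pathH] using (h (pathH σ b n, y)).2.1 (b (pathH σ b n, 1)).1
  have := (h (pathH σ b n, pathK τ b t)).2.2
  simpa [h1, h2, pathH, pathK] using this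

end

/-! ### Following a path in an encoded configuration -/

/-- Follow a path, each step of which depends on the current letter, and count marked letters; the
argument `l` is a prefix of the encoding of a configuration. -/
def follow {m : ℕ} (tab : List (List (Fin m × Bool) × ℕ)) (l : List ℕ) :
    ℕ → Option (List (Fin m × Bool) × ℕ)
  | 0 => some ([], 0)
  | n + 1 => (follow tab l n).bind fun s => (l[Encodable.encode s.1]?).map fun v =>
      (s.1 ++ (tab[v]?.getD ([], 0)).1, s.2 + (tab[v]?.getD ([], 0)).2)

theorem follow_computable {m : ℕ} (tab : List (List (Fin m × Bool) × ℕ)) :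
    Primrec₂ (follow tab) := by
  have hv : Primrec fun v : ℕ => tab[v]?.getD ([], 0) :=
    Primrec.option_getD.comp (Primrec.list_getElem?.comp (Primrec.const tab) Primrec.id)
      (Primrec.const _)
  have hstep : Primrec₂ fun (l : List ℕ) (s : List (Fin m × Bool) × ℕ) =>
      (l[Encodable.encode s.1]?).map fun v =>
        (s.1 ++ (tab[v]?.getD ([], 0)).1, s.2 + (tab[v]?.getD ([], 0)).2) := by
    refine Primrec.option_map (Primrec.list_getElem?.comp Primrec.fst
      (Primrec.encode.comp (Primrec.fst.comp Primrec.snd))) ?_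
    have hv' := hv.comp (Primrec.snd (α := List ℕ × List (Fin m × Bool) × ℕ) (β := ℕ))
    have hs := Primrec.snd.comp (Primrec.fst (α := List ℕ × List (Fin m × Bool) × ℕ) (β := ℕ))
    exact Primrec.pair (Primrec.list_append.comp (Primrec.fst.comp hs) (Primrec.fst.comp hv'))
      (Primrec.nat_add.comp (Primrec.snd.comp hs) (Primrec.snd.comp hv'))
  refine (Primrec.nat_rec (f := fun _ : List ℕ => some (([] : List (Fin m × Bool)), 0))
    (g := fun l (p : ℕ × Option (List (Fin m × Bool) × ℕ)) => p.2.bind fun s =>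
      (l[Encodable.encode s.1]?).map fun v =>
        (s.1 ++ (tab[v]?.getD ([], 0)).1, s.2 + (tab[v]?.getD ([], 0)).2))
    (Primrec.const _) ?_).of_eq fun l n => ?_
  · exact Primrec.option_bind (Primrec.snd.comp Primrec.snd)
      (hstep.comp (Primrec.fst.comp Primrec.fst) Primrec.snd)
  · induction n with
    | zero => rfl
    | succ n ih =>
      simp only [follow]
      rw [← ih]

theorem follow_mono {m : ℕ} (tab : List (List (Fin m × Bool) × ℕ)) {l₁ l₂ : List ℕ}
    (h : l₁ <+: l₂) {n : ℕ} {s} (hs : follow tab l₁ n = some s) : follow tab l₂ n = some s := by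
  induction n generalizing s with
  | zero => exact hs
  | succ n ih =>
    obtain ⟨s', hs', hm⟩ := Option.bind_eq_some_iff.1 hs
    obtain ⟨v, hv, hvs⟩ := Option.map_eq_some_iff.1 hm
    refine Option.bind_eq_some_iff.2 ⟨s', ih hs', Option.map_eq_some_iff.2 ⟨v, ?_, hvs⟩⟩
    obtain ⟨l, rfl⟩ := h
    obtain ⟨hlt, -⟩ := List.getElem?_eq_some_iff.1 hv
    rwa [List.getElem?_append_left hlt]

/-- The value of `readBit` after following a path of length `16 * 8 ^ (j + 1)`. -/
theorem readBit_follow_computable {m : ℕ} (tab : List (List (Fin m × Bool) × ℕ)) :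
    Computable₂ fun (l : List ℕ) (j : ℕ) =>
      (follow tab l (16 * 8 ^ (j + 1))).map fun s => readBit s.2 := by
  have hpow : Primrec fun j : ℕ => 16 * 8 ^ (j + 1) := by
    refine (Primrec.nat_rec₁ (f := fun _ p => 8 * p) 128
      (Primrec.nat_mul.comp (Primrec.const 8) Primrec.snd)).of_eq fun j => ?_
    induction j with
    | zero => rfl
    | succ j ih => change 8 * _ = _; rw [ih]; ring
  have hread : Primrec readBit := by
    have h' : PrimrecPred fun c : ℕ => c / 16 % 8 = 3 :=
      Primrec.eq.comp (Primrec.nat_mod.comp (Primrec.nat_div.comp Primrec.id (Primrec.const 16))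
        (Primrec.const 8)) (Primrec.const 3)
    exact Primrec.ite h' (Primrec.const 1) (Primrec.const 0)
  exact (Primrec.option_map ((follow_computable tab).comp Primrec.fst (hpow.comp Primrec.snd))
    (Primrec.comp₂ hread (Primrec.snd.comp Primrec.snd).to₂)).to_comp

theorem cover_surjective {G : Type*} [Group G] {m : ℕ} {ν : Fin m → G} (hν : IsSymmGen ν) :
    Function.Surjective (cover ν) := by
  rw [← MonoidHom.range_eq_top, cover, FreeGroup.range_lift_eq_closure]
  exact hν.1

theorem confFun_mk {m N : ℕ} (y : FreeGroup (Fin m) → Fin N) (L : List (Fin m × Bool)) :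
    confFun y (Encodable.encode L) = (y (FreeGroup.mk L) : ℕ) + 1 := by
  have : Encodable.decode (α := FreeGroup (Fin m)) (Encodable.encode L) =
      some (FreeGroup.mk L) := by
    change (Encodable.decode (Encodable.encode L)).bind _ = _
    rw [Encodable.encodek]
    rfl
  unfold confFun
  rw [this]
  rfl

end

/-- A nonempty subshift of finite type on a product of infinite groups all of whose
configurations compute a point of `diagClass`. -/
theorem exists_sft {H K : Type*} [Group H] [Group K] [Infinite H] [Infinite K]
    {k r m : ℕ} {σ : Fin k → H} (hσ : IsSymmGen σ) {τ : Fin r → K} (hτ : IsSymmGen τ)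
    {ν : Fin m → H × K} (hν : IsSymmGen ν) :
    ∃ (n : ℕ) (X : Set (H × K → Fin n)), IsSFT X ∧ X.Nonempty ∧
      BaireLE diagClass (mSet (pullback (cover ν) X)) := by
  obtain ⟨A, hA, Loc, lab, ⟨T, hT⟩, hread⟩ := exists_tiles
  let f : Fin k × Fin r × A ≃ Fin (Nat.card (Fin k × Fin r × A)) := Finite.equivFin _
  let P : (H × K → Fin (Nat.card (Fin k × Fin r × A))) → Prop := fun x =>
    ProductRule σ τ Loc fun g => f.symm (x g)
  have hP : ∀ x y, (∀ g ∈ productWindow σ τ, x g = y g) → P x → P y := fun x y hxy =>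
    ProductRule.congr fun g hg => by rw [hxy g hg]
  refine ⟨_, _, isSFT_of_local (productWindow σ τ) P hP,
    nonempty_of_local (productWindow σ τ) P hP fun F => ?_, ?_⟩
  · obtain ⟨b, hb⟩ := exists_productRule hσ hτ hT F
    exact ⟨fun g => f (b g), fun g hg => by simpa only [P, Equiv.symm_apply_apply] using hb g hg⟩
  · have hw : ∀ j, ∃ L, cover ν (FreeGroup.mk L) = (1, τ j) := fun j => by
      obtain ⟨g, hg⟩ := cover_surjective hν (1, τ j)
      exact ⟨g.toWord, by rw [FreeGroup.mk_toWord, hg]⟩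
    choose wd hwd using hw
    let tab : List (List (Fin m × Bool) × ℕ) :=
      ([], 0) :: List.ofFn fun v => (wd (f.symm v).2.1, (lab (f.symm v).2.2).toNat)
    refine baireLE_of_partial _ (readBit_follow_computable tab) (fun l₁ l₂ n v hl hv => ?_) ?_
    · obtain ⟨s, hs, rfl⟩ := Option.map_eq_some_iff.1 hv
      exact Option.map_eq_some_iff.2 ⟨s, follow_mono tab hl hs, rfl⟩
    · rintro _ ⟨_, ⟨x, hx, rfl⟩, rfl⟩
      let b : H × K → Fin k × Fin r × A := fun g => f.symm (x g)
      have hb : ∀ g, ProductRule σ τ Loc fun h => b (g * h) := hx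
      have hpath : ∀ n, ∃ L, cover ν (FreeGroup.mk L) = (1, pathK τ b n) ∧ ∃ l,
          follow tab (pref (confFun (x ∘ cover ν)) l) n = some (L,
            ((List.range n).map fun t =>
              lab (b (pathH σ b 0, pathK τ b t)).2.2).count true) := fun n => by
        induction n with
        | zero => exact ⟨[], map_one _, 0, rfl⟩
        | succ n ih =>
          obtain ⟨L, hL, l, hl⟩ := ih
          have hc : (pref (confFun (x ∘ cover ν)) (max l (Encodable.encode L + 1)))[
              Encodable.encode L]? = some ((x (1, pathK τ b n) : ℕ) + 1) := by
            rw [pref_getElem? _ (by omega), confFun_mk, Function.comp_apply, hL]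
          have htab : tab[(x (1, pathK τ b n) : ℕ) + 1]? = some (wd (b (1, pathK τ b n)).2.1,
              (lab (b (1, pathK τ b n)).2.2).toNat) := by
            rw [List.getElem?_cons_succ, List.getElem?_ofFn, dif_pos (Fin.is_lt _)]
          refine ⟨L ++ wd (b (1, pathK τ b n)).2.1, ?_, max l (Encodable.encode L + 1), ?_⟩
          · rw [← FreeGroup.mul_mk, map_mul, hL, hwd]
            simp [pathK]
          · rw [follow, follow_mono tab (pref_prefix _ (le_max_left _ _)) hl, Option.bind_some, hc,
              Option.map_some, htab, List.range_succ, List.map_append, List.count_append]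
            cases hlab : lab (b (1, pathK τ b n)).2.2 <;> simp [pathH, hlab]
      refine ⟨_, hread _ (ProductRule.tiling hb), fun j => ?_⟩
      obtain ⟨L, -, l, hl⟩ := hpath (16 * 8 ^ (j + 1))
      exact ⟨l, by rw [hl]; rfl⟩

/-- For any two infinite finitely generated groups `H`, `K`, the product `H × K` admits a
nonempty SFT of nonzero Medvedev degree; moreover, if `H` and `K` are recursively
presented, then `M_SFT(H × K)` contains a degree which is bounded below by the maximal
`Π⁰₁` Medvedev degree. -/
theorem statement14 {H K : Type*} [Group H] [Group K] [Infinite H] [Infinite K]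
    {k r m : ℕ} (σ : Fin k → H) (hσ : IsSymmGen σ) (τ : Fin r → K) (hτ : IsSymmGen τ)
    (ν : Fin m → H × K) (hν : IsSymmGen ν) :
    (∃ (n : ℕ) (X : Set (H × K → Fin n)), IsSFT X ∧ X.Nonempty ∧
      ∀ y ∈ mSet (pullback (cover ν) X), ¬Computable y) ∧
    (RecursivelyPresented σ → RecursivelyPresented τ →
      ∃ (n : ℕ) (X : Set (H × K → Fin n)), IsSFT X ∧ X.Nonempty ∧
        ∃ P : Set (ℕ → ℕ), IsMaxPi01 P ∧ BaireLE P (mSet (pullback (cover ν) X))) := by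
  obtain ⟨n, X, hX, hne, hle⟩ := exists_sft hσ hτ hν
  exact ⟨⟨n, X, hX, hne, fun y hy => not_computable_of_baireLE hle hy⟩,
    fun _ _ => ⟨n, X, hX, hne, _, diagClass_isMaxPi01, hle⟩⟩

end MedvedevFormal
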